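/- Let Ω ⊆ ℝ² be a polygonal domain and let 2 ≤ q ≤ ∞, with δ(q) = (1/2)(1/2 − 1/q) when 2 ≤ q ≤ 6 and δ(q) = 2(1/2 − 1/q) − 1/2 when q ≥ 6 (so δ(∞) = 1/2). There exists a constant C = C(Ω,q) such that every function φ : Ω → ℝ which is smooth on Ω, extends continuously to the closure of Ω, vanishes on the boundary of Ω, satisfies −Δφ = λ²φ on Ω for some λ ≥ 1, and has ‖φ‖_{L²(Ω)} = 1, obeys ‖φ‖_{L^q(Ω)} ≤ C λ^{δ(q)}. -/

import Mathlib

open MeasureTheory Set Filter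
open scoped ENNReal

/-- The Euclidean Laplacian `∂²/∂x² + ∂²/∂y²` on `ℝ²`. -/
noncomputable def planeLaplacian (φ : EuclideanSpace ℝ (Fin 2) → ℝ)
    (x : EuclideanSpace ℝ (Fin 2)) : ℝ :=
  ∑ i : Fin 2,
    fderiv ℝ (fun y => fderiv ℝ φ y (EuclideanSpace.single i 1)) x (EuclideanSpace.single i 1)

/-- A polygonal domain: a bounded, open, connected subset of `ℝ²` whose boundary is a
finite union of closed line segments. -/
def IsPolygonalDomain (Ω : Set (EuclideanSpace ℝ (Fin 2))) : Prop :=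
  IsOpen Ω ∧ IsConnected Ω ∧ Bornology.IsBounded Ω ∧
    ∃ (n : ℕ) (a b : Fin n → EuclideanSpace ℝ (Fin 2)),
      frontier Ω = ⋃ i, segment ℝ (a i) (b i)

namespace PolyEig
open Real

lemma lintegral_ray_le {k : ℝ → ℝ≥0∞} {g G : ℝ → ℝ} (hg : ∀ y, HasDerivAt g (G y) y)
    (hG : Monotone fun y => G y - y) (m b c s : ℝ) (hcs : c ^ 2 + s ^ 2 = 1) :
    ∫⁻ ρ in Ioi (0 : ℝ), ENNReal.ofReal ρ *
      k (b - (g (m + ρ * c) + g (m + ρ * s) + g (m - ρ * c - ρ * s))) ≤ ∫⁻ u, k u := by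
  set h : ℝ → ℝ := fun ρ => b - (g (m + ρ * c) + g (m + ρ * s) + g (m - ρ * c - ρ * s)) with hh
  set h' : ℝ → ℝ := fun ρ =>
    -(G (m + ρ * c) * c + G (m + ρ * s) * s + G (m - ρ * c - ρ * s) * (-c - s)) with hh'
  have hd : ∀ ρ, HasDerivAt h (h' ρ) ρ := by
    intro ρ
    have h1 : HasDerivAt (fun ρ : ℝ => m + ρ * c) c ρ := by
      simpa using ((hasDerivAt_id ρ).mul_const c).const_add m
    have h2 : HasDerivAt (fun ρ : ℝ => m + ρ * s) s ρ := by
      simpa using ((hasDerivAt_id ρ).mul_const s).const_add m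
    have h3 : HasDerivAt (fun ρ : ℝ => m - ρ * c - ρ * s) (-c - s) ρ := by
      simpa using (((hasDerivAt_id ρ).mul_const c).const_sub m).fun_sub
        ((hasDerivAt_id ρ).mul_const s)
    exact ((((hg _).comp ρ h1).add ((hg _).comp ρ h2)).add ((hg _).comp ρ h3)).const_sub b
  have key : ∀ ρ, 0 < ρ → ∀ e : ℝ, ρ * e ^ 2 ≤ (G (m + ρ * e) - G m) * e := by
    intro ρ hρ e
    rcases le_total 0 e with he | he
    · have := hG (show m ≤ m + ρ * e by nlinarith [mul_nonneg hρ.le he])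
      simp only at this
      nlinarith
    · have := hG (show m + ρ * e ≤ m by nlinarith [mul_nonneg hρ.le (neg_nonneg.2 he)])
      simp only at this
      nlinarith
  have hlow : ∀ ρ, 0 < ρ → ρ ≤ -h' ρ := by
    intro ρ hρ
    have h1 := key ρ hρ c
    have h2 := key ρ hρ s
    have h3 := key ρ hρ (-c - s)
    rw [show m + ρ * (-c - s) = m - ρ * c - ρ * s by ring] at h3
    have : ρ * (c ^ 2 + s ^ 2) = ρ := by rw [hcs, mul_one]
    simp only [hh']
    nlinarith [mul_nonneg hρ.le (sq_nonneg (-c - s))]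
  have hinj : InjOn h (Ioi 0) := by
    have : StrictAntiOn h (Ici 0) := by
      apply strictAntiOn_of_deriv_neg (convex_Ici 0)
        (fun x _ => (hd x).continuousAt.continuousWithinAt)
      intro x hx
      rw [interior_Ici] at hx
      rw [(hd x).deriv]
      linarith [hlow x hx, show (0 : ℝ) < x from hx]
    exact this.injOn.mono Ioi_subset_Ici_self
  calc ∫⁻ ρ in Ioi (0 : ℝ), ENNReal.ofReal ρ * k (h ρ)
      ≤ ∫⁻ ρ in Ioi (0 : ℝ), ENNReal.ofReal |h' ρ| * k (h ρ) := by
        refine setLIntegral_mono' measurableSet_Ioi fun ρ hρ => ?_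
        gcongr
        exact (hlow ρ hρ).trans (neg_le_abs _)
    _ = ∫⁻ u in h '' Ioi 0, k u :=
        (lintegral_image_eq_lintegral_abs_deriv_mul measurableSet_Ioi
          (fun x _ => (hd x).hasDerivWithinAt) hinj k).symm
    _ ≤ ∫⁻ u, k u := setLIntegral_le_lintegral _ _

lemma lintegral_plane_le {k : ℝ → ℝ≥0∞} (hk : Measurable k) {g G : ℝ → ℝ}
    (hg : ∀ y, HasDerivAt g (G y) y) (hG : Monotone fun y => G y - y) (m b : ℝ) :
    ∫⁻ z : ℝ × ℝ, k (b - (g (m + z.1) + g (m + z.2) + g (m - z.1 - z.2))) ≤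
      ENNReal.ofReal (2 * π) * ∫⁻ u, k u := by
  have hgc : Continuous g := continuous_iff_continuousAt.2 fun y => (hg y).continuousAt
  rw [← lintegral_comp_polarCoord_symm]
  have ht : polarCoord.target = Ioi (0 : ℝ) ×ˢ Ioo (-π) π := rfl
  rw [ht, Measure.volume_eq_prod, ← Measure.prod_restrict, lintegral_prod_symm]
  · calc _ ≤ ∫⁻ θ in Ioo (-π) π, ∫⁻ u, k u := by
          refine lintegral_mono fun θ => ?_
          simp only [polarCoord_symm_apply, smul_eq_mul]
          exact lintegral_ray_le hg hG m b (cos θ) (sin θ) (by rw [add_comm]; exact sin_sq_add_cos_sq θ)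
      _ = _ := by
          rw [lintegral_const, Measure.restrict_apply_univ, Real.volume_Ioo, mul_comm]
          congr 2; ring
  · apply Measurable.aemeasurable
    simp only [polarCoord_symm_apply, smul_eq_mul]
    refine (ENNReal.measurable_ofReal.comp measurable_fst).mul (hk.comp ?_)
    fun_prop

lemma lintegral_three_le {k : ℝ → ℝ≥0∞} (hk : Measurable k) {g G : ℝ → ℝ}
    (hg : ∀ y, HasDerivAt g (G y) y) (hG : Monotone fun y => G y - y) (a b : ℝ) :
    ∫⁻ y₁, ∫⁻ y₂, ∫⁻ y₃, k (a - (y₁ + y₂ + y₃)) * k (b - (g y₁ + g y₂ + g y₃)) ≤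
      ENNReal.ofReal (2 * π) * (∫⁻ u, k u) * ∫⁻ u, k u := by
  have hgc : Continuous g := continuous_iff_continuousAt.2 fun y => (hg y).continuousAt
  have e1 : ∀ y₁ y₂ : ℝ, ∫⁻ y₃, k (a - (y₁ + y₂ + y₃)) * k (b - (g y₁ + g y₂ + g y₃)) =
      ∫⁻ σ, k (a - σ) * k (b - (g y₁ + g y₂ + g (σ - y₁ - y₂))) := by
    intro y₁ y₂
    rw [← lintegral_add_left_eq_self _ (-(y₁ + y₂))]
    refine lintegral_congr fun σ => ?_
    congr 2
    · ring
    · ring_nf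
  simp_rw [e1]
  have e2 : ∀ y₁ : ℝ, ∫⁻ y₂, ∫⁻ σ, k (a - σ) * k (b - (g y₁ + g y₂ + g (σ - y₁ - y₂))) =
      ∫⁻ σ, ∫⁻ y₂, k (a - σ) * k (b - (g y₁ + g y₂ + g (σ - y₁ - y₂))) := by
    intro y₁
    apply lintegral_lintegral_swap
    apply Measurable.aemeasurable
    refine (hk.comp (by fun_prop)).mul (hk.comp (by fun_prop))
  simp_rw [e2]
  rw [lintegral_lintegral_swap]
  · calc _ ≤ ∫⁻ σ, k (a - σ) * (ENNReal.ofReal (2 * π) * ∫⁻ u, k u) := by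
          refine lintegral_mono fun σ => ?_
          simp only
          rw [← lintegral_add_left_eq_self _ (σ / 3)]
          calc _ = ∫⁻ z₁, ∫⁻ z₂, k (a - σ) * k (b - (g (σ / 3 + z₁) + g (σ / 3 + z₂)
                + g (σ / 3 - z₁ - z₂))) := by
                refine lintegral_congr fun z₁ => ?_
                rw [← lintegral_add_left_eq_self _ (σ / 3)]
                refine lintegral_congr fun z₂ => ?_
                congr 2
                ring_nf
            _ = ∫⁻ z : ℝ × ℝ, k (a - σ) * k (b - (g (σ / 3 + z.1) + g (σ / 3 + z.2)
                + g (σ / 3 - z.1 - z.2))) := by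
                rw [Measure.volume_eq_prod, lintegral_prod]
                apply Measurable.aemeasurable
                exact measurable_const.mul (hk.comp (by fun_prop))
            _ = k (a - σ) * ∫⁻ z : ℝ × ℝ, k (b - (g (σ / 3 + z.1) + g (σ / 3 + z.2)
                + g (σ / 3 - z.1 - z.2))) := by
                rw [lintegral_const_mul]
                exact (hk.comp (by fun_prop))
            _ ≤ _ := by
                gcongr
                exact lintegral_plane_le hk hg hG _ _
      _ = _ := by
          rw [lintegral_mul_const, lintegral_sub_left_eq_self]
          · ring
          · exact hk.comp (by fun_prop)
  · apply Measurable.aemeasurable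
    apply Measurable.lintegral_prod_right'
      (f := fun p : (ℝ × ℝ) × ℝ => k (a - p.1.2) * k (b - (g p.1.1 + g p.2 + g (p.1.2 - p.1.1 - p.2))))
    refine (hk.comp (by fun_prop)).mul (hk.comp (by fun_prop))

end PolyEig

namespace PolyEig
open Real

/-- Derivative of `arcProfile`: that of `1 - √(1 - y²)` on `[-1/2, 1/2]`, affine outside. -/
noncomputable def arcSlope (y : ℝ) : ℝ :=
  y + (max (-(1 / 2)) (min (1 / 2) y) / √(1 - max (-(1 / 2)) (min (1 / 2) y) ^ 2)
    - max (-(1 / 2)) (min (1 / 2) y))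

/-- A uniformly convex extension of `y ↦ 1 - √(1 - y²)` from `[-1/2, 1/2]` to the line. -/
noncomputable def arcProfile (y : ℝ) : ℝ := ∫ x in (0 : ℝ)..y, arcSlope x

lemma clamp_mem (y : ℝ) : max (-(1 / 2)) (min (1 / 2) y) ∈ Icc (-(1 / 2) : ℝ) (1 / 2) :=
  ⟨le_max_left _ _, max_le (by norm_num) (min_le_left _ _)⟩

lemma sqrt_clamp_pos {p : ℝ} (hp : p ∈ Icc (-(1 / 2) : ℝ) (1 / 2)) : 0 < √(1 - p ^ 2) := by
  apply Real.sqrt_pos.2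
  have := hp.1
  have := hp.2
  nlinarith

lemma continuous_arcSlope : Continuous arcSlope := by
  unfold arcSlope
  have hc : Continuous fun y : ℝ => max (-(1 / 2)) (min (1 / 2) y) := by fun_prop
  refine continuous_id.add ((hc.div ?_ ?_).sub hc)
  · fun_prop
  · exact fun y => (sqrt_clamp_pos (clamp_mem y)).ne'

lemma hasDerivAt_arcProfile (y : ℝ) : HasDerivAt arcProfile (arcSlope y) y :=
  intervalIntegral.integral_hasDerivAt_right (continuous_arcSlope.intervalIntegrable _ _)
    (continuous_arcSlope.stronglyMeasurableAtFilter _ _) continuous_arcSlope.continuousAt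

lemma div_sqrt_sub_mono {p q : ℝ} (hp : p ∈ Icc (-(1 / 2) : ℝ) (1 / 2))
    (hq : q ∈ Icc (-(1 / 2) : ℝ) (1 / 2)) (hpq : p ≤ q) :
    p / √(1 - p ^ 2) - p ≤ q / √(1 - q ^ 2) - q := by
  have hd : ∀ x ∈ Icc (-(1 / 2) : ℝ) (1 / 2),
      HasDerivAt (fun x => x / √(1 - x ^ 2) - x)
        ((1 * √(1 - x ^ 2) - x * (-(2 * x) / (2 * √(1 - x ^ 2)))) / √(1 - x ^ 2) ^ 2 - 1) x := by
    intro x hx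
    have h0 := sqrt_clamp_pos hx
    have h1 : HasDerivAt (fun x : ℝ => 1 - x ^ 2) (-(2 * x)) x := by
      simpa using (hasDerivAt_pow 2 x).const_sub 1
    have h2 := h1.sqrt (Real.sqrt_pos.1 h0).ne'
    exact ((hasDerivAt_id x).fun_div h2 h0.ne').fun_sub (hasDerivAt_id x)
  have : MonotoneOn (fun x => x / √(1 - x ^ 2) - x) (Icc (-(1 / 2) : ℝ) (1 / 2)) := by
    apply monotoneOn_of_deriv_nonneg (convex_Icc _ _)
      (fun x hx => (hd x hx).continuousAt.continuousWithinAt)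
      (fun x hx => (hd x (interior_subset hx)).differentiableAt.differentiableWithinAt)
    intro x hx
    have hx' := interior_subset hx
    rw [(hd x hx').deriv]
    have h0 := sqrt_clamp_pos hx'
    have h1 : √(1 - x ^ 2) ^ 2 = 1 - x ^ 2 := Real.sq_sqrt (Real.sqrt_pos.1 h0).le
    have h2 : √(1 - x ^ 2) ≤ 1 := Real.sqrt_le_one.2 (by nlinarith [sq_nonneg x])
    rw [sub_nonneg, le_div_iff₀ (by positivity)]
    have h3 : x * (-(2 * x) / (2 * √(1 - x ^ 2))) = -(x ^ 2 / √(1 - x ^ 2)) := by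
      field_simp
    rw [h3]
    have : 0 ≤ x ^ 2 / √(1 - x ^ 2) := by positivity
    nlinarith
  exact this hp hq hpq

lemma monotone_arcSlope_sub : Monotone fun y => arcSlope y - y := by
  intro x y hxy
  simp only [arcSlope, add_sub_cancel_left]
  exact div_sqrt_sub_mono (clamp_mem x) (clamp_mem y) (max_le_max le_rfl (min_le_min le_rfl hxy))

lemma arcProfile_eq {y : ℝ} (hy : y ∈ Icc (-(1 / 2) : ℝ) (1 / 2)) :
    arcProfile y = 1 - √(1 - y ^ 2) := by
  have hsub : uIcc 0 y ⊆ Icc (-(1 / 2) : ℝ) (1 / 2) := by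
    apply uIcc_subset_Icc _ hy
    constructor <;> norm_num
  have : ∀ x ∈ uIcc 0 y, HasDerivAt (fun x => 1 - √(1 - x ^ 2)) (arcSlope x) x := by
    intro x hx
    have hx' := hsub hx
    have h0 := sqrt_clamp_pos hx'
    have h1 : HasDerivAt (fun x : ℝ => 1 - x ^ 2) (-(2 * x)) x := by
      simpa using (hasDerivAt_pow 2 x).const_sub 1
    have h2 := (h1.sqrt (Real.sqrt_pos.1 h0).ne').const_sub 1
    have e : arcSlope x = -(-(2 * x) / (2 * √(1 - x ^ 2))) := by
      unfold arcSlope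
      rw [min_eq_right hx'.2, max_eq_right hx'.1]
      field_simp
      ring
    rw [e]
    exact h2
  rw [arcProfile, intervalIntegral.integral_eq_sub_of_hasDerivAt this
    (continuous_arcSlope.intervalIntegrable _ _)]
  simp

lemma lintegral_sin_le (F : ℝ → ℝ≥0∞) :
    ∫⁻ t in Icc (-(π / 6)) (π / 6), F (sin t) ≤ 2 * ∫⁻ y in Icc (-(1 / 2) : ℝ) (1 / 2), F y := by
  have hpi := Real.pi_pos
  have hmem : ∀ t ∈ Icc (-(π / 6)) (π / 6), t ∈ Icc (-(π / 2)) (π / 2) := fun t ht =>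
    ⟨by linarith [ht.1], by linarith [ht.2]⟩
  have hcos : ∀ t ∈ Icc (-(π / 6)) (π / 6), 1 / 2 ≤ cos t := by
    intro t ht
    rw [← Real.cos_abs, ← Real.cos_pi_div_three]
    apply Real.cos_le_cos_of_nonneg_of_le_pi (abs_nonneg _) (by linarith)
    have := abs_le.2 ht
    linarith
  calc ∫⁻ t in Icc (-(π / 6)) (π / 6), F (sin t)
      ≤ ∫⁻ t in Icc (-(π / 6)) (π / 6), 2 * (ENNReal.ofReal |cos t| * F (sin t)) := by
        refine setLIntegral_mono' measurableSet_Icc fun t ht => ?_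
        rw [← mul_assoc]
        apply le_mul_of_one_le_left (zero_le)
        rw [show (2 : ℝ≥0∞) = ENNReal.ofReal 2 by simp, ← ENNReal.ofReal_mul (by norm_num),
          ENNReal.one_le_ofReal]
        have := hcos t ht
        have := le_abs_self (cos t)
        linarith
    _ = 2 * ∫⁻ y in sin '' Icc (-(π / 6)) (π / 6), F y := by
        rw [lintegral_const_mul' _ _ (by simp), ← lintegral_image_eq_lintegral_abs_deriv_mul
          measurableSet_Icc (fun x _ => (Real.hasDerivAt_sin x).hasDerivWithinAt)]
        exact Real.injOn_sin.mono hmem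
    _ ≤ _ := by
        gcongr
        rintro _ ⟨t, ht, rfl⟩
        have h6 := Real.sin_pi_div_six
        constructor
        · rw [← h6, ← Real.sin_neg]
          exact Real.sin_le_sin_of_le_of_le_pi_div_two (by linarith) (hmem t ht).2 ht.1
        · rw [← h6]
          exact Real.sin_le_sin_of_le_of_le_pi_div_two (hmem t ht).1 (by linarith) ht.2

lemma lintegral_arc_le {k : ℝ → ℝ≥0∞} (hk : Measurable k) (a b : ℝ) :
    ∫⁻ t₁ in Icc (-(π / 6)) (π / 6), ∫⁻ t₂ in Icc (-(π / 6)) (π / 6),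
      ∫⁻ t₃ in Icc (-(π / 6)) (π / 6),
        k (a - (sin t₁ + sin t₂ + sin t₃)) * k (b + (cos t₁ + cos t₂ + cos t₃)) ≤
      8 * (ENNReal.ofReal (2 * π) * (∫⁻ u, k u) * ∫⁻ u, k u) := by
  have hcs : ∀ t ∈ Icc (-(π / 6)) (π / 6), cos t = 1 - arcProfile (sin t) := by
    intro t ht
    have hpi := Real.pi_pos
    have h6 := Real.sin_pi_div_six
    rw [arcProfile_eq, sub_sub_cancel, ← Real.cos_eq_sqrt_one_sub_sin_sq (by linarith [ht.1])
      (by linarith [ht.2])]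
    constructor
    · rw [← h6, ← Real.sin_neg]
      exact Real.sin_le_sin_of_le_of_le_pi_div_two (by linarith) (by linarith [ht.2]) ht.1
    · rw [← h6]
      exact Real.sin_le_sin_of_le_of_le_pi_div_two (by linarith [ht.1]) (by linarith) ht.2
  set F : ℝ → ℝ → ℝ → ℝ≥0∞ := fun y₁ y₂ y₃ => k (a - (y₁ + y₂ + y₃)) *
    k (b + 3 - (arcProfile y₁ + arcProfile y₂ + arcProfile y₃)) with hF
  calc _ = ∫⁻ t₁ in Icc (-(π / 6)) (π / 6), ∫⁻ t₂ in Icc (-(π / 6)) (π / 6),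
        ∫⁻ t₃ in Icc (-(π / 6)) (π / 6), F (sin t₁) (sin t₂) (sin t₃) := by
        refine setLIntegral_congr_fun measurableSet_Icc fun t₁ h₁ => ?_
        refine setLIntegral_congr_fun measurableSet_Icc fun t₂ h₂ => ?_
        refine setLIntegral_congr_fun measurableSet_Icc fun t₃ h₃ => ?_
        simp only [hF]
        rw [hcs t₁ h₁, hcs t₂ h₂, hcs t₃ h₃]
        ring_nf
    _ ≤ ∫⁻ t₁ in Icc (-(π / 6)) (π / 6), ∫⁻ t₂ in Icc (-(π / 6)) (π / 6),
        2 * ∫⁻ y₃, F (sin t₁) (sin t₂) y₃ := by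
        refine lintegral_mono fun t₁ => lintegral_mono fun t₂ => ?_
        refine (lintegral_sin_le _).trans ?_
        gcongr
        exact Measure.restrict_le_self
    _ ≤ ∫⁻ t₁ in Icc (-(π / 6)) (π / 6), 2 * ∫⁻ y₂, 2 * ∫⁻ y₃, F (sin t₁) y₂ y₃ := by
        refine lintegral_mono fun t₁ => ?_
        refine (lintegral_sin_le (fun y₂ => 2 * ∫⁻ y₃, F (sin t₁) y₂ y₃)).trans ?_
        gcongr
        exact Measure.restrict_le_self
    _ ≤ 2 * ∫⁻ y₁, 2 * ∫⁻ y₂, 2 * ∫⁻ y₃, F y₁ y₂ y₃ := by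
        refine (lintegral_sin_le (fun y₁ => 2 * ∫⁻ y₂, 2 * ∫⁻ y₃, F y₁ y₂ y₃)).trans ?_
        gcongr
        exact Measure.restrict_le_self
    _ = 8 * ∫⁻ y₁, ∫⁻ y₂, ∫⁻ y₃, F y₁ y₂ y₃ := by
        simp_rw [lintegral_const_mul' (2 : ℝ≥0∞) _ (by simp)]
        rw [← mul_assoc, ← mul_assoc]
        norm_num
    _ ≤ _ := by
        gcongr
        exact lintegral_three_le hk hasDerivAt_arcProfile monotone_arcSlope_sub _ _

/-- The one-dimensional factor of the Fourier transform of `exp (-ε |x|²)`. -/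
noncomputable def gaussKernel (ε u : ℝ) : ℝ := √(π / ε) * rexp (-u ^ 2 / (4 * ε))

lemma lintegral_gaussKernel {ε : ℝ} (hε : 0 < ε) :
    ∫⁻ u, ENNReal.ofReal (gaussKernel ε u) = ENNReal.ofReal (2 * π) := by
  unfold gaussKernel
  have e : ∀ u : ℝ, -u ^ 2 / (4 * ε) = -(1 / (4 * ε)) * u ^ 2 := fun u => by field_simp
  simp_rw [e]
  rw [← ofReal_integral_eq_lintegral_ofReal]
  · rw [integral_const_mul, integral_gaussian, ← Real.sqrt_mul (by positivity)]
    congr 1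
    rw [show π / ε * (π / (1 / (4 * ε))) = (2 * π) ^ 2 by field_simp; ring]
    exact Real.sqrt_sq (by positivity)
  · exact (integrable_exp_neg_mul_sq (by positivity)).const_mul _
  · exact ae_of_all _ fun u => by positivity

lemma lintegral_gauss_arc_le {ε : ℝ} (hε : 0 < ε) (a b c : ℝ) :
    ∫⁻ t₁ in Icc (c - π / 6) (c + π / 6), ∫⁻ t₂ in Icc (c - π / 6) (c + π / 6),
      ∫⁻ t₃ in Icc (c - π / 6) (c + π / 6),
        ENNReal.ofReal (gaussKernel ε (a - (sin t₁ + sin t₂ + sin t₃)) *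
          gaussKernel ε (b + (cos t₁ + cos t₂ + cos t₃))) ≤
      8 * (ENNReal.ofReal (2 * π) * ENNReal.ofReal (2 * π) * ENNReal.ofReal (2 * π)) := by
  have hsh : ∀ H : ℝ → ℝ≥0∞, ∫⁻ t in Icc (c - π / 6) (c + π / 6), H t =
      ∫⁻ t in Icc (-(π / 6)) (π / 6), H (c + t) := by
    intro H
    rw [← lintegral_indicator measurableSet_Icc, ← lintegral_indicator measurableSet_Icc,
      ← lintegral_add_left_eq_self _ c]
    refine lintegral_congr fun t => ?_
    simp only [indicator, mem_Icc]
    congr 1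
    apply propext
    constructor <;> rintro ⟨h1, h2⟩ <;> constructor <;> linarith
  simp_rw [hsh]
  have hk : Measurable fun u => ENNReal.ofReal (gaussKernel ε u) := by
    unfold gaussKernel; fun_prop
  have hg : ∀ u, 0 ≤ gaussKernel ε u := fun u => by unfold gaussKernel; positivity
  have := lintegral_arc_le hk (a * cos c + b * sin c) (b * cos c - a * sin c)
  rw [lintegral_gaussKernel hε] at this
  convert this using 7 with t₁ t₂ t₃
  · rw [← ENNReal.ofReal_mul (hg _)]
    congr 1
    simp only [gaussKernel]
    have h : ∀ p q x y : ℝ, p * rexp x * (p * rexp y) = p * p * rexp (x + y) := by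
      intro p q x y
      rw [Real.exp_add]; ring
    rw [h _ 0, h _ 0]
    congr 2
    simp only [sin_add, cos_add, ← add_div]
    congr 1
    have := sin_sq_add_cos_sq c
    linear_combination (-(a ^ 2 + b ^ 2) + (sin t₁ + sin t₂ + sin t₃) ^ 2
      + (cos t₁ + cos t₂ + cos t₃) ^ 2) * (-this)
end PolyEig

namespace PolyEig
open Real

/-- The unimodular oscillation `e^{iu}`. -/
noncomputable def osc (u : ℝ) : ℂ := Complex.exp (u * Complex.I)

lemma norm_osc (u : ℝ) : ‖osc u‖ = 1 := Complex.norm_exp_ofReal_mul_I u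

lemma osc_add (u v : ℝ) : osc (u + v) = osc u * osc v := by
  simp only [osc, ← Complex.exp_add]; congr 1; push_cast; ring

lemma conj_osc (u : ℝ) : (starRingEnd ℂ) (osc u) = osc (-u) := by
  simp only [osc, ← Complex.exp_conj]; simp

lemma continuous_osc : Continuous osc := by unfold osc; fun_prop

lemma measurable_osc : Measurable osc := continuous_osc.measurable

lemma integral_osc_gauss {ε : ℝ} (hε : 0 < ε) (u : ℝ) :
    ∫ x : ℝ, osc (-(x * u)) * (rexp (-ε * x ^ 2) : ℂ) = (gaussKernel ε u : ℂ) := by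
  have h := fourierIntegral_gaussian (b := (ε : ℂ)) (by simpa using hε) (-u : ℂ)
  have e : ∀ x : ℝ, osc (-(x * u)) * (rexp (-ε * x ^ 2) : ℂ) =
      Complex.exp (Complex.I * (-u) * x) * Complex.exp (-ε * x ^ 2) := by
    intro x
    simp only [osc]
    push_cast
    congr 2; ring
  simp_rw [e, h, gaussKernel]
  push_cast
  congr 1
  · rw [Real.sqrt_eq_rpow, Complex.ofReal_cpow (by positivity)]
    push_cast; rfl
  · congr 1; ring

lemma integrable_gauss {ε : ℝ} (hε : 0 < ε) :
    Integrable fun x : ℝ × ℝ => rexp (-ε * x.1 ^ 2) * rexp (-ε * x.2 ^ 2) :=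
  (integrable_exp_neg_mul_sq hε).mul_prod (integrable_exp_neg_mul_sq hε)

lemma integral_osc_gauss_two {ε : ℝ} (hε : 0 < ε) (u v : ℝ) :
    ∫ x : ℝ × ℝ, osc (-(x.1 * u + x.2 * v)) * ((rexp (-ε * x.1 ^ 2) * rexp (-ε * x.2 ^ 2) : ℝ) : ℂ)
      = (gaussKernel ε u * gaussKernel ε v : ℝ) := by
  have e : ∀ x : ℝ × ℝ, osc (-(x.1 * u + x.2 * v)) *
      ((rexp (-ε * x.1 ^ 2) * rexp (-ε * x.2 ^ 2) : ℝ) : ℂ) =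
      (osc (-(x.1 * u)) * (rexp (-ε * x.1 ^ 2) : ℂ)) *
      (osc (-(x.2 * v)) * (rexp (-ε * x.2 ^ 2) : ℂ)) := by
    intro x
    rw [neg_add, osc_add]; push_cast; ring
  simp_rw [e]
  rw [Measure.volume_eq_prod, integral_prod_mul (fun x : ℝ => osc (-(x * u)) * (rexp (-ε * x ^ 2) : ℂ))
    (fun x : ℝ => osc (-(x * v)) * (rexp (-ε * x ^ 2) : ℂ)), integral_osc_gauss hε,
    integral_osc_gauss hε]
  push_cast; rfl

section
variable {T : Type*} [MeasurableSpace T] {μ : Measure T} [IsFiniteMeasure μ] {F : T → ℂ}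
  {A B : T → ℝ}

lemma norm_oscInt_le {M : ℝ} (hM : ∀ t, ‖F t‖ ≤ M) (x : ℝ × ℝ) :
    ‖∫ t, F t * osc (-(x.1 * A t + x.2 * B t)) ∂μ‖ ≤ M * μ.real univ := by
  apply norm_integral_le_of_norm_le_const
  exact ae_of_all _ fun t => by rw [norm_mul, norm_osc, mul_one]; exact hM t

lemma stronglyMeasurable_oscInt (hF : Measurable F) (hA : Measurable A) (hB : Measurable B) :
    StronglyMeasurable fun x : ℝ × ℝ => ∫ t, F t * osc (-(x.1 * A t + x.2 * B t)) ∂μ := by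
  apply StronglyMeasurable.integral_prod_right'
    (f := fun p : (ℝ × ℝ) × T => F p.2 * osc (-(p.1.1 * A p.2 + p.1.2 * B p.2)))
  apply Measurable.stronglyMeasurable
  exact (hF.comp measurable_snd).mul (measurable_osc.comp (by fun_prop))

lemma integral_sq_oscInt {ε : ℝ} (hε : 0 < ε) (hF : Measurable F) {M : ℝ}
    (hM : ∀ t, ‖F t‖ ≤ M) (hA : Measurable A) (hB : Measurable B) :
    ∫ x : ℝ × ℝ, ((‖∫ t, F t * osc (-(x.1 * A t + x.2 * B t)) ∂μ‖ ^ 2 *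
      (rexp (-ε * x.1 ^ 2) * rexp (-ε * x.2 ^ 2)) : ℝ) : ℂ) =
    ∫ p : T × T, F p.1 * (starRingEnd ℂ) (F p.2) *
      (gaussKernel ε (A p.1 - A p.2) * gaussKernel ε (B p.1 - B p.2) : ℝ) ∂(μ.prod μ) := by
  have e1 : ∀ x : ℝ × ℝ, ((‖∫ t, F t * osc (-(x.1 * A t + x.2 * B t)) ∂μ‖ ^ 2 *
      (rexp (-ε * x.1 ^ 2) * rexp (-ε * x.2 ^ 2)) : ℝ) : ℂ) =
      ∫ p : T × T, F p.1 * (starRingEnd ℂ) (F p.2) *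
        (osc (-(x.1 * (A p.1 - A p.2) + x.2 * (B p.1 - B p.2))) *
        ((rexp (-ε * x.1 ^ 2) * rexp (-ε * x.2 ^ 2) : ℝ) : ℂ)) ∂(μ.prod μ) := by
    intro x
    rw [Complex.ofReal_mul, Complex.ofReal_pow, ← Complex.mul_conj', ← integral_conj,
      ← integral_prod_mul, ← integral_mul_const]
    congr 1
    ext p
    rw [map_mul, conj_osc, show -(x.1 * (A p.1 - A p.2) + x.2 * (B p.1 - B p.2)) =
      -(x.1 * A p.1 + x.2 * B p.1) + -(-(x.1 * A p.2 + x.2 * B p.2)) by ring, osc_add]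
    ring
  simp_rw [e1]
  rw [integral_integral_swap]
  · congr 1
    ext p
    rw [integral_const_mul, integral_osc_gauss_two hε]
  · have hM0 : ∀ t, 0 ≤ M := fun t => (norm_nonneg _).trans (hM t)
    have h_int : Integrable (fun z : (ℝ × ℝ) × (T × T) =>
        (rexp (-ε * z.1.1 ^ 2) * rexp (-ε * z.1.2 ^ 2)) * (M * M))
        (volume.prod (μ.prod μ)) :=
      (integrable_gauss hε).mul_prod (integrable_const (M * M))
    refine h_int.mono ?_ ?_
    · apply Measurable.aestronglyMeasurable
      unfold Function.uncurry
      have h1 : Measurable fun z : (ℝ × ℝ) × (T × T) => F z.2.1 := hF.comp (by fun_prop)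
      have h2 : Measurable fun z : (ℝ × ℝ) × (T × T) => (starRingEnd ℂ) (F z.2.2) :=
        Complex.continuous_conj.measurable.comp (hF.comp (by fun_prop))
      refine (h1.mul h2).mul ((measurable_osc.comp ?_).mul ?_)
      · fun_prop
      · fun_prop
    · refine ae_of_all _ fun z => ?_
      simp only [Function.uncurry, norm_mul, norm_osc, Complex.norm_conj, Complex.norm_real, one_mul]
      rw [mul_comm]
      have h1 := hM z.2.1
      have h2 := hM z.2.2
      have h3 := hM0 z.2.1
      have h4 := le_abs_self M
      simp only [Real.norm_eq_abs]
      have : 0 ≤ |rexp (-ε * z.1.1 ^ 2)| * |rexp (-ε * z.1.2 ^ 2)| := by positivity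
      have h5 : ‖F z.2.1‖ * ‖F z.2.2‖ ≤ |M| * |M| :=
        mul_le_mul (h1.trans h4) (h2.trans h4) (norm_nonneg _) (abs_nonneg _)
      exact mul_le_mul_of_nonneg_left h5 this

lemma gaussKernel_nonneg (ε u : ℝ) : 0 ≤ gaussKernel ε u := by unfold gaussKernel; positivity

lemma gaussKernel_neg (ε u : ℝ) : gaussKernel ε (-u) = gaussKernel ε u := by
  simp [gaussKernel]

lemma measurable_gaussKernel (ε : ℝ) : Measurable (gaussKernel ε) := by
  unfold gaussKernel; fun_prop

lemma two_mul_le_sq_add_sq (a b : ℝ≥0∞) : 2 * (a * b) ≤ a ^ 2 + b ^ 2 := by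
  rcases eq_or_ne a ⊤ with rfl | ha
  · simp
  rcases eq_or_ne b ⊤ with rfl | hb
  · simp
  lift a to NNReal using ha
  lift b to NNReal using hb
  norm_cast
  have := two_mul_le_add_sq (a : ℝ) b
  rw [← NNReal.coe_le_coe]
  push_cast
  linarith

lemma lintegral_schur_le {K : T → T → ℝ≥0∞} (hK : Measurable (Function.uncurry K))
    (hsym : ∀ s t, K s t = K t s) {C : ℝ≥0∞} (hC : ∀ s, ∫⁻ t, K s t ∂μ ≤ C)
    {f : T → ℝ≥0∞} (hf : Measurable f) :
    ∫⁻ p : T × T, f p.1 * f p.2 * K p.1 p.2 ∂(μ.prod μ) ≤ C * ∫⁻ t, f t ^ 2 ∂μ := by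
  have h1 : ∫⁻ p : T × T, f p.1 ^ 2 * K p.1 p.2 ∂(μ.prod μ) ≤ C * ∫⁻ t, f t ^ 2 ∂μ := by
    rw [lintegral_prod]
    · calc _ ≤ ∫⁻ s, f s ^ 2 * C ∂μ := by
            refine lintegral_mono fun s => ?_
            simp only
            have hKs : Measurable (K s) := hK.comp (by fun_prop : Measurable fun t => (s, t))
            rw [lintegral_const_mul _ hKs]
            gcongr
            exact hC s
        _ = _ := by rw [lintegral_mul_const _ (by fun_prop), mul_comm]
    · exact (((hf.comp measurable_fst).pow_const 2).mul hK).aemeasurable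
  have h2 : ∫⁻ p : T × T, f p.2 ^ 2 * K p.1 p.2 ∂(μ.prod μ) ≤ C * ∫⁻ t, f t ^ 2 ∂μ := by
    rw [← lintegral_prod_swap]
    simp only [Prod.fst_swap, Prod.snd_swap]
    refine (lintegral_congr fun p => ?_).trans_le h1
    rw [hsym]
  have h3 : 2 * ∫⁻ p : T × T, f p.1 * f p.2 * K p.1 p.2 ∂(μ.prod μ) ≤
      2 * (C * ∫⁻ t, f t ^ 2 ∂μ) := by
    rw [two_mul (C * _)]
    refine le_trans ?_ (add_le_add h1 h2)
    rw [← lintegral_const_mul' _ _ (by simp), ← lintegral_add_left]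
    · refine lintegral_mono fun p => ?_
      rw [← add_mul, ← mul_assoc]
      gcongr
      exact two_mul_le_sq_add_sq _ _
    · exact ((hf.comp measurable_fst).pow_const 2).mul hK
  exact (ENNReal.mul_le_mul_iff_right (by simp) (by simp)).1 h3

lemma lintegral_sq_oscInt_gauss_le {ε : ℝ} (hε : 0 < ε) (hF : Measurable F) {M : ℝ}
    (hM : ∀ t, ‖F t‖ ≤ M) (hA : Measurable A) (hB : Measurable B) {C : ℝ≥0∞}
    (hC : ∀ a b, ∫⁻ t, ENNReal.ofReal (gaussKernel ε (a - A t) * gaussKernel ε (b - B t)) ∂μ ≤ C) :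
    ∫⁻ x : ℝ × ℝ, ‖∫ t, F t * osc (-(x.1 * A t + x.2 * B t)) ∂μ‖ₑ ^ 2 *
      ENNReal.ofReal (rexp (-ε * x.1 ^ 2) * rexp (-ε * x.2 ^ 2)) ≤ C * ∫⁻ t, ‖F t‖ₑ ^ 2 ∂μ := by
  set G : ℝ × ℝ → ℂ := fun x => ∫ t, F t * osc (-(x.1 * A t + x.2 * B t)) ∂μ with hG
  have e1 : ∀ x : ℝ × ℝ, ‖G x‖ₑ ^ 2 *
      ENNReal.ofReal (rexp (-ε * x.1 ^ 2) * rexp (-ε * x.2 ^ 2)) =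
      ENNReal.ofReal (‖G x‖ ^ 2 * (rexp (-ε * x.1 ^ 2) * rexp (-ε * x.2 ^ 2))) := by
    intro x
    rw [ENNReal.ofReal_mul (p := ‖G x‖ ^ 2) (by positivity), ENNReal.ofReal_pow (norm_nonneg _), ofReal_norm]
  rw [lintegral_congr e1, ← ofReal_integral_eq_lintegral_ofReal]
  · have e2 : ENNReal.ofReal (∫ x : ℝ × ℝ, ‖G x‖ ^ 2 *
        (rexp (-ε * x.1 ^ 2) * rexp (-ε * x.2 ^ 2))) = ‖∫ p : T × T, F p.1 * (starRingEnd ℂ) (F p.2) *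
      (gaussKernel ε (A p.1 - A p.2) * gaussKernel ε (B p.1 - B p.2) : ℝ) ∂(μ.prod μ)‖ₑ := by
      rw [← integral_sq_oscInt hε hF hM hA hB, integral_complex_ofReal, ← ofReal_norm, Complex.norm_real,
        Real.norm_of_nonneg]
      exact integral_nonneg fun x => by positivity
    rw [e2]
    refine (enorm_integral_le_lintegral_enorm _).trans ?_
    have e3 : ∀ p : T × T, ‖F p.1 * (starRingEnd ℂ) (F p.2) *
      (gaussKernel ε (A p.1 - A p.2) * gaussKernel ε (B p.1 - B p.2) : ℝ)‖ₑ =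
      ‖F p.1‖ₑ * ‖F p.2‖ₑ *
        ENNReal.ofReal (gaussKernel ε (A p.1 - A p.2) * gaussKernel ε (B p.1 - B p.2)) := by
      intro p
      rw [enorm_mul, enorm_mul]
      congr 1
      · congr 1
        rw [← ofReal_norm, Complex.norm_conj, ofReal_norm]
      · rw [← ofReal_norm, Complex.norm_real, Real.norm_of_nonneg
          (mul_nonneg (gaussKernel_nonneg _ _) (gaussKernel_nonneg _ _))]
    simp_rw [e3]
    refine lintegral_schur_le (K := fun s t => ENNReal.ofReal
      (gaussKernel ε (A s - A t) * gaussKernel ε (B s - B t))) ?_ ?_ (fun s => hC _ _)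
      (by fun_prop)
    · unfold Function.uncurry
      refine ENNReal.measurable_ofReal.comp (((measurable_gaussKernel ε).comp ?_).mul
        ((measurable_gaussKernel ε).comp ?_)) <;> fun_prop
    · intro s t
      rw [← neg_sub (A t), ← neg_sub (B t), gaussKernel_neg, gaussKernel_neg]
  · refine ((integrable_gauss hε).const_mul ((M * μ.real univ) ^ 2)).mono ?_ ?_
    · apply StronglyMeasurable.aestronglyMeasurable
      refine ((stronglyMeasurable_oscInt hF hA hB).norm.pow 2).mul
        (Measurable.stronglyMeasurable ?_)
      fun_prop
    · refine ae_of_all _ fun x => ?_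
      rw [norm_mul, norm_mul ((M * μ.real univ) ^ 2)]
      gcongr
      simp only [norm_pow, norm_norm]
      exact pow_le_pow_left₀ (norm_nonneg _) ((norm_oscInt_le hM x).trans (le_abs_self _)) 2
  · exact ae_of_all _ fun x => by positivity

lemma lintegral_sq_oscInt_le (hF : Measurable F) {M : ℝ}
    (hM : ∀ t, ‖F t‖ ≤ M) (hA : Measurable A) (hB : Measurable B) {C : ℝ≥0∞}
    (hC : ∀ ε, 0 < ε → ∀ a b,
      ∫⁻ t, ENNReal.ofReal (gaussKernel ε (a - A t) * gaussKernel ε (b - B t)) ∂μ ≤ C) :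
    ∫⁻ x : ℝ × ℝ, ‖∫ t, F t * osc (-(x.1 * A t + x.2 * B t)) ∂μ‖ₑ ^ 2 ≤
      C * ∫⁻ t, ‖F t‖ₑ ^ 2 ∂μ := by
  set G : ℝ × ℝ → ℂ := fun x => ∫ t, F t * osc (-(x.1 * A t + x.2 * B t)) ∂μ with hG
  have hGm : Measurable G := (stronglyMeasurable_oscInt hF hA hB).measurable
  set w : ℕ → ℝ × ℝ → ℝ := fun n x =>
    rexp (-(1 / ((n : ℝ) + 1)) * x.1 ^ 2) * rexp (-(1 / ((n : ℝ) + 1)) * x.2 ^ 2) with hw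
  have hlim : ∀ x, Tendsto (fun n => ‖G x‖ₑ ^ 2 * ENNReal.ofReal (w n x)) atTop
      (nhds (‖G x‖ₑ ^ 2)) := by
    intro x
    have h0 : Tendsto (fun n : ℕ => 1 / ((n : ℝ) + 1)) atTop (nhds 0) :=
      tendsto_one_div_add_atTop_nhds_zero_nat
    have h1 : Tendsto (fun n => w n x) atTop (nhds 1) := by
      have hc : Continuous fun s : ℝ => rexp (-s * x.1 ^ 2) * rexp (-s * x.2 ^ 2) := by fun_prop
      have := (hc.tendsto 0).comp h0
      simp only [neg_zero, zero_mul, Real.exp_zero, mul_one] at this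
      exact this
    have h2 := ENNReal.Tendsto.const_mul (a := ‖G x‖ₑ ^ 2) (ENNReal.tendsto_ofReal h1)
      (Or.inl (by simp))
    simpa using h2
  calc ∫⁻ x, ‖G x‖ₑ ^ 2
      = ∫⁻ x, liminf (fun n => ‖G x‖ₑ ^ 2 * ENNReal.ofReal (w n x)) atTop :=
        lintegral_congr fun x => (hlim x).liminf_eq.symm
    _ ≤ liminf (fun n => ∫⁻ x, ‖G x‖ₑ ^ 2 * ENNReal.ofReal (w n x)) atTop := by
        apply lintegral_liminf_le
        intro n
        refine (hGm.enorm.pow_const 2).mul (ENNReal.measurable_ofReal.comp ?_)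
        simp only [hw]
        fun_prop
    _ ≤ _ := by
        refine (liminf_le_liminf (v := fun _ => C * ∫⁻ t, ‖F t‖ₑ ^ 2 ∂μ) ?_).trans
          (liminf_const _).le
        exact Eventually.of_forall fun n =>
          lintegral_sq_oscInt_gauss_le (by positivity) hF hM hA hB (hC _ (by positivity))
end

end PolyEig

namespace PolyEig
open Real

/-- Fourier extension from the arc of length `π/3` about `c`. -/
noncomputable def arcExt (c : ℝ) (f : ℝ → ℂ) (x : ℝ × ℝ) : ℂ :=
  ∫ s in Icc (c - π / 6) (c + π / 6), f s * osc (-(x.1 * sin s - x.2 * cos s))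

lemma integral_triple_prod (μ : Measure ℝ) [IsFiniteMeasure μ] (h : ℝ → ℂ) :
    ∫ t : ℝ × ℝ × ℝ, h t.1 * (h t.2.1 * h t.2.2) ∂(μ.prod (μ.prod μ)) = (∫ s, h s ∂μ) ^ 3 := by
  rw [integral_prod_mul h (fun p : ℝ × ℝ => h p.1 * h p.2), integral_prod_mul]
  ring

lemma lintegral_triple_prod (μ : Measure ℝ) [IsFiniteMeasure μ] {h : ℝ → ℝ≥0∞}
    (hh : Measurable h) :
    ∫⁻ t : ℝ × ℝ × ℝ, h t.1 * (h t.2.1 * h t.2.2) ∂(μ.prod (μ.prod μ)) = (∫⁻ s, h s ∂μ) ^ 3 := by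
  rw [lintegral_prod_mul (g := fun p : ℝ × ℝ => h p.1 * h p.2) hh.aemeasurable
    ((hh.comp measurable_fst).mul (hh.comp measurable_snd)).aemeasurable,
    lintegral_prod_mul hh.aemeasurable hh.aemeasurable]
  ring

theorem lintegral_arcExt_le {f : ℝ → ℂ} (hf : Measurable f) {M : ℝ} (hM : ∀ s, ‖f s‖ ≤ M)
    (c : ℝ) : ∫⁻ x, ‖arcExt c f x‖ₑ ^ 6 ≤
      8 * (ENNReal.ofReal (2 * π) * ENNReal.ofReal (2 * π) * ENNReal.ofReal (2 * π)) *
        (∫⁻ s in Icc (c - π / 6) (c + π / 6), ‖f s‖ₑ ^ 2) ^ 3 := by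
  set μ : Measure ℝ := volume.restrict (Icc (c - π / 6) (c + π / 6)) with hμ
  set A : ℝ × ℝ × ℝ → ℝ := fun t => sin t.1 + sin t.2.1 + sin t.2.2 with hA
  set B : ℝ × ℝ × ℝ → ℝ := fun t => -(cos t.1 + cos t.2.1 + cos t.2.2) with hB
  set F : ℝ × ℝ × ℝ → ℂ := fun t => f t.1 * (f t.2.1 * f t.2.2) with hF
  have hAm : Measurable A := by simp only [hA]; fun_prop
  have hBm : Measurable B := by simp only [hB]; fun_prop
  have hFm : Measurable F := (hf.comp (by fun_prop)).mul
    ((hf.comp (by fun_prop)).mul (hf.comp (by fun_prop)))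
  have h0 : 0 ≤ M := (norm_nonneg _).trans (hM 0)
  have hFM : ∀ t, ‖F t‖ ≤ M * (M * M) := by
    intro t
    simp only [hF, norm_mul]
    have := hM t.1
    have := hM t.2.1
    have := hM t.2.2
    gcongr
  have key := lintegral_sq_oscInt_le (μ := μ.prod (μ.prod μ)) hFm hFM hAm hBm
    (C := 8 * (ENNReal.ofReal (2 * π) * ENNReal.ofReal (2 * π) * ENNReal.ofReal (2 * π))) ?_
  · have e1 : ∀ x : ℝ × ℝ, ‖arcExt c f x‖ₑ ^ 6 =
        ‖∫ t, F t * osc (-(x.1 * A t + x.2 * B t)) ∂(μ.prod (μ.prod μ))‖ₑ ^ 2 := by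
      intro x
      have : ∫ t, F t * osc (-(x.1 * A t + x.2 * B t)) ∂(μ.prod (μ.prod μ)) =
          arcExt c f x ^ 3 := by
        rw [arcExt, ← integral_triple_prod]
        congr 1
        ext t
        simp only [hF, hA, hB]
        rw [show -(x.1 * (sin t.1 + sin t.2.1 + sin t.2.2) +
          x.2 * -(cos t.1 + cos t.2.1 + cos t.2.2)) = -(x.1 * sin t.1 - x.2 * cos t.1) +
          (-(x.1 * sin t.2.1 - x.2 * cos t.2.1) + -(x.1 * sin t.2.2 - x.2 * cos t.2.2)) by ring,
          osc_add, osc_add]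
        ring
      rw [this, enorm_pow, ← pow_mul]
    have e2 : ∫⁻ t, ‖F t‖ₑ ^ 2 ∂(μ.prod (μ.prod μ)) = (∫⁻ s, ‖f s‖ₑ ^ 2 ∂μ) ^ 3 := by
      rw [← lintegral_triple_prod μ (hf.enorm.pow_const 2)]
      refine lintegral_congr fun t => ?_
      simp only [hF, enorm_mul]
      ring
    rw [lintegral_congr e1, ← e2]
    exact key
  · intro ε hε a b
    refine le_trans (le_of_eq ?_) (lintegral_gauss_arc_le hε a b c)
    have hm : Measurable fun t : ℝ × ℝ × ℝ =>
        ENNReal.ofReal (gaussKernel ε (a - A t) * gaussKernel ε (b - B t)) :=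
      ENNReal.measurable_ofReal.comp (((measurable_gaussKernel ε).comp (by fun_prop)).mul
        ((measurable_gaussKernel ε).comp (by fun_prop)))
    rw [lintegral_prod _ hm.aemeasurable]
    refine lintegral_congr fun t₁ => ?_
    have hm₁ : Measurable fun p : ℝ × ℝ =>
        ENNReal.ofReal (gaussKernel ε (a - A (t₁, p)) * gaussKernel ε (b - B (t₁, p))) :=
      hm.comp (by fun_prop : Measurable fun p : ℝ × ℝ => (t₁, p))
    rw [lintegral_prod _ hm₁.aemeasurable]
    simp only [hA, hB, sub_neg_eq_add, ← add_assoc]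
    rfl

end PolyEig

namespace PolyEig
open Real

lemma hasDerivAt_intervalIntegral_param {F F' : ℝ → ℝ → ℝ} {U : Set ℝ} (hU : IsOpen U)
    {a b : ℝ} (hab : a ≤ b) (hF : ∀ τ ∈ U, ContinuousOn (F τ) (Icc a b))
    (hF' : ContinuousOn (Function.uncurry F') (U ×ˢ Icc a b))
    (hd : ∀ τ ∈ U, ∀ s ∈ Icc a b, HasDerivAt (fun τ => F τ s) (F' τ s) τ) {τ₀ : ℝ} (hτ₀ : τ₀ ∈ U) :
    HasDerivAt (fun τ => ∫ s in a..b, F τ s) (∫ s in a..b, F' τ₀ s) τ₀ := by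
  obtain ⟨r, hr, hrU⟩ := Metric.nhds_basis_closedBall.mem_iff.1 (hU.mem_nhds hτ₀)
  have hcpt : IsCompact (Metric.closedBall τ₀ r ×ˢ Icc a b) :=
    (isCompact_closedBall _ _).prod isCompact_Icc
  obtain ⟨M, hM⟩ := hcpt.exists_bound_of_continuousOn (hF'.mono (prod_mono hrU subset_rfl))
  have hIoc : uIoc a b ⊆ Icc a b := by rw [uIoc_of_le hab]; exact Ioc_subset_Icc_self
  have hF'0 : ContinuousOn (F' τ₀) (Icc a b) :=
    hF'.comp (f := fun s => (τ₀, s)) (by fun_prop) fun s hs => ⟨hτ₀, hs⟩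
  refine (intervalIntegral.hasDerivAt_integral_of_dominated_loc_of_deriv_le
    (bound := fun _ => M) (s := Metric.closedBall τ₀ r) (Metric.closedBall_mem_nhds _ hr) ?_ ?_ ?_
    ?_ ?_ ?_).2
  · filter_upwards [hU.mem_nhds hτ₀] with τ hτ
    exact ((hF τ hτ).mono hIoc).aestronglyMeasurable measurableSet_uIoc
  · exact (hF τ₀ hτ₀).intervalIntegrable_of_Icc hab
  · exact (hF'0.mono hIoc).aestronglyMeasurable measurableSet_uIoc
  · exact ae_of_all _ fun s hs τ hτ => hM (τ, s) ⟨hτ, hIoc hs⟩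
  · exact intervalIntegrable_const
  · exact ae_of_all _ fun s hs τ hτ => hd τ (hrU hτ) s (hIoc hs)

/-- The integral over a full period in Schläfli's formula. -/
noncomputable def besA (ν τ : ℝ) : ℝ := ∫ s in -π..π, cos (ν * s - rexp τ * sin s)

/-- The logarithmic derivative `r ∂_r` of `besA`. -/
noncomputable def besA' (ν τ : ℝ) : ℝ :=
  ∫ s in -π..π, sin (ν * s - rexp τ * sin s) * (rexp τ * sin s)

lemma hasDerivAt_besA (ν τ : ℝ) : HasDerivAt (besA ν) (besA' ν τ) τ := by
  have hpi := Real.pi_pos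
  refine hasDerivAt_intervalIntegral_param (F := fun τ s => cos (ν * s - rexp τ * sin s))
    (F' := fun τ s => sin (ν * s - rexp τ * sin s) * (rexp τ * sin s)) isOpen_univ (by linarith)
    (fun τ _ => by fun_prop) (by unfold Function.uncurry; fun_prop) ?_ (mem_univ τ)
  intro τ _ s _
  have h := (((Real.hasDerivAt_exp τ).mul_const (sin s)).const_sub (ν * s)).cos
  exact h.congr_deriv (by ring)

lemma hasDerivAt_besA' (ν τ : ℝ) :
    HasDerivAt (besA' ν) ((ν ^ 2 - rexp τ ^ 2) * besA ν τ - 2 * (ν - rexp τ) * sin (ν * π)) τ := by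
  have hpi := Real.pi_pos
  have h1 : HasDerivAt (besA' ν) (∫ s in -π..π,
      (-(cos (ν * s - rexp τ * sin s) * (rexp τ * sin s) ^ 2)
        + sin (ν * s - rexp τ * sin s) * (rexp τ * sin s))) τ := by
    refine hasDerivAt_intervalIntegral_param
      (F := fun τ s => sin (ν * s - rexp τ * sin s) * (rexp τ * sin s))
      (F' := fun τ s => -(cos (ν * s - rexp τ * sin s) * (rexp τ * sin s) ^ 2)
        + sin (ν * s - rexp τ * sin s) * (rexp τ * sin s)) isOpen_univ (by linarith)
      (fun τ _ => by fun_prop) (by unfold Function.uncurry; fun_prop) ?_ (mem_univ τ)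
    intro τ _ s _
    have h := (((Real.hasDerivAt_exp τ).mul_const (sin s)).const_sub (ν * s)).sin.mul
      ((Real.hasDerivAt_exp τ).mul_const (sin s))
    exact h.congr_deriv (by ring)
  refine h1.congr_deriv ?_
  have h2 : ∫ s in -π..π, (-(cos (ν * s - rexp τ * sin s) * (rexp τ * sin s) ^ 2)
        + sin (ν * s - rexp τ * sin s) * (rexp τ * sin s)
        + (rexp τ ^ 2 - ν ^ 2) * cos (ν * s - rexp τ * sin s)) =
      -((ν + rexp τ * cos π) * sin (ν * π - rexp τ * sin π)) -
      -((ν + rexp τ * cos (-π)) * sin (ν * (-π) - rexp τ * sin (-π))) := by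
    apply intervalIntegral.integral_eq_sub_of_hasDerivAt
      (f := fun s => -((ν + rexp τ * cos s) * sin (ν * s - rexp τ * sin s)))
    · intro s _
      have hψ : HasDerivAt (fun s => ν * s - rexp τ * sin s) (ν * 1 - rexp τ * cos s) s :=
        ((hasDerivAt_id s).const_mul ν).sub ((Real.hasDerivAt_sin s).const_mul _)
      have h := ((((Real.hasDerivAt_cos s).const_mul (rexp τ)).const_add ν).mul hψ.sin).neg
      refine h.congr_deriv ?_
      have := sin_sq_add_cos_sq s
      linear_combination (cos (ν * s - rexp τ * sin s)) * (rexp τ) ^ 2 * this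
    · apply Continuous.intervalIntegrable
      fun_prop
  rw [intervalIntegral.integral_add, intervalIntegral.integral_const_mul] at h2
  · simp only [cos_pi, sin_pi, cos_neg, sin_neg, mul_neg, neg_zero, mul_zero, sub_zero] at h2
    unfold besA
    linear_combination h2
  · apply Continuous.intervalIntegrable; fun_prop
  · apply Continuous.intervalIntegrable; fun_prop

/-- The integrand of the exponentially decaying part of Schläfli's formula. -/
noncomputable def besK (ν τ t : ℝ) : ℝ := rexp (-(ν * t) - rexp τ * sinh t)

lemma besK_pos (ν τ t : ℝ) : 0 < besK ν τ t := Real.exp_pos _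

/-- The exponentially decaying part of Schläfli's formula. -/
noncomputable def besB (ν τ : ℝ) : ℝ := ∫ t in Ioi (0 : ℝ), besK ν τ t

/-- The logarithmic derivative of `besB`. -/
noncomputable def besB' (ν τ : ℝ) : ℝ :=
  ∫ t in Ioi (0 : ℝ), -(rexp τ * sinh t) * besK ν τ t

lemma poly_mul_besK_le {ν ρ τ t : ℝ} (hν : 0 ≤ ν) (hρ : 0 < ρ) (hρτ : ρ ≤ rexp τ) (ht : 0 ≤ t) :
    (1 + sinh t + sinh t ^ 2) * besK ν τ t ≤ (1 + 4 / ρ + 16 / ρ ^ 2) * rexp (-(ρ / 2) * t) := by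
  have hx : t ≤ sinh t := Real.self_le_sinh_iff.2 ht
  have hx0 : 0 ≤ sinh t := ht.trans hx
  set x := sinh t
  have h1 : ρ * x / 4 ≤ rexp (ρ * x / 4) := by linarith [Real.add_one_le_exp (ρ * x / 4)]
  have hsq : rexp (ρ * x / 4) ^ 2 = rexp (ρ * x / 2) := by
    rw [← Real.exp_nat_mul]; congr 1; push_cast; ring
  have h4 : rexp (ρ * x / 4) ≤ rexp (ρ * x / 2) := Real.exp_le_exp.2 (by nlinarith [mul_nonneg hρ.le hx0])
  have h0 : 1 ≤ rexp (ρ * x / 2) := Real.one_le_exp (by positivity)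
  have h2 : x ≤ 4 / ρ * rexp (ρ * x / 2) := by
    calc x = 4 / ρ * (ρ * x / 4) := by field_simp
      _ ≤ _ := by gcongr; exact h1.trans h4
  have h3 : x ^ 2 ≤ 16 / ρ ^ 2 * rexp (ρ * x / 2) := by
    calc x ^ 2 = 16 / ρ ^ 2 * (ρ * x / 4) ^ 2 := by field_simp; ring
      _ ≤ _ := by rw [← hsq]; gcongr
  have h5 : besK ν τ t ≤ rexp (-(ρ * x)) := by
    apply Real.exp_le_exp.2
    nlinarith [mul_nonneg hν ht, mul_le_mul_of_nonneg_right hρτ hx0]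
  have h6 : rexp (ρ * x / 2) * rexp (-(ρ * x)) ≤ rexp (-(ρ / 2) * t) := by
    rw [← Real.exp_add]
    apply Real.exp_le_exp.2
    nlinarith [mul_le_mul_of_nonneg_left hx hρ.le]
  calc (1 + x + x ^ 2) * besK ν τ t ≤
      (rexp (ρ * x / 2) + 4 / ρ * rexp (ρ * x / 2) + 16 / ρ ^ 2 * rexp (ρ * x / 2)) *
        rexp (-(ρ * x)) := by
        have := (besK_pos ν τ t).le
        gcongr
    _ = (1 + 4 / ρ + 16 / ρ ^ 2) * (rexp (ρ * x / 2) * rexp (-(ρ * x))) := by ring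
    _ ≤ _ := by gcongr

lemma continuous_besK (ν τ : ℝ) : Continuous (besK ν τ) := by unfold besK; fun_prop

lemma hasDerivAt_besK (ν τ t : ℝ) :
    HasDerivAt (fun τ => besK ν τ t) (-(rexp τ * sinh t) * besK ν τ t) τ := by
  have h := (((Real.hasDerivAt_exp τ).mul_const (sinh t)).const_sub (-(ν * t))).exp
  unfold besK
  exact h.congr_deriv (by ring)

lemma integrableOn_of_le_besK {ν τ C : ℝ} (hν : 0 ≤ ν) {f : ℝ → ℝ} (hf : Continuous f)
    (h : ∀ t, 0 ≤ t → |f t| ≤ C * ((1 + sinh t + sinh t ^ 2) * besK ν τ t)) :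
    IntegrableOn f (Ioi 0) := by
  have hi := (exp_neg_integrableOn_Ioi 0 (half_pos (Real.exp_pos τ))).const_mul
    (|C| * (1 + 4 / rexp τ + 16 / rexp τ ^ 2))
  refine Integrable.mono' hi hf.aestronglyMeasurable.restrict ?_
  refine (ae_restrict_iff' measurableSet_Ioi).2 (ae_of_all _ fun t ht => ?_)
  have ht0 : (0 : ℝ) ≤ t := le_of_lt ht
  have h0 := Real.sinh_nonneg_iff.2 ht0
  have h1 : 0 ≤ (1 + sinh t + sinh t ^ 2) * besK ν τ t :=
    mul_nonneg (by positivity) (besK_pos _ _ _).le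
  rw [Real.norm_eq_abs]
  calc |f t| ≤ |C| * ((1 + sinh t + sinh t ^ 2) * besK ν τ t) :=
        (h t ht0).trans (mul_le_mul_of_nonneg_right (le_abs_self _) h1)
    _ ≤ |C| * ((1 + 4 / rexp τ + 16 / rexp τ ^ 2) * rexp (-(rexp τ / 2) * t)) := by
        exact mul_le_mul_of_nonneg_left (poly_mul_besK_le hν (Real.exp_pos τ) le_rfl ht0)
          (abs_nonneg _)
    _ = _ := by ring

lemma hasDerivAt_integral_besK {ν τ₀ C : ℝ} (hν : 0 ≤ ν) {F F' : ℝ → ℝ → ℝ}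
    (hF : ∀ τ, Continuous (F τ)) (hF' : ∀ τ, Continuous (F' τ))
    (hd : ∀ τ t, HasDerivAt (fun τ => F τ t) (F' τ t) τ)
    (hFC : ∀ τ ∈ Ioo (τ₀ - 1) (τ₀ + 1), ∀ t, 0 ≤ t →
      |F τ t| ≤ C * ((1 + sinh t + sinh t ^ 2) * besK ν τ t))
    (hFC' : ∀ τ ∈ Ioo (τ₀ - 1) (τ₀ + 1), ∀ t, 0 ≤ t →
      |F' τ t| ≤ C * ((1 + sinh t + sinh t ^ 2) * besK ν τ t)) :
    HasDerivAt (fun τ => ∫ t in Ioi (0 : ℝ), F τ t) (∫ t in Ioi (0 : ℝ), F' τ₀ t) τ₀ := by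
  have hmem : Ioo (τ₀ - 1) (τ₀ + 1) ∈ nhds τ₀ := Ioo_mem_nhds (by linarith) (by linarith)
  have h0 : τ₀ ∈ Ioo (τ₀ - 1) (τ₀ + 1) := mem_of_mem_nhds hmem
  set ρ := rexp (τ₀ - 1)
  have hρ : 0 < ρ := Real.exp_pos _
  have hi := (exp_neg_integrableOn_Ioi 0 (half_pos hρ)).const_mul
    (|C| * (1 + 4 / ρ + 16 / ρ ^ 2))
  refine (hasDerivAt_integral_of_dominated_loc_of_deriv_le hmem ?_ ?_ ?_ ?_ hi ?_).2
  · exact Eventually.of_forall fun τ => (hF τ).aestronglyMeasurable.restrict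
  · exact integrableOn_of_le_besK hν (hF τ₀) (hFC τ₀ h0)
  · exact (hF' τ₀).aestronglyMeasurable.restrict
  · refine (ae_restrict_iff' measurableSet_Ioi).2 (ae_of_all _ fun t ht τ hτ => ?_)
    have ht0 : (0 : ℝ) ≤ t := le_of_lt ht
    have h0 := Real.sinh_nonneg_iff.2 ht0
    have h1 : 0 ≤ (1 + sinh t + sinh t ^ 2) * besK ν τ t :=
      mul_nonneg (by positivity) (besK_pos _ _ _).le
    rw [Real.norm_eq_abs]
    calc |F' τ t| ≤ |C| * ((1 + sinh t + sinh t ^ 2) * besK ν τ t) :=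
          (hFC' τ hτ t ht0).trans (mul_le_mul_of_nonneg_right (le_abs_self _) h1)
      _ ≤ |C| * ((1 + 4 / ρ + 16 / ρ ^ 2) * rexp (-(ρ / 2) * t)) := by
          exact mul_le_mul_of_nonneg_left
            (poly_mul_besK_le hν hρ (Real.exp_le_exp.2 hτ.1.le) ht0) (abs_nonneg _)
      _ = _ := by ring
  · exact ae_of_all _ fun t τ _ => hd τ t

lemma hasDerivAt_besB {ν : ℝ} (hν : 0 ≤ ν) (τ : ℝ) : HasDerivAt (besB ν) (besB' ν τ) τ := by
  have hbd : ∀ σ ∈ Ioo (τ - 1) (τ + 1), rexp σ ≤ rexp (τ + 1) := fun σ hσ =>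
    Real.exp_le_exp.2 hσ.2.le
  refine hasDerivAt_integral_besK (C := 1 + rexp (τ + 1)) hν (F := besK ν)
    (F' := fun τ t => -(rexp τ * sinh t) * besK ν τ t) (continuous_besK ν)
    (fun τ => by have := continuous_besK ν τ; fun_prop) (hasDerivAt_besK ν) ?_ ?_
  · intro σ hσ t ht
    have h0 := Real.sinh_nonneg_iff.2 ht
    have hk := besK_pos ν σ t
    rw [abs_of_pos hk, ← mul_assoc]
    apply le_mul_of_one_le_left hk.le
    nlinarith [Real.exp_pos (τ + 1), mul_nonneg (Real.exp_pos (τ + 1)).le h0, sq_nonneg (sinh t)]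
  · intro σ hσ t ht
    have h0 := Real.sinh_nonneg_iff.2 ht
    have hk := besK_pos ν σ t
    rw [abs_mul, abs_neg, abs_of_pos hk, abs_of_nonneg (by positivity), ← mul_assoc]
    refine mul_le_mul_of_nonneg_right ?_ hk.le
    have := hbd σ hσ
    nlinarith [Real.exp_pos (τ + 1), mul_le_mul_of_nonneg_right this h0, sq_nonneg (sinh t),
      mul_nonneg (Real.exp_pos (τ + 1)).le (sq_nonneg (sinh t))]

lemma hasDerivAt_besB' {ν : ℝ} (hν : 0 ≤ ν) (τ : ℝ) :
    HasDerivAt (besB' ν) ((ν ^ 2 - rexp τ ^ 2) * besB ν τ - (ν - rexp τ)) τ := by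
  have hbd : ∀ σ ∈ Ioo (τ - 1) (τ + 1), rexp σ ≤ rexp (τ + 1) := fun σ hσ =>
    Real.exp_le_exp.2 hσ.2.le
  have hF'C : ∀ R σ t : ℝ, rexp σ ≤ R → 0 ≤ t →
      |(-(rexp σ * sinh t) + (rexp σ * sinh t) ^ 2) * besK ν σ t| ≤
        (1 + R + R ^ 2) * ((1 + sinh t + sinh t ^ 2) * besK ν σ t) := by
    intro R σ t hR ht
    have h0 := Real.sinh_nonneg_iff.2 ht
    have hk := besK_pos ν σ t
    have he := Real.exp_pos σ
    rw [abs_mul, abs_of_pos hk, ← mul_assoc]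
    gcongr
    refine (abs_add_le _ _).trans ?_
    rw [abs_neg, abs_of_nonneg (by positivity), abs_of_nonneg (by positivity)]
    have h1 : rexp σ * sinh t ≤ R * sinh t := by gcongr
    have h2 : (rexp σ * sinh t) ^ 2 ≤ (R * sinh t) ^ 2 := by gcongr
    have hR0 : 0 ≤ R := he.le.trans hR
    nlinarith [mul_nonneg hR0 h0, mul_nonneg (sq_nonneg R) h0, mul_nonneg hR0 (sq_nonneg (sinh t)),
      sq_nonneg R, sq_nonneg (sinh t)]
  have h1 : HasDerivAt (besB' ν) (∫ t in Ioi (0 : ℝ),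
      (-(rexp τ * sinh t) + (rexp τ * sinh t) ^ 2) * besK ν τ t) τ := by
    refine hasDerivAt_integral_besK (C := 1 + rexp (τ + 1) + rexp (τ + 1) ^ 2) hν
      (F := fun τ t => -(rexp τ * sinh t) * besK ν τ t)
      (F' := fun τ t => (-(rexp τ * sinh t) + (rexp τ * sinh t) ^ 2) * besK ν τ t)
      (fun τ => by have := continuous_besK ν τ; fun_prop)
      (fun τ => by have := continuous_besK ν τ; fun_prop) ?_ ?_
      (fun σ hσ t ht => hF'C _ σ t (hbd σ hσ) ht)
    · intro σ t
      have h0 : HasDerivAt (fun τ => -(rexp τ * sinh t)) (-(rexp σ * sinh t)) σ :=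
        ((Real.hasDerivAt_exp σ).mul_const (sinh t)).neg
      have h := h0.mul (hasDerivAt_besK ν σ t)
      exact h.congr_deriv (by ring)
    · intro σ hσ t ht
      have h0 := Real.sinh_nonneg_iff.2 ht
      have hk := besK_pos ν σ t
      rw [abs_mul, abs_neg, abs_of_pos hk, abs_of_nonneg (by positivity), ← mul_assoc]
      refine mul_le_mul_of_nonneg_right ?_ hk.le
      have := hbd σ hσ
      nlinarith [Real.exp_pos (τ + 1), mul_le_mul_of_nonneg_right this h0, sq_nonneg (sinh t),
        mul_nonneg (Real.exp_pos (τ + 1)).le (sq_nonneg (sinh t)), sq_nonneg (rexp (τ + 1)),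
        mul_nonneg (sq_nonneg (rexp (τ + 1))) h0]
  refine h1.congr_deriv ?_
  have hiB : IntegrableOn (besK ν τ) (Ioi 0) := by
    refine integrableOn_of_le_besK (C := 1) (τ := τ) hν (continuous_besK ν τ) fun t ht => ?_
    have h0 := Real.sinh_nonneg_iff.2 ht
    have hk := besK_pos ν τ t
    rw [abs_of_pos hk, ← mul_assoc]
    apply le_mul_of_one_le_left hk.le
    nlinarith [sq_nonneg (sinh t)]
  have hi2 : IntegrableOn (fun t => (-(rexp τ * sinh t) + (rexp τ * sinh t) ^ 2) * besK ν τ t)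
      (Ioi 0) := integrableOn_of_le_besK hν
    (by have := continuous_besK ν τ; fun_prop) (fun t ht => hF'C _ τ t le_rfl ht)
  have h2 : ∫ t in Ioi (0 : ℝ), ((-(rexp τ * sinh t) + (rexp τ * sinh t) ^ 2) * besK ν τ t +
      (rexp τ ^ 2 - ν ^ 2) * besK ν τ t) = 0 - (ν - rexp τ * cosh 0) * besK ν τ 0 := by
    refine integral_Ioi_of_hasDerivAt_of_tendsto (f := fun t => (ν - rexp τ * cosh t) * besK ν τ t)
      ?_ ?_ (hi2.add (hiB.const_mul _)) ?_
    · apply Continuous.continuousWithinAt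
      have := continuous_besK ν τ
      fun_prop
    · intro t _
      have hk : HasDerivAt (besK ν τ) (besK ν τ t * (-(ν * 1) - rexp τ * cosh t)) t :=
        ((((hasDerivAt_id t).const_mul ν).neg).sub ((Real.hasDerivAt_sinh t).const_mul _)).exp
      have h := (((Real.hasDerivAt_cosh t).const_mul (rexp τ)).const_sub ν).mul hk
      refine h.congr_deriv ?_
      have := Real.cosh_sq t
      linear_combination besK ν τ t * (rexp τ) ^ 2 * this
    · have hlim : Tendsto (fun t => (ν + rexp τ) * ((1 + 4 / rexp τ + 16 / rexp τ ^ 2) *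
          rexp (-(rexp τ / 2) * t))) atTop (nhds 0) := by
        have : Tendsto (fun t : ℝ => -(rexp τ / 2) * t) atTop atBot :=
          tendsto_id.const_mul_atTop_of_neg (by have := Real.exp_pos τ; linarith)
        simpa using ((Real.tendsto_exp_atBot.comp this).const_mul
          (1 + 4 / rexp τ + 16 / rexp τ ^ 2)).const_mul (ν + rexp τ)
      apply squeeze_zero_norm' _ hlim
      filter_upwards [eventually_ge_atTop 0] with t ht
      have h0 := Real.sinh_nonneg_iff.2 ht
      have hk := besK_pos ν τ t
      have hp := poly_mul_besK_le hν (Real.exp_pos τ) le_rfl ht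
      rw [norm_mul, Real.norm_eq_abs, Real.norm_eq_abs, abs_of_pos hk]
      refine le_trans ?_ (mul_le_mul_of_nonneg_left hp (by positivity))
      rw [← mul_assoc]
      gcongr
      refine (abs_sub _ _).trans ?_
      rw [abs_of_nonneg hν, abs_of_pos (by positivity)]
      have hc : cosh t ≤ 1 + sinh t := by
        have := Real.cosh_sub_sinh t
        have : rexp (-t) ≤ 1 := Real.exp_le_one_iff.2 (by linarith)
        linarith
      have he := Real.exp_pos τ
      have hc2 := mul_le_mul_of_nonneg_left hc he.le
      nlinarith [mul_nonneg hν h0, mul_nonneg hν (sq_nonneg (sinh t)),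
        mul_nonneg he.le (sq_nonneg (sinh t))]
  rw [integral_add hi2 (hiB.const_mul _), integral_const_mul] at h2
  simp only [besK, cosh_zero, sinh_zero, mul_zero, neg_zero, sub_zero, Real.exp_zero, mul_one] at h2
  unfold besB besK
  linear_combination h2

/-- `2π` times the Bessel function `J_ν` at `e^τ`. -/
noncomputable def bes (ν τ : ℝ) : ℝ := besA ν τ - 2 * sin (ν * π) * besB ν τ

/-- The derivative of `bes`. -/
noncomputable def bes' (ν τ : ℝ) : ℝ := besA' ν τ - 2 * sin (ν * π) * besB' ν τ

lemma hasDerivAt_bes {ν : ℝ} (hν : 0 ≤ ν) (τ : ℝ) : HasDerivAt (bes ν) (bes' ν τ) τ :=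
  (hasDerivAt_besA ν τ).sub ((hasDerivAt_besB hν τ).const_mul _)

lemma hasDerivAt_bes' {ν : ℝ} (hν : 0 ≤ ν) (τ : ℝ) :
    HasDerivAt (bes' ν) ((ν ^ 2 - rexp τ ^ 2) * bes ν τ) τ := by
  have h := (hasDerivAt_besA' ν τ).sub ((hasDerivAt_besB' hν τ).const_mul (2 * sin (ν * π)))
  refine h.congr_deriv ?_
  unfold bes
  ring

lemma besB_nonneg (ν τ : ℝ) : 0 ≤ besB ν τ := integral_nonneg fun t => (besK_pos ν τ t).le

lemma besB_le {ν : ℝ} (hν : 0 ≤ ν) (τ : ℝ) : besB ν τ ≤ 1 / (ν + rexp τ) := by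
  have hp : 0 < ν + rexp τ := by positivity
  have hi := exp_neg_integrableOn_Ioi 0 hp
  have : 1 / (ν + rexp τ) = ∫ t in Ioi (0 : ℝ), rexp (-(ν + rexp τ) * t) := by
    rw [integral_exp_mul_Ioi (by linarith)]
    simp [neg_div_neg_eq, -neg_add_rev]
  rw [this]
  refine integral_mono_of_nonneg (ae_of_all _ fun t => (besK_pos ν τ t).le) hi ?_
  refine (ae_restrict_iff' measurableSet_Ioi).2 (ae_of_all _ fun t ht => ?_)
  apply Real.exp_le_exp.2
  have := Real.self_le_sinh_iff.2 (le_of_lt (show (0 : ℝ) < t from ht))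
  nlinarith [mul_le_mul_of_nonneg_left this (Real.exp_pos τ).le]

lemma abs_bes_le {ν : ℝ} (hν : 0 ≤ ν) (τ : ℝ) : |bes ν τ| ≤ 4 * π := by
  have hpi := Real.pi_pos
  have h1 : |besA ν τ| ≤ 2 * π := by
    have := intervalIntegral.norm_integral_le_of_norm_le_const (a := -π) (b := π)
      (f := fun s => cos (ν * s - rexp τ * sin s)) (C := 1) (fun s _ => abs_cos_le_one _)
    rw [Real.norm_eq_abs] at this
    rw [show |π - -π| = 2 * π by rw [sub_neg_eq_add, abs_of_pos (by linarith)]; ring] at this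
    simpa [besA] using this
  have h2 : |2 * sin (ν * π) * besB ν τ| ≤ 2 * π := by
    rw [abs_mul, abs_mul, abs_of_nonneg (besB_nonneg ν τ), abs_two]
    have h3 := Real.abs_sin_le_abs (x := ν * π)
    rw [abs_of_nonneg (show 0 ≤ ν * π by positivity)] at h3
    have h4 := besB_le hν τ
    have hp : 0 < ν + rexp τ := by positivity
    calc 2 * |sin (ν * π)| * besB ν τ ≤ 2 * (ν * π) * (1 / (ν + rexp τ)) := by
          gcongr
          exact besB_nonneg ν τ
      _ = 2 * π * (ν / (ν + rexp τ)) := by ring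
      _ ≤ 2 * π * 1 := by
          gcongr
          rw [div_le_one hp]
          linarith [Real.exp_pos τ]
      _ = 2 * π := by ring
  calc |bes ν τ| ≤ |besA ν τ| + |2 * sin (ν * π) * besB ν τ| := abs_sub _ _
    _ ≤ 4 * π := by linarith

end PolyEig

namespace PolyEig
open Real

lemma osc_add_osc_neg (u : ℝ) : osc u + osc (-u) = ((2 * cos u : ℝ) : ℂ) := by
  unfold osc
  push_cast
  rw [Complex.two_cos, neg_mul]

lemma besA_eq_integral_osc (ν τ : ℝ) :
    (besA ν τ : ℂ) = ∫ s in -π..π, osc (ν * s - rexp τ * sin s) := by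
  have hc : Continuous fun s => osc (ν * s - rexp τ * sin s) :=
    continuous_osc.comp (by fun_prop)
  have hc' : Continuous fun s => osc (-(ν * s - rexp τ * sin s)) :=
    continuous_osc.comp (by fun_prop)
  have h1 : ∫ s in -π..π, osc (-(ν * s - rexp τ * sin s)) =
      ∫ s in -π..π, osc (ν * s - rexp τ * sin s) := by
    have := intervalIntegral.integral_comp_neg (a := -π) (b := π)
      (fun s => osc (ν * s - rexp τ * sin s))
    simp only [neg_neg] at this
    rw [← this]
    congr 1
    ext s
    rw [sin_neg]
    congr 1
    ring
  have h2 : ∫ s in -π..π, (osc (ν * s - rexp τ * sin s) + osc (-(ν * s - rexp τ * sin s))) =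
      ((2 * besA ν τ : ℝ) : ℂ) := by
    simp_rw [osc_add_osc_neg]
    rw [intervalIntegral.integral_ofReal, intervalIntegral.integral_const_mul]
    rfl
  rw [intervalIntegral.integral_add (hc.intervalIntegrable _ _) (hc'.intervalIntegrable _ _),
    h1] at h2
  push_cast at h2
  linear_combination -h2 / 2

lemma norm_integral_osc_le {ν r a b : ℝ} (hν : 0 ≤ ν) (hr : 0 < r) (hab : a ≤ b) (hab2 : b - a ≤ 2)
    (hcos : ∀ s ∈ Icc a b, cos s ≤ -(1 / 2)) :
    ‖∫ s in a..b, osc (ν * s - r * sin s)‖ ≤ 12 / (ν + r) := by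
  set m := ν + r / 2 with hm
  have hm0 : 0 < m := by positivity
  have hψ : ∀ s ∈ Icc a b, m ≤ ν - r * cos s := fun s hs => by
    nlinarith [hcos s hs]
  have hψ0 : ∀ s ∈ Icc a b, ((ν - r * cos s : ℝ) : ℂ) ≠ 0 := fun s hs => by
    have := hψ s hs
    exact_mod_cast (by linarith : 0 < ν - r * cos s).ne'
  have huIcc : uIcc a b = Icc a b := uIcc_of_le hab
  let G : ℝ → ℂ := fun s => osc (ν * s - r * sin s) * (-Complex.I) / ((ν - r * cos s : ℝ) : ℂ)
  let R : ℝ → ℂ := fun s => osc (ν * s - r * sin s) * Complex.I * ((r * sin s : ℝ) : ℂ) /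
    ((ν - r * cos s : ℝ) : ℂ) ^ 2
  have hosc : Continuous fun s => osc (ν * s - r * sin s) := continuous_osc.comp (by fun_prop)
  have hRc : ContinuousOn R (uIcc a b) := by
    rw [huIcc]
    apply ContinuousOn.div
    · fun_prop
    · fun_prop
    · exact fun s hs => pow_ne_zero _ (hψ0 s hs)
  have hd : ∀ s ∈ uIcc a b, HasDerivAt G (osc (ν * s - r * sin s) + R s) s := by
    intro s hs
    rw [huIcc] at hs
    have h1 : HasDerivAt (fun s : ℝ => ν * s - r * sin s) (ν - r * cos s) s := by
      have := ((hasDerivAt_id s).const_mul ν).sub ((Real.hasDerivAt_sin s).const_mul r)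
      exact this.congr_deriv (by ring)
    have h2 : HasDerivAt (fun s : ℝ => ν - r * cos s) (r * sin s) s := by
      have := ((Real.hasDerivAt_cos s).const_mul r).const_sub ν
      exact this.congr_deriv (by ring)
    have h3 : HasDerivAt (fun s => osc (ν * s - r * sin s))
        (osc (ν * s - r * sin s) * (((ν - r * cos s : ℝ) : ℂ) * Complex.I)) s :=
      (h1.ofReal_comp.mul_const Complex.I).cexp
    have h4 := (h3.mul_const (-Complex.I)).div h2.ofReal_comp (hψ0 s hs)
    refine h4.congr_deriv ?_
    have := hψ0 s hs
    simp only [R]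
    field_simp
    linear_combination -osc (ν * s - r * sin s) * (((ν - r * cos s : ℝ) : ℂ) ^ 2) * Complex.I_sq
  have h_int := intervalIntegral.integral_eq_sub_of_hasDerivAt hd
    ((hosc.intervalIntegrable _ _).add hRc.intervalIntegrable)
  rw [intervalIntegral.integral_add (hosc.intervalIntegrable _ _) hRc.intervalIntegrable] at h_int
  have hG : ∀ s ∈ Icc a b, ‖G s‖ ≤ 1 / m := by
    intro s hs
    have := hψ s hs
    simp only [G]
    rw [norm_div, norm_mul, norm_osc, norm_neg, Complex.norm_I, Complex.norm_real,
      Real.norm_of_nonneg (by linarith), one_mul]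
    exact one_div_le_one_div_of_le hm0 this
  have hR : ‖∫ s in a..b, R s‖ ≤ 2 / m * |b - a| := by
    apply intervalIntegral.norm_integral_le_of_norm_le_const
    intro s hs
    rw [uIoc_of_le hab] at hs
    have := hψ s (Ioc_subset_Icc_self hs)
    simp only [R]
    rw [norm_div, norm_mul, norm_mul, norm_osc, Complex.norm_I, norm_pow, Complex.norm_real,
      Complex.norm_real, Real.norm_of_nonneg (r := ν - r * cos s) (by linarith), one_mul, one_mul]
    calc ‖r * sin s‖ / (ν - r * cos s) ^ 2 ≤ r / m ^ 2 := by
          apply div_le_div₀ hr.le _ (by positivity) (by gcongr)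
          rw [norm_mul, Real.norm_of_nonneg hr.le, Real.norm_eq_abs]
          exact mul_le_of_le_one_right hr.le (abs_sin_le_one s)
      _ ≤ 2 * m / m ^ 2 := by gcongr; linarith
      _ = 2 / m := by field_simp
  have e : ∫ s in a..b, osc (ν * s - r * sin s) = G b - G a - ∫ s in a..b, R s := by
    rw [← h_int]; ring
  rw [e]
  rw [abs_of_nonneg (by linarith)] at hR
  calc ‖G b - G a - ∫ s in a..b, R s‖ ≤ ‖G b‖ + ‖G a‖ + ‖∫ s in a..b, R s‖ :=
        (norm_sub_le _ _).trans (add_le_add (norm_sub_le _ _) le_rfl)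
    _ ≤ 1 / m + 1 / m + 2 / m * 2 := by
        refine add_le_add (add_le_add (hG b ⟨hab, le_rfl⟩) (hG a ⟨le_rfl, hab⟩)) (hR.trans ?_)
        gcongr
    _ = 6 / m := by ring
    _ ≤ 12 / (ν + r) := by
        rw [div_le_div_iff₀ hm0 (by positivity)]
        rw [hm]; linarith

lemma norm_bes_sub_window_le {ν τ h : ℝ} (hν0 : 0 ≤ ν) (hh : |h| ≤ π / 12) :
    ‖(bes ν τ : ℂ) - ∫ s in (-(5 * π / 6) - h)..(5 * π / 6 - h), osc (ν * s - rexp τ * sin s)‖ ≤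
      60 / (1 + ν + rexp τ) := by
  have hpi := Real.pi_pos
  have hpi4 := Real.pi_le_four
  have hr := Real.exp_pos τ
  obtain ⟨hh1, hh2⟩ := abs_le.1 hh
  have hosc : Continuous fun s => osc (ν * s - rexp τ * sin s) := continuous_osc.comp (by fun_prop)
  have hcos34 : cos (3 * π / 4) ≤ -(1 / 2) := by
    rw [show 3 * π / 4 = π - π / 4 by ring, cos_pi_sub, cos_pi_div_four]
    have : (1 : ℝ) ≤ √2 := by rw [Real.one_le_sqrt]; norm_num
    linarith
  have hI1 : ‖∫ s in (5 * π / 6 - h)..π, osc (ν * s - rexp τ * sin s)‖ ≤ 12 / (ν + rexp τ) := by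
    apply norm_integral_osc_le hν0 hr (by linarith) (by linarith)
    intro s hs
    refine (Real.cos_le_cos_of_nonneg_of_le_pi (by linarith) hs.2 ?_).trans hcos34
    linarith [hs.1]
  have hI2 : ‖∫ s in -π..(-(5 * π / 6) - h), osc (ν * s - rexp τ * sin s)‖ ≤
      12 / (ν + rexp τ) := by
    apply norm_integral_osc_le hν0 hr (by linarith) (by linarith)
    intro s hs
    rw [← cos_neg]
    refine (Real.cos_le_cos_of_nonneg_of_le_pi (by linarith) (by linarith [hs.1]) ?_).trans hcos34
    linarith [hs.2]
  have hB : ‖((2 * sin (ν * π) * besB ν τ : ℝ) : ℂ)‖ ≤ 2 / (ν + rexp τ) := by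
    have := besB_nonneg ν τ
    have h2 := besB_le hν0 τ
    rw [Complex.norm_real, norm_mul, norm_mul, Real.norm_eq_abs, Real.norm_eq_abs,
      Real.norm_of_nonneg this, abs_two]
    have h3 := abs_sin_le_one (ν * π)
    calc 2 * |sin (ν * π)| * besB ν τ ≤ 2 * 1 * (1 / (ν + rexp τ)) := by gcongr
      _ = _ := by ring
  have e : (bes ν τ : ℂ) - ∫ s in (-(5 * π / 6) - h)..(5 * π / 6 - h),
      osc (ν * s - rexp τ * sin s) = (∫ s in -π..(-(5 * π / 6) - h), osc (ν * s - rexp τ * sin s)) +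
      (∫ s in (5 * π / 6 - h)..π, osc (ν * s - rexp τ * sin s)) -
      ((2 * sin (ν * π) * besB ν τ : ℝ) : ℂ) := by
    have h1 := intervalIntegral.integral_add_adjacent_intervals
      (hosc.intervalIntegrable (μ := volume) (-π) (-(5 * π / 6) - h))
      (hosc.intervalIntegrable (-(5 * π / 6) - h) (5 * π / 6 - h))
    have h2 := intervalIntegral.integral_add_adjacent_intervals
      (hosc.intervalIntegrable (μ := volume) (-π) (5 * π / 6 - h))
      (hosc.intervalIntegrable (5 * π / 6 - h) π)
    rw [bes, Complex.ofReal_sub, besA_eq_integral_osc, ← h2, ← h1]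
    ring
  rcases le_total 1 (ν + rexp τ) with h1 | h1
  · rw [e]
    calc _ ≤ 12 / (ν + rexp τ) + 12 / (ν + rexp τ) + 2 / (ν + rexp τ) :=
          (norm_sub_le _ _).trans (add_le_add ((norm_add_le _ _).trans (add_le_add hI2 hI1)) hB)
      _ = 26 / (ν + rexp τ) := by ring
      _ ≤ 60 / (1 + ν + rexp τ) := by
          rw [div_le_div_iff₀ (by positivity) (by positivity)]
          linarith
  · have hw : ‖∫ s in (-(5 * π / 6) - h)..(5 * π / 6 - h), osc (ν * s - rexp τ * sin s)‖ ≤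
        1 * |(5 * π / 6 - h) - (-(5 * π / 6) - h)| :=
      intervalIntegral.norm_integral_le_of_norm_le_const fun s _ => (norm_osc _).le
    rw [show (5 * π / 6 - h) - (-(5 * π / 6) - h) = 5 * π / 3 by ring,
      abs_of_pos (by positivity)] at hw
    have hb : ‖(bes ν τ : ℂ)‖ ≤ 4 * π := by
      rw [Complex.norm_real]; exact abs_bes_le hν0 τ
    calc _ ≤ 4 * π + 1 * (5 * π / 3) := (norm_sub_le _ _).trans (add_le_add hb hw)
      _ ≤ 60 / 2 := by linarith [Real.pi_lt_d2]
      _ ≤ _ := by gcongr; linarith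

end PolyEig

namespace PolyEig
open Real

/-- `x` is a solution, bounded by `M`, of `x'' = (ν² - κ e^{2τ}) x` on `τ < T`. -/
structure BddSol (ν κ M T : ℝ) (x x' : ℝ → ℝ) : Prop where
  hν : 0 ≤ ν
  hκ : 0 ≤ κ
  d1 : ∀ τ < T, HasDerivAt x (x' τ) τ
  d2 : ∀ τ < T, HasDerivAt x' ((ν ^ 2 - κ * rexp (2 * τ)) * x τ) τ
  bd : ∀ τ < T, |x τ| ≤ M

variable {ν κ M T : ℝ} {x x' : ℝ → ℝ}

lemma BddSol.neg (h : BddSol ν κ M T x x') :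
    BddSol ν κ M T (fun τ => -x τ) (fun τ => -x' τ) where
  hν := h.hν
  hκ := h.hκ
  d1 τ hτ := (h.d1 τ hτ).fun_neg
  d2 τ hτ := (h.d2 τ hτ).fun_neg.congr_deriv (by ring)
  bd τ hτ := by rw [abs_neg]; exact h.bd τ hτ

lemma BddSol.nonneg_bound (h : BddSol ν κ M T x x') : 0 ≤ M :=
  (abs_nonneg _).trans (h.bd (T - 1) (by linarith))

lemma monotoneOn_Iic_of_hasDerivAt {f f' : ℝ → ℝ} {a : ℝ}
    (hf : ∀ τ ≤ a, HasDerivAt f (f' τ) τ) (hf' : ∀ τ ≤ a, 0 ≤ f' τ) : MonotoneOn f (Iic a) := by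
  refine monotoneOn_of_deriv_nonneg (convex_Iic a)
    (fun τ hτ => (hf τ hτ).continuousAt.continuousWithinAt)
    (fun τ hτ => (hf τ (show τ ∈ Iic a from interior_subset hτ)).differentiableAt.differentiableWithinAt) ?_
  intro τ hτ
  have h : τ ∈ Iic a := interior_subset hτ
  rw [(hf τ h).deriv]
  exact hf' τ h

lemma hasDerivAt_exp_mul (c τ : ℝ) : HasDerivAt (fun τ => rexp (c * τ)) (c * rexp (c * τ)) τ := by
  have := ((hasDerivAt_id τ).const_mul c).exp
  exact this.congr_deriv (by simp [mul_comm])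

lemma BddSol.neg_le_deriv_sub (h : BddSol ν κ M T x x') {τ₁ : ℝ} (hτ₁ : τ₁ < T) :
    -(κ * M * rexp (2 * τ₁)) ≤ x' τ₁ - ν * x τ₁ := by
  have hν := h.hν
  have hκ := h.hκ
  have hM := h.nonneg_bound
  let G : ℝ → ℝ := fun τ => rexp (ν * τ) * (x' τ - ν * x τ) + κ * M * rexp ((ν + 2) * τ)
  have hG : MonotoneOn G (Iic τ₁) := by
    refine monotoneOn_Iic_of_hasDerivAt (f' := fun τ =>
      κ * rexp ((ν + 2) * τ) * ((ν + 2) * M - x τ)) ?_ ?_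
    · intro τ hτ
      have hτT : τ < T := lt_of_le_of_lt hτ hτ₁
      have h1 := ((hasDerivAt_exp_mul ν τ).mul ((h.d2 τ hτT).sub ((h.d1 τ hτT).const_mul ν))).add
        ((hasDerivAt_exp_mul (ν + 2) τ).const_mul (κ * M))
      refine h1.congr_deriv ?_
      have e : rexp ((ν + 2) * τ) = rexp (ν * τ) * rexp (2 * τ) := by
        rw [← Real.exp_add]; ring_nf
      simp only [Pi.sub_apply]
      rw [e]; ring
    · intro τ hτ
      have hτT : τ < T := lt_of_le_of_lt hτ hτ₁
      have := (abs_le.1 (h.bd τ hτT)).2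
      have : 0 ≤ (ν + 2) * M - x τ := by nlinarith
      positivity
  by_contra! hneg
  set c := -G τ₁ with hc
  have e : rexp ((ν + 2) * τ₁) = rexp (ν * τ₁) * rexp (2 * τ₁) := by
    rw [← Real.exp_add]; ring_nf
  have hc0 : 0 < c := by
    have : G τ₁ = rexp (ν * τ₁) * ((x' τ₁ - ν * x τ₁) + κ * M * rexp (2 * τ₁)) := by
      simp only [G]; rw [e]; ring
    rw [hc, this]
    have := mul_pos (Real.exp_pos (ν * τ₁)) (by linarith :
      0 < -((x' τ₁ - ν * x τ₁) + κ * M * rexp (2 * τ₁)))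
    linarith
  have hw : ∀ τ ≤ τ₁, x' τ - ν * x τ ≤ -c * rexp (-(ν * τ)) := by
    intro τ hτ
    have h1 : G τ ≤ -c := by rw [hc, neg_neg]; exact hG hτ self_mem_Iic hτ
    have h2 : 0 ≤ κ * M * rexp ((ν + 2) * τ) := by positivity
    have h3 : rexp (ν * τ) * (x' τ - ν * x τ) ≤ -c := by simp only [G] at h1; linarith
    have h4 := mul_le_mul_of_nonneg_left h3 (Real.exp_pos (-(ν * τ))).le
    rw [← mul_assoc, ← Real.exp_add, neg_add_cancel, Real.exp_zero, one_mul] at h4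
    linarith
  let H : ℝ → ℝ := fun τ => -(rexp (-ν * τ) * (x τ + c * τ))
  have hH : MonotoneOn H (Iic τ₁) := by
    refine monotoneOn_Iic_of_hasDerivAt (f' := fun τ =>
      -(rexp (-ν * τ) * ((x' τ - ν * x τ) + c * (1 - ν * τ)))) ?_ ?_
    · intro τ hτ
      have hτT : τ < T := lt_of_le_of_lt hτ hτ₁
      have h1 := ((hasDerivAt_exp_mul (-ν) τ).mul
        ((h.d1 τ hτT).add ((hasDerivAt_id τ).const_mul c))).fun_neg
      refine h1.congr_deriv ?_
      simp only [Pi.add_apply, id]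
      ring
    · intro τ hτ
      have h1 := hw τ hτ
      have h2 := Real.add_one_le_exp (-(ν * τ))
      have h3 := mul_le_mul_of_nonneg_left h2 hc0.le
      have := mul_nonneg (Real.exp_pos (-ν * τ)).le
        (by linarith : 0 ≤ -((x' τ - ν * x τ) + c * (1 - ν * τ)))
      linarith
  set K := |H τ₁|
  have hK : 0 ≤ K := abs_nonneg _
  set τ := min (min τ₁ 0) (-(K + M + 1) / c)
  have hτ1 : τ ≤ τ₁ := (min_le_left _ _).trans (min_le_left _ _)
  have hτ0 : τ ≤ 0 := (min_le_left _ _).trans (min_le_right _ _)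
  have hτc : c * τ ≤ -(K + M + 1) := by
    have : τ ≤ -(K + M + 1) / c := min_le_right _ _
    rw [le_div_iff₀ hc0] at this
    linarith
  have h1 : H τ ≤ K := (hH hτ1 self_mem_Iic hτ1).trans (le_abs_self _)
  have h2 : -(x τ + c * τ) ≤ K := by
    by_cases hs : -(x τ + c * τ) ≤ 0
    · linarith
    · push Not at hs
      have : 1 ≤ rexp (-ν * τ) := Real.one_le_exp (by nlinarith)
      have h3 := mul_le_mul_of_nonneg_right this hs.le
      simp only [H] at h1
      linarith
  have := (abs_le.1 (h.bd τ (lt_of_le_of_lt hτ1 hτ₁))).2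
  linarith

lemma BddSol.abs_deriv_sub_le (h : BddSol ν κ M T x x') {τ : ℝ} (hτ : τ < T) :
    |x' τ - ν * x τ| ≤ κ * M * rexp (2 * τ) := by
  have h1 := h.neg_le_deriv_sub hτ
  have h2 := h.neg.neg_le_deriv_sub hτ
  exact abs_le.2 ⟨h1, by linarith⟩

lemma tendsto_exp_two_mul_atBot : Tendsto (fun τ : ℝ => rexp (2 * τ)) atBot (nhds 0) :=
  Real.tendsto_exp_atBot.comp (tendsto_id.const_mul_atBot (by norm_num))

/-- The growth of bounded solutions in the forbidden region. -/
lemma BddSol.sq_le_exp_mul (h : BddSol ν κ M T x x') {τ σ : ℝ} (hτσ : τ ≤ σ) (hσ : σ < T)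
    (hκσ : κ * rexp (2 * σ) ≤ ν ^ 2 / 4) : x τ ^ 2 ≤ rexp (ν * (τ - σ)) * x σ ^ 2 := by
  have hν := h.hν
  have hκ := h.hκ
  have hM := h.nonneg_bound
  let F : ℝ → ℝ := fun τ => x τ * x' τ - ν / 2 * x τ ^ 2
  have hF : MonotoneOn F (Iic σ) := by
    refine monotoneOn_Iic_of_hasDerivAt (f' := fun τ =>
      x' τ ^ 2 - ν * (x τ * x' τ) + (ν ^ 2 - κ * rexp (2 * τ)) * x τ ^ 2) ?_ ?_
    · intro τ hτ
      have hτT : τ < T := lt_of_le_of_lt hτ hσ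
      have h1 := ((h.d1 τ hτT).mul (h.d2 τ hτT)).sub (((h.d1 τ hτT).pow 2).const_mul (ν / 2))
      refine h1.congr_deriv ?_
      simp only [Nat.cast_ofNat, Nat.add_one_sub_one, pow_one]
      ring
    · intro τ hτ
      have : κ * rexp (2 * τ) ≤ ν ^ 2 / 4 := by
        refine le_trans ?_ hκσ
        gcongr
      have h2 := mul_le_mul_of_nonneg_right this (sq_nonneg (x τ))
      nlinarith [sq_nonneg (x' τ - ν / 2 * x τ), mul_nonneg (sq_nonneg ν) (sq_nonneg (x τ))]
  have hF0 : ∀ τ ≤ σ, 0 ≤ F τ := by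
    intro τ hτ
    have hlim : Tendsto (fun s : ℝ => -(M * (κ * M * rexp (2 * s)))) atBot (nhds 0) := by
      simpa using ((tendsto_exp_two_mul_atBot.const_mul (κ * M)).const_mul M).neg
    refine le_of_tendsto hlim ?_
    filter_upwards [eventually_le_atBot τ] with s hs
    have hsσ : s ≤ σ := hs.trans hτ
    have hsT : s < T := lt_of_le_of_lt hsσ hσ
    refine le_trans ?_ (hF hsσ hτ hs)
    have hw := h.abs_deriv_sub_le hsT
    have hx := h.bd s hsT
    have h3 : |x s * (x' s - ν * x s)| ≤ M * (κ * M * rexp (2 * s)) := by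
      rw [abs_mul]
      exact mul_le_mul hx hw (abs_nonneg _) hM
    have h4 := (abs_le.1 h3).1
    simp only [F]
    nlinarith [mul_nonneg hν (sq_nonneg (x s))]
  have hP : MonotoneOn (fun τ => rexp (-ν * τ) * x τ ^ 2) (Iic σ) := by
    refine monotoneOn_Iic_of_hasDerivAt (f' := fun τ => 2 * (rexp (-ν * τ) * F τ)) ?_ ?_
    · intro τ hτ
      have hτT : τ < T := lt_of_le_of_lt hτ hσ
      have h1 := (hasDerivAt_exp_mul (-ν) τ).mul ((h.d1 τ hτT).pow 2)
      refine h1.congr_deriv ?_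
      simp only [Nat.cast_ofNat, Nat.add_one_sub_one, pow_one, F, Pi.pow_apply]
      ring
    · intro τ hτ
      have := hF0 τ hτ
      positivity
  have h5 : rexp (-ν * τ) * x τ ^ 2 ≤ rexp (-ν * σ) * x σ ^ 2 := hP hτσ self_mem_Iic hτσ
  have h6 := mul_le_mul_of_nonneg_left h5 (Real.exp_pos (ν * τ)).le
  rw [← mul_assoc, ← mul_assoc, ← Real.exp_add, ← Real.exp_add,
    show ν * τ + -ν * τ = 0 by ring, Real.exp_zero, one_mul,
    show ν * τ + -ν * σ = ν * (τ - σ) by ring] at h6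
  exact h6

/-- Uniqueness for the Cauchy problem. -/
lemma eq_zero_of_ode {d d' : ℝ → ℝ} (hκ : 0 ≤ κ) (d1 : ∀ τ < T, HasDerivAt d (d' τ) τ)
    (d2 : ∀ τ < T, HasDerivAt d' ((ν ^ 2 - κ * rexp (2 * τ)) * d τ) τ) {τ₁ : ℝ} (hτ₁ : τ₁ < T)
    (h0 : d τ₁ = 0) (h0' : d' τ₁ = 0) {τ : ℝ} (hτ : τ < T) : d τ = 0 := by
  set β := max τ τ₁
  have hβ : β < T := max_lt hτ hτ₁
  set K := 1 + ν ^ 2 + κ * rexp (2 * β) with hK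
  let e : ℝ → ℝ := fun τ => d τ ^ 2 + d' τ ^ 2
  have he : ∀ s ≤ β, HasDerivAt e (2 * d s * d' s * (1 + (ν ^ 2 - κ * rexp (2 * s)))) s := by
    intro s hs
    have hsT : s < T := lt_of_le_of_lt hs hβ
    have h1 := ((d1 s hsT).pow 2).add ((d2 s hsT).pow 2)
    refine h1.congr_deriv ?_
    simp only [Nat.cast_ofNat, Nat.add_one_sub_one, pow_one]
    ring
  have hb : ∀ s ≤ β, |2 * d s * d' s * (1 + (ν ^ 2 - κ * rexp (2 * s)))| ≤ K * e s := by
    intro s hs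
    rw [abs_mul, mul_comm]
    have h1 : |1 + (ν ^ 2 - κ * rexp (2 * s))| ≤ K := by
      have h2 : κ * rexp (2 * s) ≤ κ * rexp (2 * β) := by gcongr
      have h3 : 0 ≤ κ * rexp (2 * s) := by positivity
      have h4 := sq_nonneg ν
      rw [abs_le]; constructor <;> linarith
    have h2 : |2 * d s * d' s| ≤ e s := by
      simp only [e]
      rw [abs_le]; constructor <;> nlinarith [sq_nonneg (d s + d' s), sq_nonneg (d s - d' s)]
    exact mul_le_mul h1 h2 (abs_nonneg _) ((abs_nonneg _).trans h1)
  have hm1 : MonotoneOn (fun s => rexp (K * s) * e s) (Iic β) := by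
    refine monotoneOn_Iic_of_hasDerivAt (fun s hs => (hasDerivAt_exp_mul K s).mul (he s hs)) ?_
    intro s hs
    have := (abs_le.1 (hb s hs)).1
    have := mul_nonneg (Real.exp_pos (K * s)).le (by linarith :
      0 ≤ 2 * d s * d' s * (1 + (ν ^ 2 - κ * rexp (2 * s))) + K * e s)
    linarith
  have hm2 : MonotoneOn (fun s => -(rexp (-K * s) * e s)) (Iic β) := by
    refine monotoneOn_Iic_of_hasDerivAt
      (fun s hs => ((hasDerivAt_exp_mul (-K) s).mul (he s hs)).fun_neg) ?_
    intro s hs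
    have := (abs_le.1 (hb s hs)).2
    have := mul_nonneg (Real.exp_pos (-K * s)).le (by linarith :
      0 ≤ K * e s - 2 * d s * d' s * (1 + (ν ^ 2 - κ * rexp (2 * s))))
    linarith
  have he0 : e τ₁ = 0 := by simp [e, h0, h0']
  have hen : 0 ≤ e τ := by positivity
  have hle : e τ ≤ 0 := by
    rcases le_total τ τ₁ with h | h
    · have := hm1 (le_max_left τ τ₁) (le_max_right τ τ₁) h
      simp only [he0, mul_zero] at this
      exact (mul_nonpos_iff_pos_imp_nonpos.1 this).1 (Real.exp_pos _)
    · have := hm2 (le_max_right τ τ₁) (le_max_left τ τ₁) h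
      simp only [he0, mul_zero, neg_zero, neg_nonneg] at this
      exact (mul_nonpos_iff_pos_imp_nonpos.1 this).1 (Real.exp_pos _)
  have : d τ ^ 2 + d' τ ^ 2 = 0 := le_antisymm hle hen
  nlinarith [sq_nonneg (d τ), sq_nonneg (d' τ)]

/-- Bounded solutions form an at most one-dimensional space. -/
lemma BddSol.exists_eq_mul {M₂ : ℝ} {y y' : ℝ → ℝ} (hx : BddSol ν κ M T x x')
    (hy : BddSol ν κ M₂ T y y') {τ₁ : ℝ} (hτ₁ : τ₁ < T) (hy1 : y τ₁ ≠ 0) :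
    ∃ a, ∀ τ < T, x τ = a * y τ := by
  have hW : ∀ τ < T, x τ * y' τ - y τ * x' τ = 0 := by
    intro τ hτ
    have hd : ∀ s ≤ τ, HasDerivAt (fun s => x s * y' s - y s * x' s) 0 s := by
      intro s hs
      have hsT := lt_of_le_of_lt hs hτ
      have h1 := ((hx.d1 s hsT).mul (hy.d2 s hsT)).sub ((hy.d1 s hsT).mul (hx.d2 s hsT))
      exact h1.congr_deriv (by ring)
    have hm1 := monotoneOn_Iic_of_hasDerivAt hd (fun _ _ => le_rfl)
    have hm2 := monotoneOn_Iic_of_hasDerivAt (fun s hs => (hd s hs).fun_neg)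
      (fun _ _ => by simp)
    have hlim : Tendsto (fun s : ℝ => M * (κ * M₂ * rexp (2 * s)) + M₂ * (κ * M * rexp (2 * s)))
        atBot (nhds 0) := by
      simpa using ((tendsto_exp_two_mul_atBot.const_mul (κ * M₂)).const_mul M).add
        ((tendsto_exp_two_mul_atBot.const_mul (κ * M)).const_mul M₂)
    have : |x τ * y' τ - y τ * x' τ| ≤ 0 := by
      refine ge_of_tendsto hlim ?_
      filter_upwards [eventually_le_atBot τ] with s hs
      have hsT := lt_of_le_of_lt hs hτ
      have e1 := hm1 hs self_mem_Iic hs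
      have e2 := hm2 hs self_mem_Iic hs
      simp only at e1 e2
      have e3 : x τ * y' τ - y τ * x' τ = x s * (y' s - ν * y s) - y s * (x' s - ν * x s) := by
        linarith
      rw [e3]
      refine (abs_sub _ _).trans (add_le_add ?_ ?_)
      · rw [abs_mul]
        exact mul_le_mul (hx.bd s hsT) (hy.abs_deriv_sub_le hsT) (abs_nonneg _) hx.nonneg_bound
      · rw [abs_mul]
        exact mul_le_mul (hy.bd s hsT) (hx.abs_deriv_sub_le hsT) (abs_nonneg _) hy.nonneg_bound
    exact abs_nonpos_iff.1 this
  refine ⟨x τ₁ / y τ₁, fun τ hτ => ?_⟩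
  have := eq_zero_of_ode (ν := ν) (T := T) (d := fun τ => x τ - x τ₁ / y τ₁ * y τ)
    (d' := fun τ => x' τ - x τ₁ / y τ₁ * y' τ) hx.hκ
    (fun τ hτ => (hx.d1 τ hτ).sub ((hy.d1 τ hτ).const_mul _))
    (fun τ hτ => ((hx.d2 τ hτ).sub ((hy.d2 τ hτ).const_mul _)).congr_deriv (by ring)) hτ₁
    (by field_simp; ring) ?_ hτ
  · linarith
  · have := hW τ₁ hτ₁
    field_simp
    linarith

end PolyEig

namespace PolyEig
open Real

/-- The real part of the Laplace transform of the Bessel kernel. -/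
noncomputable def lapKer (ν η x : ℝ) : ℝ :=
  (η * cos (ν * x) - (1 - cos x) * sin (ν * x)) / (η ^ 2 + (1 - cos x) ^ 2)

lemma continuous_lapKer (ν : ℝ) {η : ℝ} (hη : 0 < η) : Continuous (lapKer ν η) := by
  unfold lapKer
  refine Continuous.div (by fun_prop) (by fun_prop) fun x => ?_
  have := sq_nonneg (1 - cos x)
  positivity

lemma integral_lapKer_ge (ν : ℝ) {k : ℝ} (hk : 0 < k) (hk1 : k ≤ 1) :
    8 / 5 / k - (2 * π + ν ^ 2 * π ^ 3 / 8) ≤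
      ∫ x in (-(3 * π / 2))..(π / 2), lapKer ν (k ^ 2) x := by
  have hpi := Real.pi_pos
  have hpi3 := Real.pi_gt_three
  have hη : 0 < k ^ 2 := by positivity
  have hcont := continuous_lapKer ν hη
  have hden : ∀ x, 0 < (k ^ 2) ^ 2 + (1 - cos x) ^ 2 := fun x => by
    have := sq_nonneg (1 - cos x)
    positivity
  rw [← intervalIntegral.integral_add_adjacent_intervals (hcont.intervalIntegrable _ (-(π / 2)))
    (hcont.intervalIntegrable _ _)]
  have h1 : ‖∫ x in (-(3 * π / 2))..(-(π / 2)), lapKer ν (k ^ 2) x‖ ≤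
      2 * |-(π / 2) - -(3 * π / 2)| := by
    apply intervalIntegral.norm_integral_le_of_norm_le_const
    intro x hx
    rw [uIoc_of_le (by linarith)] at hx
    have hc : cos x ≤ 0 := by
      rw [← cos_neg]
      exact Real.cos_nonpos_of_pi_div_two_le_of_le (by linarith [hx.2]) (by linarith [hx.1])
    rw [lapKer, norm_div, Real.norm_of_nonneg (hden x).le, div_le_iff₀ (hden x)]
    have hb : 1 ≤ 1 - cos x := by linarith
    calc ‖k ^ 2 * cos (ν * x) - (1 - cos x) * sin (ν * x)‖ ≤ k ^ 2 * 1 + (1 - cos x) * 1 := by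
          refine (norm_sub_le _ _).trans (add_le_add ?_ ?_)
          · rw [norm_mul, Real.norm_of_nonneg hη.le]
            exact mul_le_mul_of_nonneg_left (abs_cos_le_one _) hη.le
          · rw [norm_mul, Real.norm_of_nonneg (by linarith : 0 ≤ 1 - cos x)]
            exact mul_le_mul_of_nonneg_left (abs_sin_le_one _) (by linarith)
      _ ≤ 2 * ((k ^ 2) ^ 2 + (1 - cos x) ^ 2) := by
          have : k ^ 2 ≤ 1 := pow_le_one₀ hk.le hk1
          nlinarith
  have h2 : 8 / 5 / k - ν ^ 2 * π ^ 3 / 8 ≤ ∫ x in (-(π / 2))..(π / 2), lapKer ν (k ^ 2) x := by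
    have hneg : ∫ x in (-(π / 2))..(π / 2), lapKer ν (k ^ 2) (-x) =
        ∫ x in (-(π / 2))..(π / 2), lapKer ν (k ^ 2) x := by
      rw [intervalIntegral.integral_comp_neg, neg_neg]
    have hcontn : Continuous fun x => lapKer ν (k ^ 2) (-x) := hcont.comp continuous_neg
    have hc1 : Continuous fun x => k ^ 2 / ((k ^ 2) ^ 2 + (1 - cos x) ^ 2) :=
      Continuous.div (by fun_prop) (by fun_prop) fun x => (hden x).ne'
    have hge : ∫ x in (-(π / 2))..(π / 2),
        2 * (k ^ 2 / ((k ^ 2) ^ 2 + (1 - cos x) ^ 2) - ν ^ 2 * π ^ 2 / 8) ≤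
        ∫ x in (-(π / 2))..(π / 2), (lapKer ν (k ^ 2) x + lapKer ν (k ^ 2) (-x)) := by
      apply intervalIntegral.integral_mono_on (by linarith)
      · apply Continuous.intervalIntegrable; fun_prop
      · apply Continuous.intervalIntegrable; fun_prop
      · intro x hx
        have e : lapKer ν (k ^ 2) x + lapKer ν (k ^ 2) (-x) =
            2 * (k ^ 2 * cos (ν * x) / ((k ^ 2) ^ 2 + (1 - cos x) ^ 2)) := by
          simp only [lapKer, mul_neg, cos_neg, sin_neg]
          ring
        rw [e]
        apply mul_le_mul_of_nonneg_left _ (by norm_num)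
        have hb : 2 / π ^ 2 * x ^ 2 ≤ 1 - cos x := by
          have := Real.cos_le_one_sub_mul_cos_sq (x := x) (by
            rw [abs_le]; constructor <;> linarith [hx.1, hx.2])
          linarith
        have hc : 1 - (ν * x) ^ 2 / 2 ≤ cos (ν * x) := Real.one_sub_sq_div_two_le_cos
        rw [sub_le_iff_le_add, div_add' _ _ _ (hden x).ne', div_le_div_iff_of_pos_right (hden x)]
        have h3 : 2 * k ^ 2 * (1 - cos x) ≤ (k ^ 2) ^ 2 + (1 - cos x) ^ 2 := by
          nlinarith [sq_nonneg (k ^ 2 - (1 - cos x))]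
        have h4 : k ^ 2 * x ^ 2 ≤ π ^ 2 / 4 * ((k ^ 2) ^ 2 + (1 - cos x) ^ 2) := by
          calc k ^ 2 * x ^ 2 = π ^ 2 / 4 * (2 * k ^ 2 * (2 / π ^ 2 * x ^ 2)) := by
                field_simp; ring
            _ ≤ π ^ 2 / 4 * (2 * k ^ 2 * (1 - cos x)) := by gcongr
            _ ≤ _ := by gcongr
        have h5 := mul_le_mul_of_nonneg_left hc hη.le
        have h6 := mul_le_mul_of_nonneg_left h4 (by positivity : 0 ≤ ν ^ 2 / 2)
        nlinarith
    rw [intervalIntegral.integral_add (hcont.intervalIntegrable _ _)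
      (hcontn.intervalIntegrable _ _), hneg,
      intervalIntegral.integral_const_mul,
      intervalIntegral.integral_sub (hc1.intervalIntegrable _ _) intervalIntegrable_const,
      intervalIntegral.integral_const, smul_eq_mul] at hge
    have hsub : ∫ x in (-k)..k, k ^ 2 / ((k ^ 2) ^ 2 + (1 - cos x) ^ 2) ≤
        ∫ x in (-(π / 2))..(π / 2), k ^ 2 / ((k ^ 2) ^ 2 + (1 - cos x) ^ 2) := by
      apply intervalIntegral.integral_mono_interval (by linarith) (by linarith) (by linarith)
      · exact ae_of_all _ fun x => div_nonneg hη.le (hden x).le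
      · exact hc1.intervalIntegrable _ _
    have hin : ∫ x in (-k)..k, 4 / 5 / k ^ 2 ≤
        ∫ x in (-k)..k, k ^ 2 / ((k ^ 2) ^ 2 + (1 - cos x) ^ 2) := by
      apply intervalIntegral.integral_mono_on (by linarith) intervalIntegrable_const
        (hc1.intervalIntegrable _ _)
      intro x hx
      have hb := Real.one_sub_sq_div_two_le_cos (x := x)
      have hx2 : x ^ 2 ≤ k ^ 2 := sq_le_sq' hx.1 hx.2
      have hb0 : 0 ≤ 1 - cos x := by linarith [cos_le_one x]
      have : (1 - cos x) ^ 2 ≤ (k ^ 2 / 2) ^ 2 := by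
        gcongr; linarith
      rw [div_div, div_le_div_iff₀ (by positivity) (hden x)]
      nlinarith
    rw [intervalIntegral.integral_const, smul_eq_mul] at hin
    have e2 : (k - -k) * (4 / 5 / k ^ 2) = 8 / 5 / k := by field_simp; ring
    rw [e2] at hin
    have e3 : (π / 2 - -(π / 2)) * (ν ^ 2 * π ^ 2 / 8) = ν ^ 2 * π ^ 3 / 8 := by ring
    rw [e3] at hge
    linarith
  rw [show |-(π / 2) - -(3 * π / 2)| = π by
    rw [abs_of_pos (by linarith)]; ring] at h1
  have := (abs_le.1 (Real.norm_eq_abs _ ▸ h1)).1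
  linarith

lemma integral_laplace_osc {η : ℝ} (hη : 0 < η) (ν s : ℝ) :
    ∫ r in Ioi (0 : ℝ), (rexp (-η * r) : ℂ) * osc r * osc (ν * s - r * sin s) =
      osc (ν * s) / (η - (1 - sin s : ℝ) * Complex.I) := by
  set a : ℂ := -(η - (1 - sin s : ℝ) * Complex.I) with ha
  have hre : a.re < 0 := by
    rw [ha, Complex.neg_re, Complex.sub_re, Complex.re_ofReal_mul]
    simp [hη]
  have e : ∀ r : ℝ, (rexp (-η * r) : ℂ) * osc r * osc (ν * s - r * sin s) =
      osc (ν * s) * Complex.exp (a * r) := by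
    intro r
    simp only [osc, ← Complex.exp_add, Complex.ofReal_exp, ha]
    congr 1
    push_cast
    ring
  simp_rw [e]
  rw [integral_const_mul, integral_exp_mul_complex_Ioi hre 0]
  simp only [Complex.ofReal_zero, mul_zero, Complex.exp_zero]
  rw [ha, neg_div, div_neg, neg_neg, mul_one_div]

lemma re_osc_div (η β u : ℝ) :
    (osc u / (η - β * Complex.I)).re = (η * cos u - β * sin u) / (η ^ 2 + β ^ 2) := by
  have h1 : (osc u).re = cos u := by simp [osc, Complex.exp_ofReal_mul_I_re]
  have h2 : (osc u).im = sin u := by simp [osc, Complex.exp_ofReal_mul_I_im]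
  rw [Complex.div_re, h1, h2]
  simp only [Complex.normSq_apply, Complex.sub_re, Complex.sub_im, Complex.ofReal_re,
    Complex.ofReal_im, Complex.re_ofReal_mul, Complex.im_ofReal_mul, Complex.I_re, Complex.I_im]
  rw [← add_div]
  congr 1 <;> ring

lemma laplace_besA (ν : ℝ) {η : ℝ} (hη : 0 < η) :
    (osc (-(ν * (π / 2))) * ∫ r in Ioi (0 : ℝ), (rexp (-η * r) : ℂ) * osc r * besA ν (log r)).re =
      ∫ x in (-(3 * π / 2))..(π / 2), lapKer ν η x := by
  have hpi := Real.pi_pos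
  have hle : -π ≤ π := by linarith
  have e1 : ∫ r in Ioi (0 : ℝ), (rexp (-η * r) : ℂ) * osc r * besA ν (log r) =
      ∫ r in Ioi (0 : ℝ), ∫ s in Ioc (-π) π,
        (rexp (-η * r) : ℂ) * osc r * osc (ν * s - r * sin s) := by
    refine setIntegral_congr_fun measurableSet_Ioi fun r hr => ?_
    rw [besA_eq_integral_osc, intervalIntegral.integral_of_le hle, integral_const_mul,
      Real.exp_log hr]
  have h_int : Integrable (Function.uncurry fun r s : ℝ =>
      (rexp (-η * r) : ℂ) * osc r * osc (ν * s - r * sin s))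
      ((volume.restrict (Ioi 0)).prod (volume.restrict (Ioc (-π) π))) := by
    have hb : Integrable (fun p : ℝ × ℝ => rexp (-η * p.1) * 1)
        ((volume.restrict (Ioi 0)).prod (volume.restrict (Ioc (-π) π))) :=
      Integrable.mul_prod (f := fun r => rexp (-η * r)) (g := fun _ : ℝ => (1 : ℝ))
        (exp_neg_integrableOn_Ioi 0 hη) (integrable_const _)
    refine hb.mono' ?_ (ae_of_all _ fun p => ?_)
    · apply Continuous.aestronglyMeasurable
      unfold Function.uncurry
      have := continuous_osc
      fun_prop
    · simp only [Function.uncurry]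
      rw [norm_mul, norm_mul, norm_osc, norm_osc, Complex.norm_real,
        Real.norm_of_nonneg (Real.exp_pos _).le, mul_one]
  rw [e1, integral_integral_swap h_int]
  simp_rw [integral_laplace_osc hη]
  rw [← integral_const_mul]
  have hcont : Continuous fun s : ℝ =>
      osc (-(ν * (π / 2))) * (osc (ν * s) / (η - (1 - sin s : ℝ) * Complex.I)) := by
    refine continuous_const.mul (Continuous.div ?_ (by fun_prop) fun s => ?_)
    · exact continuous_osc.comp (by fun_prop)
    · intro h
      have := congrArg Complex.re h
      rw [Complex.sub_re, Complex.re_ofReal_mul] at this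
      simp at this
      exact hη.ne' this
  rw [← intervalIntegral.integral_of_le hle]
  have hre := Complex.reCLM.intervalIntegral_comp_comm (hcont.intervalIntegrable (μ := volume) (-π) π)
  simp only [Complex.reCLM_apply] at hre
  rw [← hre]
  have := intervalIntegral.integral_comp_sub_right (a := -π) (b := π) (lapKer ν η) (π / 2)
  have e3 : ∫ x in (-(3 * π / 2))..(π / 2), lapKer ν η x =
      ∫ x in (-π - π / 2)..(π - π / 2), lapKer ν η x := by
    congr 1 <;> ring
  rw [e3, ← this]
  refine intervalIntegral.integral_congr fun s _ => ?_
  rw [← mul_div_assoc, ← osc_add, show -(ν * (π / 2)) + ν * s = ν * (s - π / 2) by ring,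
    re_osc_div, lapKer, Real.cos_sub_pi_div_two]

lemma one_le_of_besA_decay {ν A D : ℝ}
    (h : ∀ r > 0, |besA ν (log r)| ≤ A * r ^ (-(1 / 2) : ℝ) + D * r ^ (-(3 / 4) : ℝ)) :
    1 ≤ A * √π := by
  have hpi := Real.pi_pos
  set C := 2 * π + ν ^ 2 * π ^ 3 / 8 with hC
  have hΓ : 0 ≤ Real.Gamma (1 / 4) := (Real.Gamma_pos_of_pos (by norm_num)).le
  have key : ∀ k : ℝ, 0 < k → k ≤ 1 →
      8 / 5 ≤ A * √π + C * k + D * Real.Gamma (1 / 4) * k ^ (1 / 2 : ℝ) := by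
    intro k hk hk1
    have hη : 0 < k ^ 2 := by positivity
    have h1 := integral_lapKer_ge ν hk hk1
    rw [← laplace_besA ν hη] at h1
    have i1 := integrableOn_rpow_mul_exp_neg_mul_rpow (p := 1) (s := -(1 / 2)) (b := k ^ 2)
      (by norm_num) (by norm_num) hη
    have i2 := integrableOn_rpow_mul_exp_neg_mul_rpow (p := 1) (s := -(3 / 4)) (b := k ^ 2)
      (by norm_num) (by norm_num) hη
    have v1 := Real.integral_rpow_mul_exp_neg_mul_Ioi (a := 1 / 2) (r := k ^ 2) (by norm_num) hη
    have v2 := Real.integral_rpow_mul_exp_neg_mul_Ioi (a := 1 / 4) (r := k ^ 2) (by norm_num) hη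
    rw [show (1 / 2 - 1 : ℝ) = -(1 / 2) by norm_num, Real.Gamma_one_half_eq] at v1
    rw [show (1 / 4 - 1 : ℝ) = -(3 / 4) by norm_num] at v2
    simp only [Real.rpow_one, neg_mul] at i1 i2
    have hb : ‖∫ r in Ioi (0 : ℝ), (rexp (-k ^ 2 * r) : ℂ) * osc r * besA ν (log r)‖ ≤
        ∫ r in Ioi (0 : ℝ), (A * (r ^ (-(1 / 2) : ℝ) * rexp (-(k ^ 2 * r))) +
          D * (r ^ (-(3 / 4) : ℝ) * rexp (-(k ^ 2 * r)))) := by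
      refine norm_integral_le_of_norm_le ((i1.const_mul A).add (i2.const_mul D)) ?_
      refine (ae_restrict_iff' measurableSet_Ioi).2 (ae_of_all _ fun r hr => ?_)
      rw [norm_mul, norm_mul, norm_osc, mul_one, Complex.norm_real, Complex.norm_real,
        Real.norm_of_nonneg (Real.exp_pos _).le, neg_mul]
      have := mul_le_mul_of_nonneg_left (h r hr) (Real.exp_pos (-(k ^ 2 * r))).le
      rw [Real.norm_eq_abs]
      linarith
    rw [integral_add (i1.const_mul A) (i2.const_mul D), integral_const_mul, integral_const_mul,
      v1, v2] at hb
    have e1 : (1 / k ^ 2) ^ (1 / 2 : ℝ) = 1 / k := by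
      rw [← Real.sqrt_eq_rpow, Real.sqrt_div' _ hη.le, Real.sqrt_one, Real.sqrt_sq hk.le]
    have e2 : (1 / k ^ 2) ^ (1 / 4 : ℝ) = k ^ (1 / 2 : ℝ) / k := by
      rw [Real.div_rpow (by norm_num) hη.le, Real.one_rpow, ← Real.rpow_natCast, ← Real.rpow_mul hk.le]
      rw [div_eq_div_iff (by positivity) (by positivity), one_mul, ← Real.rpow_add hk]
      norm_num
    rw [e1, e2] at hb
    have h2 := (Complex.re_le_norm (osc (-(ν * (π / 2))) *
      ∫ r in Ioi (0 : ℝ), (rexp (-k ^ 2 * r) : ℂ) * osc r * besA ν (log r)))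
    rw [norm_mul, norm_osc, one_mul] at h2
    have h3 := mul_le_mul_of_nonneg_right (h1.trans (h2.trans hb)) hk.le
    have e4 : (8 / 5 / k - C) * k = 8 / 5 - C * k := by field_simp
    have e5 : (A * (1 / k * √π) + D * (k ^ (1 / 2 : ℝ) / k * Real.Gamma (1 / 4))) * k =
        A * √π + D * Real.Gamma (1 / 4) * k ^ (1 / 2 : ℝ) := by field_simp
    rw [e4, e5] at h3
    linarith
  have hlim : Tendsto (fun k : ℝ => A * √π + C * k + D * Real.Gamma (1 / 4) * k ^ (1 / 2 : ℝ))
      (nhdsWithin 0 (Ioi 0)) (nhds (A * √π + C * 0 + D * Real.Gamma (1 / 4) * 0 ^ (1 / 2 : ℝ))) := by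
    apply Tendsto.mono_left _ nhdsWithin_le_nhds
    apply Continuous.tendsto
    exact (continuous_const.add (continuous_const.mul continuous_id)).add
      (continuous_const.mul (Real.continuous_rpow_const (by norm_num)))
  have := ge_of_tendsto hlim (b := 8 / 5) (by
    filter_upwards [Ioo_mem_nhdsGT (zero_lt_one (α := ℝ))] with k hk
    exact key k hk.1 hk.2.le)
  rw [Real.zero_rpow (by norm_num)] at this
  linarith

end PolyEig

namespace PolyEig
open Real

lemma exp_two_mul_eq_sq (τ : ℝ) : rexp (2 * τ) = rexp τ ^ 2 := by
  rw [← Real.exp_nat_mul]; norm_num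

lemma bddSol_bes {ν : ℝ} (hν : 0 ≤ ν) (T : ℝ) : BddSol ν 1 (4 * π) T (bes ν) (bes' ν) where
  hν := hν
  hκ := zero_le_one
  d1 τ _ := hasDerivAt_bes hν τ
  d2 τ _ := (hasDerivAt_bes' hν τ).congr_deriv (by rw [one_mul, exp_two_mul_eq_sq])
  bd τ _ := abs_bes_le hν τ

/-- An energy measuring the amplitude of `bes` in the oscillatory region. -/
noncomputable def besQ (ν τ : ℝ) : ℝ :=
  rexp (-τ) * (bes' ν τ ^ 2 + bes ν τ * bes' ν τ +
    (rexp τ ^ 2 - ν ^ 2 + 1 / 2) * bes ν τ ^ 2)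

lemma hasDerivAt_besQ {ν : ℝ} (hν : 0 ≤ ν) (τ : ℝ) :
    HasDerivAt (besQ ν) (2 * (ν ^ 2 - 1 / 4) * rexp (-τ) * bes ν τ ^ 2) τ := by
  have hy := hasDerivAt_bes hν τ
  have hy' := hasDerivAt_bes' hν τ
  have he : HasDerivAt (fun τ => rexp (-τ)) (-rexp (-τ)) τ :=
    ((hasDerivAt_id τ).neg.exp).congr_deriv (by simp)
  have h := he.mul (((hy'.pow 2).add (hy.mul hy')).add
    (((((Real.hasDerivAt_exp τ).pow 2).sub_const (ν ^ 2)).add_const (1 / 2)).mul (hy.pow 2)))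
  refine h.congr_deriv ?_
  simp only [Nat.cast_ofNat, Nat.add_one_sub_one, pow_one, Pi.add_apply, Pi.mul_apply, Pi.pow_apply]
  ring

lemma le_besQ (ν τ : ℝ) :
    rexp (-τ) * ((rexp τ ^ 2 - max (ν ^ 2 - 1 / 4) 0) * bes ν τ ^ 2) ≤ besQ ν τ := by
  refine mul_le_mul_of_nonneg_left ?_ (Real.exp_pos _).le
  have h1 := mul_le_mul_of_nonneg_right (le_max_left (ν ^ 2 - 1 / 4) 0) (sq_nonneg (bes ν τ))
  nlinarith [sq_nonneg (bes' ν τ + bes ν τ / 2)]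

lemma besQ_nonneg_of_le {ν τ : ℝ} (h : max (ν ^ 2 - 1 / 4) 0 ≤ rexp τ ^ 2) : 0 ≤ besQ ν τ := by
  refine le_trans ?_ (le_besQ ν τ)
  have := sub_nonneg.2 h
  positivity

lemma exp_mul_bes_sq_le {ν τ₀ τ : ℝ} (hν : 0 ≤ ν) (hτ₀ : 2 * ν ≤ rexp τ₀) (hτ : τ₀ ≤ τ) :
    rexp τ * bes ν τ ^ 2 ≤ 4 / 3 * besQ ν τ₀ := by
  set μ := max (ν ^ 2 - 1 / 4) 0 with hμ
  have hμ0 : 0 ≤ μ := le_max_right _ _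
  have hN := Real.exp_pos τ₀
  have hμN : μ ≤ rexp τ₀ ^ 2 / 4 := by
    refine max_le ?_ (by positivity)
    nlinarith
  let g : ℝ → ℝ := fun s => 1 - μ * rexp (-2 * s)
  have hes : ∀ s, rexp (-2 * s) * rexp s ^ 2 = 1 := fun s => by
    rw [← exp_two_mul_eq_sq, ← Real.exp_add]; simp
  have hg : ∀ s, τ₀ ≤ s → 3 / 4 ≤ g s := by
    intro s hs
    have h1 : rexp τ₀ ^ 2 ≤ rexp s ^ 2 := by gcongr
    have h2 := mul_le_mul_of_nonneg_left (hμN.trans (by linarith : _ ≤ rexp s ^ 2 / 4))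
      (Real.exp_pos (-2 * s)).le
    have h3 := hes s
    simp only [g]
    linarith
  have hanti : AntitoneOn (fun s => besQ ν s / g s) (Ici τ₀) := by
    have hgd : ∀ s, HasDerivAt g (2 * μ * rexp (-2 * s)) s := fun s =>
      (((hasDerivAt_exp_mul (-2) s).const_mul μ).const_sub 1).congr_deriv (by ring)
    have hd : ∀ s ∈ Ici τ₀, HasDerivAt (fun s => besQ ν s / g s)
        ((2 * (ν ^ 2 - 1 / 4) * rexp (-s) * bes ν s ^ 2 * g s - besQ ν s *
          (2 * μ * rexp (-2 * s))) / g s ^ 2) s := fun s hs =>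
      (hasDerivAt_besQ hν s).div (hgd s) (by linarith [hg s hs])
    refine antitoneOn_of_deriv_nonpos (convex_Ici τ₀)
      (fun s hs => (hd s hs).continuousAt.continuousWithinAt)
      (fun s hs => (hd s (interior_subset hs)).differentiableAt.differentiableWithinAt) ?_
    intro s hs'
    have hs : s ∈ Ici τ₀ := interior_subset hs'
    rw [(hd s hs).deriv]
    apply div_nonpos_of_nonpos_of_nonneg _ (sq_nonneg _)
    have hgs := hg s hs
    have h1 : 2 * (ν ^ 2 - 1 / 4) * rexp (-s) * bes ν s ^ 2 * g s ≤
        2 * μ * rexp (-s) * bes ν s ^ 2 * g s := by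
      have := le_max_left (ν ^ 2 - 1 / 4) 0
      gcongr
    have h2 := mul_le_mul_of_nonneg_right (le_besQ ν s)
      (by positivity : 0 ≤ 2 * μ * rexp (-2 * s))
    have h3 : rexp (-s) * ((rexp s ^ 2 - μ) * bes ν s ^ 2) * (2 * μ * rexp (-2 * s)) =
        2 * μ * rexp (-s) * bes ν s ^ 2 * g s := by
      simp only [g]
      linear_combination (2 * μ * rexp (-s) * bes ν s ^ 2) * hes s
    linarith
  have h1 := hanti self_mem_Ici (mem_Ici.2 hτ) hτ
  have h0 := hg τ₀ le_rfl
  have hgτ := hg τ hτ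
  have hQ0 : 0 ≤ besQ ν τ₀ := besQ_nonneg_of_le (by linarith [sq_nonneg (rexp τ₀)])
  have h2 : rexp τ * bes ν τ ^ 2 ≤ besQ ν τ / g τ := by
    rw [le_div_iff₀ (by linarith)]
    refine le_trans (le_of_eq ?_) (le_besQ ν τ)
    have h3 : rexp (-τ) * rexp τ = 1 := by rw [← Real.exp_add]; simp
    have h4 : rexp (-2 * τ) * rexp τ = rexp (-τ) := by rw [← Real.exp_add]; congr 1; ring
    simp only [g]
    linear_combination (-μ * bes ν τ ^ 2) * h4 - (rexp τ * bes ν τ ^ 2) * h3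
  refine h2.trans (h1.trans ?_)
  rw [div_le_iff₀ (by linarith)]
  nlinarith

lemma le_besQ_of_two_mul_le {ν τ₀ : ℝ} (hν : 0 ≤ ν) (hτ₀ : 2 * ν ≤ rexp τ₀) :
    1 ≤ 4 / 3 * π * besQ ν τ₀ := by
  have hpi := Real.pi_pos
  set N := rexp τ₀ with hN
  have hN0 : 0 < N := Real.exp_pos _
  have hQ0 : 0 ≤ besQ ν τ₀ := besQ_nonneg_of_le (max_le (by rw [← hN]; nlinarith) (by positivity))
  obtain ⟨D, hD0, hD⟩ : ∃ D : ℝ, 0 ≤ D ∧ ∀ r > 0,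
      |2 * sin (ν * π) * besB ν (log r)| ≤ D * r ^ (-(3 / 4) : ℝ) := by
    rcases hν.eq_or_lt with h0 | h0
    · refine ⟨0, le_rfl, fun r _ => ?_⟩
      simp [← h0]
    · refine ⟨2 * (1 + 1 / ν), by positivity, fun r hr => ?_⟩
      have hb := besB_le hν (log r)
      have hb0 := besB_nonneg ν (log r)
      rw [Real.exp_log hr] at hb
      rw [abs_mul, abs_mul, abs_two, abs_of_nonneg hb0, Real.rpow_neg hr.le]
      have h1 : r ^ (3 / 4 : ℝ) ≤ 1 + r := by
        rcases le_total r 1 with h | h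
        · have := Real.rpow_le_one hr.le h (by norm_num : (0 : ℝ) ≤ 3 / 4)
          linarith
        · have := Real.rpow_le_rpow_of_exponent_le h (by norm_num : (3 / 4 : ℝ) ≤ 1)
          rw [Real.rpow_one] at this
          linarith
      have h2 : 1 / (ν + r) ≤ (1 + 1 / ν) * (r ^ (3 / 4 : ℝ))⁻¹ := by
        rw [← div_eq_mul_inv, div_le_div_iff₀ (by positivity) (by positivity), one_mul]
        refine h1.trans ?_
        have : (1 + 1 / ν) * (ν + r) = 1 + r + (ν + r / ν) := by field_simp; ring
        rw [this]
        have : 0 ≤ r / ν := by positivity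
        linarith
      calc 2 * |sin (ν * π)| * besB ν (log r) ≤ 2 * 1 * ((1 + 1 / ν) * (r ^ (3 / 4 : ℝ))⁻¹) := by
            gcongr
            · exact abs_sin_le_one _
            · exact hb.trans h2
        _ = _ := by ring
  have hdecay := one_le_of_besA_decay (ν := ν) (A := √(4 / 3 * besQ ν τ₀))
    (D := 4 * π * N ^ (3 / 4 : ℝ) + D) ?_
  · rw [← Real.sqrt_mul (by positivity)] at hdecay
    rw [Real.one_le_sqrt] at hdecay
    linarith
  intro r hr
  have hr34 : (0 : ℝ) < r ^ (-(3 / 4) : ℝ) := Real.rpow_pos_of_pos hr _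
  have hr12 : (0 : ℝ) < r ^ (-(1 / 2) : ℝ) := Real.rpow_pos_of_pos hr _
  have hbes : |bes ν (log r)| ≤ √(4 / 3 * besQ ν τ₀) * r ^ (-(1 / 2) : ℝ) +
      4 * π * N ^ (3 / 4 : ℝ) * r ^ (-(3 / 4) : ℝ) := by
    rcases le_total r N with h | h
    · have h1 := abs_bes_le hν (log r)
      have h2 : 1 ≤ N ^ (3 / 4 : ℝ) * r ^ (-(3 / 4) : ℝ) := by
        rw [Real.rpow_neg hr.le, ← div_eq_mul_inv, one_le_div (by positivity)]
        gcongr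
      have h3 := mul_le_mul_of_nonneg_left h2 (by positivity : 0 ≤ 4 * π)
      have h4 : 0 ≤ √(4 / 3 * besQ ν τ₀) * r ^ (-(1 / 2) : ℝ) := by positivity
      linarith
    · have h1 := exp_mul_bes_sq_le hν hτ₀ ((Real.le_log_iff_exp_le hr).2 h)
      rw [Real.exp_log hr] at h1
      have h2 : |bes ν (log r)| ≤ √(4 / 3 * besQ ν τ₀) * r ^ (-(1 / 2) : ℝ) := by
        rw [Real.rpow_neg hr.le, ← Real.sqrt_eq_rpow, ← div_eq_mul_inv, ← Real.sqrt_div (by positivity)]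
        apply Real.abs_le_sqrt
        rw [le_div_iff₀ hr]
        linarith
      have h4 : 0 ≤ 4 * π * N ^ (3 / 4 : ℝ) * r ^ (-(3 / 4) : ℝ) := by positivity
      linarith
  have e : besA ν (log r) = bes ν (log r) + 2 * sin (ν * π) * besB ν (log r) := by
    rw [bes]; ring
  rw [e]
  refine (abs_add_le _ _).trans ?_
  have := hD r hr
  linarith

lemma le_bes_energy {ν N : ℝ} (hν : 0 ≤ ν) (hN : 0 < N) (hνN : 2 * ν ≤ N) :
    N ^ 3 / (8 * (1 + N ^ 2)) ≤
      bes' ν (log N) ^ 2 + (N ^ 2 - ν ^ 2) * bes ν (log N) ^ 2 := by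
  have hQ := le_besQ_of_two_mul_le (τ₀ := log N) hν (by rwa [Real.exp_log hN])
  rw [besQ, Real.exp_neg, Real.exp_log hN] at hQ
  set y := bes ν (log N)
  set y' := bes' ν (log N)
  set E := y' ^ 2 + (N ^ 2 - ν ^ 2) * y ^ 2 with hE
  have hν2 : ν ^ 2 ≤ N ^ 2 / 4 := by nlinarith
  have h1 : 3 / 4 * (N ^ 2 * y ^ 2) ≤ E := by
    have := mul_le_mul_of_nonneg_right hν2 (sq_nonneg y)
    nlinarith [sq_nonneg y']
  have hE0 : 0 ≤ E := le_trans (by positivity) h1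
  have h2 : N ≤ 4 / 3 * π * (y' ^ 2 + y * y' + (N ^ 2 - ν ^ 2 + 1 / 2) * y ^ 2) := by
    have := mul_le_mul_of_nonneg_left hQ hN.le
    rw [mul_one] at this
    refine this.trans (le_of_eq ?_)
    field_simp
  have h3 : y' ^ 2 + y * y' + (N ^ 2 - ν ^ 2 + 1 / 2) * y ^ 2 ≤ 3 / 2 * E + y ^ 2 := by
    have := mul_le_mul_of_nonneg_right hν2 (sq_nonneg y)
    have : 0 ≤ (N ^ 2 - ν ^ 2) * y ^ 2 := by nlinarith [mul_nonneg (sq_nonneg N) (sq_nonneg y)]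
    nlinarith [sq_nonneg (y - y')]
  have hpi := Real.pi_lt_d2
  have hpi0 := Real.pi_pos
  have h4 : N ≤ 4.2 * (3 / 2 * E + y ^ 2) := by
    have h5 : 0 ≤ 3 / 2 * E + y ^ 2 := by positivity
    refine h2.trans ((mul_le_mul_of_nonneg_left h3 (by positivity)).trans ?_)
    apply mul_le_mul_of_nonneg_right _ h5
    linarith
  rw [div_le_iff₀ (by positivity)]
  have h5 : N * N ^ 2 ≤ 4.2 * (3 / 2 * E + y ^ 2) * N ^ 2 :=
    mul_le_mul_of_nonneg_right h4 (sq_nonneg N)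
  nlinarith [mul_nonneg hE0 (sq_nonneg N)]

lemma lintegral_bes_sq_ge {ν N : ℝ} (hν : 0 ≤ ν) (hN : 0 < N) (hνN : 2 * ν ≤ N) :
    ENNReal.ofReal (N ^ 3 / (32 * (1 + N ^ 2))) ≤
      ∫⁻ τ in Iio (log N), ENNReal.ofReal (bes ν τ ^ 2 * rexp (2 * τ)) := by
  have hpi := Real.pi_pos
  let E : ℝ → ℝ := fun τ => bes' ν τ ^ 2 + (rexp τ ^ 2 - ν ^ 2) * bes ν τ ^ 2
  have hE : ∀ τ, HasDerivAt E (2 * (bes ν τ ^ 2 * rexp (2 * τ))) τ := by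
    intro τ
    have hy := hasDerivAt_bes hν τ
    have hy' := hasDerivAt_bes' hν τ
    have h := (hy'.pow 2).add ((((Real.hasDerivAt_exp τ).pow 2).sub_const (ν ^ 2)).mul (hy.pow 2))
    refine h.congr_deriv ?_
    rw [exp_two_mul_eq_sq]
    simp only [Nat.cast_ofNat, Nat.add_one_sub_one, pow_one, Pi.pow_apply]
    ring
  have hElim : Tendsto E atBot (nhds 0) := by
    have hsol := bddSol_bes hν (log N)
    have hlim : Tendsto (fun τ : ℝ => (1 * (4 * π) * rexp (2 * τ)) *
        (1 * (4 * π) * rexp (2 * τ) + 2 * ν * (4 * π)) + (4 * π) ^ 2 * rexp (2 * τ)) atBot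
        (nhds 0) := by
      have h1 := tendsto_exp_two_mul_atBot.const_mul (1 * (4 * π))
      simpa using (h1.mul (h1.add_const (2 * ν * (4 * π)))).add
        (tendsto_exp_two_mul_atBot.const_mul ((4 * π) ^ 2))
    refine squeeze_zero_norm' ?_ hlim
    filter_upwards [eventually_lt_atBot (log N)] with τ hτ
    have hw := hsol.abs_deriv_sub_le hτ
    have hb := hsol.bd τ hτ
    have e : E τ = (bes' ν τ - ν * bes ν τ) * ((bes' ν τ - ν * bes ν τ) + 2 * ν * bes ν τ) +
        bes ν τ ^ 2 * rexp (2 * τ) := by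
      simp only [E]; rw [exp_two_mul_eq_sq]; ring
    rw [e, Real.norm_eq_abs]
    refine (abs_add_le _ _).trans (add_le_add ?_ ?_)
    · rw [abs_mul]
      refine mul_le_mul hw ((abs_add_le _ _).trans (add_le_add hw ?_)) (abs_nonneg _) (by positivity)
      rw [abs_mul, abs_of_nonneg (by positivity : 0 ≤ 2 * ν)]
      gcongr
    · rw [abs_mul, abs_of_pos (Real.exp_pos _), abs_pow]
      gcongr
  have hEN : N ^ 3 / (8 * (1 + N ^ 2)) ≤ E (log N) := by
    simp only [E]
    rw [Real.exp_log hN]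
    exact le_bes_energy hν hN hνN
  have hpos : 0 < N ^ 3 / (8 * (1 + N ^ 2)) := by positivity
  obtain ⟨τ₁, hτ₁, hτ₁N⟩ : ∃ τ₁, E τ₁ < N ^ 3 / (8 * (1 + N ^ 2)) / 2 ∧ τ₁ < log N :=
    ((hElim.eventually_lt_const (half_pos hpos)).and (eventually_lt_atBot (log N))).exists
  have hcont : Continuous fun τ => bes ν τ ^ 2 * rexp (2 * τ) := by
    have : Continuous (bes ν) := continuous_iff_continuousAt.2 fun τ =>
      (hasDerivAt_bes hν τ).continuousAt
    fun_prop
  have hFTC := intervalIntegral.integral_eq_sub_of_hasDerivAt (a := τ₁) (b := log N)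
    (fun τ _ => hE τ) ((hcont.const_mul 2).intervalIntegrable _ _)
  rw [intervalIntegral.integral_const_mul, intervalIntegral.integral_of_le hτ₁N.le,
    integral_Ioc_eq_integral_Ioo] at hFTC
  have h8 : N ^ 3 / (32 * (1 + N ^ 2)) = N ^ 3 / (8 * (1 + N ^ 2)) / 4 := by
    rw [div_div]; congr 1; ring
  calc ENNReal.ofReal (N ^ 3 / (32 * (1 + N ^ 2))) ≤
        ENNReal.ofReal (∫ τ in Ioo τ₁ (log N), bes ν τ ^ 2 * rexp (2 * τ)) := by
        apply ENNReal.ofReal_le_ofReal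
        linarith
    _ = ∫⁻ τ in Ioo τ₁ (log N), ENNReal.ofReal (bes ν τ ^ 2 * rexp (2 * τ)) := by
        apply ofReal_integral_eq_lintegral_ofReal
        · exact (hcont.integrableOn_Icc).mono_set Ioo_subset_Icc_self
        · exact ae_of_all _ fun τ => by positivity
    _ ≤ _ := lintegral_mono_set Ioo_subset_Iio_self

end PolyEig

namespace PolyEig
open Real

lemma osc_int_mul_two_pi (m : ℤ) : osc (m * (2 * π)) = 1 := by
  unfold osc
  rw [← Complex.exp_int_mul_two_pi_mul_I m]
  congr 1
  push_cast
  ring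

/-- A trigonometric polynomial with nonnegative frequencies in `w ℕ`. -/
noncomputable def trigSum (w : ℝ) (K : Finset ℕ) (a : ℕ → ℂ) (σ : ℝ) : ℂ :=
  ∑ k ∈ K, a k * osc (k * w * σ)

lemma continuous_trigSum (w : ℝ) (K : Finset ℕ) (a : ℕ → ℂ) : Continuous (trigSum w K a) := by
  have := continuous_osc
  unfold trigSum
  fun_prop

lemma norm_trigSum_le (w : ℝ) (K : Finset ℕ) (a : ℕ → ℂ) (σ : ℝ) :
    ‖trigSum w K a σ‖ ≤ ∑ k ∈ K, ‖a k‖ := by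
  refine (norm_sum_le _ _).trans (Finset.sum_le_sum fun k _ => ?_)
  rw [norm_mul, norm_osc, mul_one]

lemma integral_osc_period {w : ℝ} (hw : 0 < w) (c : ℝ) (N : ℕ) {m : ℤ} (hm : m ≠ 0) :
    ∫ σ in c..c + N * (2 * π / w), osc (m * w * σ) = 0 := by
  have hc : ((m * w : ℝ) : ℂ) * Complex.I ≠ 0 := by
    refine mul_ne_zero ?_ Complex.I_ne_zero
    exact_mod_cast mul_ne_zero (Int.cast_ne_zero.mpr hm) hw.ne'
  have h := integral_exp_mul_complex (a := c) (b := c + N * (2 * π / w)) hc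
  have e : ∀ σ : ℝ, osc (m * w * σ) = Complex.exp (((m * w : ℝ) : ℂ) * Complex.I * σ) := by
    intro σ
    unfold osc
    congr 1
    push_cast
    ring
  simp_rw [e]
  rw [h, ← e, ← e]
  have : m * w * (c + N * (2 * π / w)) = m * w * c + ((m * N : ℤ) : ℝ) * (2 * π) := by
    push_cast
    field_simp
  rw [this, osc_add, osc_int_mul_two_pi]
  simp

lemma integral_normSq_trigSum {w : ℝ} (hw : 0 < w) (K : Finset ℕ) (a : ℕ → ℂ) (c : ℝ) (N : ℕ) :
    ∫ σ in c..c + N * (2 * π / w), ‖trigSum w K a σ‖ ^ 2 = N * (2 * π / w) * ∑ k ∈ K, ‖a k‖ ^ 2 := by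
  apply Complex.ofReal_injective
  rw [← intervalIntegral.integral_ofReal]
  have e : ∀ σ : ℝ, ((‖trigSum w K a σ‖ ^ 2 : ℝ) : ℂ) =
      ∑ k ∈ K, ∑ j ∈ K, a k * (starRingEnd ℂ) (a j) * osc (((k : ℝ) - j) * w * σ) := by
    intro σ
    push_cast
    rw [← Complex.mul_conj']
    unfold trigSum
    rw [map_sum, Finset.sum_mul_sum]
    refine Finset.sum_congr rfl fun k _ => Finset.sum_congr rfl fun j _ => ?_
    rw [map_mul, conj_osc]
    have : ((k : ℝ) - j) * w * σ = k * w * σ + -(j * w * σ) := by ring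
    rw [this, osc_add]
    ring
  simp_rw [e]
  have hc := continuous_osc
  rw [intervalIntegral.integral_finsetSum]
  · push_cast
    rw [Finset.mul_sum]
    refine Finset.sum_congr rfl fun k hk => ?_
    rw [intervalIntegral.integral_finsetSum]
    · rw [Finset.sum_eq_single k]
      · rw [← Complex.mul_conj']
        simp only [sub_self, zero_mul, osc, Complex.ofReal_zero, Complex.exp_zero, mul_one,
          intervalIntegral.integral_const, add_sub_cancel_left, Complex.real_smul]
        push_cast
        ring
      · intro j _ hj
        rw [intervalIntegral.integral_const_mul]
        have hm : (k - j : ℤ) ≠ 0 := by omega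
        have h0 := integral_osc_period hw c N hm
        push_cast at h0
        rw [h0, mul_zero]
      · exact fun h => absurd hk h
    · intro j _
      have : Continuous fun σ : ℝ => a k * (starRingEnd ℂ) (a j) * osc (((k : ℝ) - j) * w * σ) := by
        fun_prop
      exact this.intervalIntegrable _ _
  · intro k _
    have : Continuous fun σ : ℝ => ∑ j ∈ K,
        a k * (starRingEnd ℂ) (a j) * osc (((k : ℝ) - j) * w * σ) := by
      fun_prop
    exact this.intervalIntegrable _ _

lemma integral_normSq_trigSum_window_le {w : ℝ} (hw : 1 / 2 ≤ w) (K : Finset ℕ) (a : ℕ → ℂ)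
    {c d : ℝ} (hcd : c ≤ d) (hd : d ≤ c + 2 * π) :
    ∫ σ in c..d, ‖trigSum w K a σ‖ ^ 2 ≤ 6 * π * ∑ k ∈ K, ‖a k‖ ^ 2 := by
  have hw0 : 0 < w := by linarith
  have hπ := Real.pi_pos
  have hcont : Continuous fun σ => ‖trigSum w K a σ‖ ^ 2 := (continuous_trigSum w K a).norm.pow 2
  set N := ⌈w⌉₊ with hN
  have h1 : 2 * π ≤ N * (2 * π / w) := by
    rw [mul_div_assoc', le_div_iff₀ hw0, mul_comm]
    exact mul_le_mul_of_nonneg_right (Nat.le_ceil w) (by positivity)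
  have h2 : N * (2 * π / w) ≤ 6 * π := by
    rw [mul_div_assoc', div_le_iff₀ hw0]
    have := (Nat.ceil_lt_add_one hw0.le).le
    nlinarith
  calc ∫ σ in c..d, ‖trigSum w K a σ‖ ^ 2
      ≤ ∫ σ in c..c + N * (2 * π / w), ‖trigSum w K a σ‖ ^ 2 := by
        refine intervalIntegral.integral_mono_interval le_rfl hcd (by linarith)
          (Eventually.of_forall fun σ => by positivity) (hcont.intervalIntegrable _ _)
    _ = N * (2 * π / w) * ∑ k ∈ K, ‖a k‖ ^ 2 := integral_normSq_trigSum hw0 K a c N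
    _ ≤ _ := by gcongr

lemma lintegral_normSq_trigSum_window_le {w : ℝ} (hw : 1 / 2 ≤ w) (K : Finset ℕ) (a : ℕ → ℂ)
    {c d : ℝ} (hcd : c ≤ d) (hd : d ≤ c + 2 * π) :
    ∫⁻ σ in Icc c d, ‖trigSum w K a σ‖ₑ ^ 2 ≤ ENNReal.ofReal (6 * π * ∑ k ∈ K, ‖a k‖ ^ 2) := by
  have hcont : Continuous fun σ => ‖trigSum w K a σ‖ ^ 2 := (continuous_trigSum w K a).norm.pow 2
  have e : ∀ σ, ‖trigSum w K a σ‖ₑ ^ 2 = ENNReal.ofReal (‖trigSum w K a σ‖ ^ 2) := by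
    intro σ
    rw [ENNReal.ofReal_pow (norm_nonneg _), ofReal_norm]
  simp_rw [e]
  rw [← ofReal_integral_eq_lintegral_ofReal (hcont.continuousOn.integrableOn_Icc)
    (Eventually.of_forall fun σ => by positivity), integral_Icc_eq_integral_Ioc,
    ← intervalIntegral.integral_of_le hcd]
  exact ENNReal.ofReal_le_ofReal (integral_normSq_trigSum_window_le hw K a hcd hd)

/-- A crude Cauchy–Schwarz bound over a window of length at most `2π`. -/
lemma integral_norm_trigSum_window_le {w : ℝ} (hw : 1 / 2 ≤ w) (K : Finset ℕ) (a : ℕ → ℂ)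
    {c d : ℝ} (hcd : c ≤ d) (hd : d ≤ c + 2 * π) :
    ∫ σ in c..d, ‖trigSum w K a σ‖ ≤ 4 * π * √(∑ k ∈ K, ‖a k‖ ^ 2) := by
  have hπ := Real.pi_pos
  set S := √(∑ k ∈ K, ‖a k‖ ^ 2) with hS
  have hS2 : S ^ 2 = ∑ k ∈ K, ‖a k‖ ^ 2 := Real.sq_sqrt (by positivity)
  have hcont := (continuous_trigSum w K a).norm
  have h2 := integral_normSq_trigSum_window_le hw K a hcd hd
  have hS0 : 0 ≤ S := Real.sqrt_nonneg _
  rcases hS0.eq_or_lt with h0 | h0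
  · have : ∀ σ, ‖trigSum w K a σ‖ = 0 := by
      intro σ
      refine le_antisymm ((norm_trigSum_le w K a σ).trans ?_) (norm_nonneg _)
      rw [← h0] at hS2
      have h3 := (Finset.sum_eq_zero_iff_of_nonneg (fun k _ => by positivity)).mp
        (show ∑ k ∈ K, ‖a k‖ ^ 2 = 0 by rw [← hS2]; ring)
      exact le_of_eq (Finset.sum_eq_zero fun k hk => by simpa using h3 k hk)
    simp [this, ← h0]
  · have h3 : ∫ σ in c..d, ‖trigSum w K a σ‖ ≤
        ∫ σ in c..d, (S / 2 + (1 / (2 * S)) * ‖trigSum w K a σ‖ ^ 2) := by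
      refine intervalIntegral.integral_mono_on hcd (hcont.intervalIntegrable _ _) ?_ fun σ _ => ?_
      · exact (Continuous.intervalIntegrable (by fun_prop) _ _)
      · have : S / 2 + (1 / (2 * S)) * ‖trigSum w K a σ‖ ^ 2 - ‖trigSum w K a σ‖ =
            (S - ‖trigSum w K a σ‖) ^ 2 / (2 * S) := by
          field_simp
          ring
        have h5 : 0 ≤ (S - ‖trigSum w K a σ‖) ^ 2 / (2 * S) := by positivity
        linarith
    rw [intervalIntegral.integral_add (by simp) (Continuous.intervalIntegrable (by fun_prop) _ _),
      intervalIntegral.integral_const_mul, intervalIntegral.integral_const, smul_eq_mul] at h3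
    refine h3.trans ?_
    have h4 : 1 / (2 * S) * ∫ σ in c..d, ‖trigSum w K a σ‖ ^ 2 ≤ 1 / (2 * S) * (6 * π * S ^ 2) := by
      rw [hS2]
      gcongr
    have h5 : 1 / (2 * S) * (6 * π * S ^ 2) = 3 * π * S := by field_simp; ring
    nlinarith

lemma sum_le_card_pow_six {ι : Type*} (s : Finset ι) (x : ι → ℝ≥0∞) :
    (∑ i ∈ s, x i) ^ 6 ≤ (s.card : ℝ≥0∞) ^ 6 * ∑ i ∈ s, x i ^ 6 := by
  rcases s.eq_empty_or_nonempty with rfl | hs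
  · simp
  obtain ⟨m, hm, hmax⟩ := s.exists_max_image x hs
  calc (∑ i ∈ s, x i) ^ 6 ≤ ((s.card : ℝ≥0∞) * x m) ^ 6 := by
        gcongr
        simpa using Finset.sum_le_card_nsmul s x (x m) hmax
    _ = (s.card : ℝ≥0∞) ^ 6 * x m ^ 6 := by rw [mul_pow]
    _ ≤ _ := by
        gcongr
        exact Finset.single_le_sum (f := fun i => x i ^ 6) (fun _ _ => zero_le) hm

end PolyEig

namespace PolyEig
open Real

/-- A finite sum of separated solutions of the Helmholtz equation in logarithmic polar
coordinates. -/
noncomputable def besSum (w : ℝ) (K : Finset ℕ) (a : ℕ → ℂ) (τ θ : ℝ) : ℂ :=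
  ∑ k ∈ K, a k * (bes (k * w) τ : ℂ) * osc (k * w * θ)

lemma sum_inv_sq_le {w A : ℝ} (hw : 1 / 2 ≤ w) (hA : 1 ≤ A) (K : Finset ℕ) :
    ∑ k ∈ K, (1 / (A + k * w)) ^ 2 ≤ 4 / A := by
  have key : ∀ n : ℕ, ∑ k ∈ Finset.range n, (1 / (A + k * w)) ^ 2 ≤
      4 / A - 2 / (A + n / 2 - 1 / 2) := by
    intro n
    induction n with
    | zero =>
      have h1 : 0 < A - 1 / 2 := by linarith
      have : 2 / (A - 1 / 2) ≤ 4 / A := by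
        rw [div_le_div_iff₀ h1 (by linarith)]
        linarith
      simpa using this
    | succ n ih =>
      rw [Finset.sum_range_succ]
      have hn : (0 : ℝ) ≤ n := Nat.cast_nonneg n
      set B := A + n / 2 with hB
      have hB1 : 1 ≤ B := by rw [hB]; linarith
      have h1 : (1 / (A + n * w)) ^ 2 ≤ (1 / B) ^ 2 := by
        have : B ≤ A + n * w := by rw [hB]; nlinarith
        gcongr
      have h2 : (1 / B) ^ 2 ≤ 2 / (B - 1 / 2) - 2 / B := by
        have h3 : 0 < B - 1 / 2 := by linarith
        have : 2 / (B - 1 / 2) - 2 / B = 1 / ((B - 1 / 2) * B) := by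
          rw [div_sub_div _ _ h3.ne' (by positivity)]
          congr 1
          ring
        rw [this, one_div_pow]
        apply one_div_le_one_div_of_le (by positivity)
        nlinarith
      have h4 : A + ((n + 1 : ℕ) : ℝ) / 2 - 1 / 2 = B := by
        rw [hB]
        push_cast
        ring
      rw [h4]
      linarith
  obtain ⟨n, hn⟩ := K.exists_nat_subset_range
  have hn0 : (0 : ℝ) ≤ n := Nat.cast_nonneg n
  refine (Finset.sum_le_sum_of_subset_of_nonneg hn fun _ _ _ => by positivity).trans
    ((key n).trans ?_)
  have : 0 ≤ 2 / (A + n / 2 - 1 / 2) := div_nonneg (by norm_num) (by linarith)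
  linarith

lemma norm_besSum_sub_window_le {w : ℝ} (hw : 1 / 2 ≤ w) (K : Finset ℕ) (a : ℕ → ℂ)
    {τ θ θ₀ : ℝ} (hθ : |θ - θ₀| ≤ π / 12) :
    ‖besSum w K a τ θ - ∫ σ in (θ₀ - 5 * π / 6)..(θ₀ + 5 * π / 6), trigSum w K a σ *
        osc (-(rexp τ * cos θ * sin σ - rexp τ * sin θ * cos σ))‖ ≤
      120 * √(∑ k ∈ K, ‖a k‖ ^ 2) / √(1 + rexp τ) := by
  have hoc := continuous_osc
  have hE := Real.exp_pos τ
  have e1 : ∀ k : ℕ, ∫ σ in (θ₀ - 5 * π / 6)..(θ₀ + 5 * π / 6), a k * (osc (k * w * σ) *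
        osc (-(rexp τ * cos θ * sin σ - rexp τ * sin θ * cos σ))) =
      a k * (osc (k * w * θ) * ∫ s in (-(5 * π / 6) - (θ - θ₀))..(5 * π / 6 - (θ - θ₀)),
        osc (k * w * s - rexp τ * sin s)) := by
    intro k
    rw [intervalIntegral.integral_const_mul]
    rw [← intervalIntegral.integral_const_mul (osc (k * w * θ))]
    congr 1
    have h1 := intervalIntegral.integral_comp_add_right (a := -(5 * π / 6) - (θ - θ₀))
      (b := 5 * π / 6 - (θ - θ₀)) (fun σ => osc (k * w * σ) *
        osc (-(rexp τ * cos θ * sin σ - rexp τ * sin θ * cos σ))) θ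
    have e2 : -(5 * π / 6) - (θ - θ₀) + θ = θ₀ - 5 * π / 6 := by ring
    have e3 : 5 * π / 6 - (θ - θ₀) + θ = θ₀ + 5 * π / 6 := by ring
    rw [e2, e3] at h1
    rw [← h1]
    refine intervalIntegral.integral_congr fun s _ => ?_
    change osc (k * w * (s + θ)) * osc (-(rexp τ * cos θ * sin (s + θ) -
      rexp τ * sin θ * cos (s + θ))) = osc (k * w * θ) * osc (k * w * s - rexp τ * sin s)
    rw [← osc_add, ← osc_add]
    congr 1
    rw [sin_add, cos_add]
    have := sin_sq_add_cos_sq θ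
    linear_combination (-rexp τ * sin s) * this
  have e4 : ∫ σ in (θ₀ - 5 * π / 6)..(θ₀ + 5 * π / 6), trigSum w K a σ *
        osc (-(rexp τ * cos θ * sin σ - rexp τ * sin θ * cos σ)) =
      ∑ k ∈ K, a k * (osc (k * w * θ) *
        ∫ s in (-(5 * π / 6) - (θ - θ₀))..(5 * π / 6 - (θ - θ₀)),
          osc (k * w * s - rexp τ * sin s)) := by
    simp_rw [← e1]
    rw [← intervalIntegral.integral_finsetSum]
    · refine intervalIntegral.integral_congr fun σ _ => ?_
      simp only [trigSum, Finset.sum_mul, mul_assoc]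
    · intro k _
      exact Continuous.intervalIntegrable (by fun_prop) _ _
  rw [e4, besSum, ← Finset.sum_sub_distrib]
  calc _ ≤ ∑ k ∈ K, ‖a k‖ * (60 * (1 / (1 + rexp τ + k * w))) := by
        refine (norm_sum_le _ _).trans (Finset.sum_le_sum fun k _ => ?_)
        have hk : 0 ≤ (k : ℝ) * w := mul_nonneg (Nat.cast_nonneg k) (by linarith)
        have h := norm_bes_sub_window_le (τ := τ) hk hθ
        rw [show ∀ B I o : ℂ, a k * B * o - a k * (o * I) = a k * (o * (B - I)) by intros; ring,
          norm_mul, norm_mul, norm_osc, one_mul]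
        refine mul_le_mul_of_nonneg_left (h.trans (le_of_eq ?_)) (norm_nonneg _)
        rw [mul_one_div]
        congr 1
        ring
    _ ≤ √(∑ k ∈ K, ‖a k‖ ^ 2) * √(∑ k ∈ K, (60 * (1 / (1 + rexp τ + k * w))) ^ 2) :=
        Real.sum_mul_le_sqrt_mul_sqrt _ _ _
    _ ≤ √(∑ k ∈ K, ‖a k‖ ^ 2) * (120 / √(1 + rexp τ)) := by
        gcongr
        rw [Real.sqrt_le_left (by positivity), div_pow, Real.sq_sqrt (by positivity)]
        simp_rw [mul_pow]
        rw [← Finset.mul_sum]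
        have := sum_inv_sq_le hw (A := 1 + rexp τ) (by linarith) K
        calc _ ≤ (60 : ℝ) ^ 2 * (4 / (1 + rexp τ)) := by
              refine mul_le_mul_of_nonneg_left ?_ (by norm_num)
              simpa only [mul_pow] using this
          _ = _ := by ring
    _ = _ := by ring

lemma window_eq_sum_arcExt (f : ℝ → ℂ) (hf : Continuous f) (x : ℝ × ℝ) (θ₀ : ℝ) :
    ∫ σ in (θ₀ - 5 * π / 6)..(θ₀ + 5 * π / 6), f σ * osc (-(x.1 * sin σ - x.2 * cos σ)) =
      ∑ j ∈ Finset.range 5, arcExt (θ₀ + ((j : ℝ) - 2) * (π / 3)) f x := by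
  have hoc := continuous_osc
  have hg : Continuous fun σ => f σ * osc (-(x.1 * sin σ - x.2 * cos σ)) := by fun_prop
  have h := intervalIntegral.sum_integral_adjacent_intervals (μ := volume)
    (a := fun j : ℕ => θ₀ - 5 * π / 6 + j * (π / 3)) (n := 5)
    (f := fun σ => f σ * osc (-(x.1 * sin σ - x.2 * cos σ)))
    (fun k _ => hg.intervalIntegrable _ _)
  have e1 : θ₀ - 5 * π / 6 + ((0 : ℕ) : ℝ) * (π / 3) = θ₀ - 5 * π / 6 := by simp
  have e2 : θ₀ - 5 * π / 6 + ((5 : ℕ) : ℝ) * (π / 3) = θ₀ + 5 * π / 6 := by push_cast; ring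
  rw [e1, e2] at h
  rw [← h]
  refine Finset.sum_congr rfl fun j _ => ?_
  have hπ := Real.pi_pos
  unfold arcExt
  rw [integral_Icc_eq_integral_Ioc, ← intervalIntegral.integral_of_le (by linarith)]
  congr 1 <;> push_cast <;> ring

lemma norm_besSum_le {w : ℝ} (hw : 1 / 2 ≤ w) (K : Finset ℕ) (a : ℕ → ℂ) (τ θ : ℝ) :
    ‖besSum w K a τ θ‖ ≤ (4 * π + 120) * √(∑ k ∈ K, ‖a k‖ ^ 2) := by
  have hπ := Real.pi_pos
  have h := norm_besSum_sub_window_le hw K a (τ := τ) (θ := θ) (θ₀ := θ) (by simp; positivity)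
  have h2 := integral_norm_trigSum_window_le hw K a (c := θ - 5 * π / 6) (d := θ + 5 * π / 6)
    (by linarith) (by linarith)
  set I := ∫ σ in (θ - 5 * π / 6)..(θ + 5 * π / 6), trigSum w K a σ *
        osc (-(rexp τ * cos θ * sin σ - rexp τ * sin θ * cos σ)) with hI
  have h3 : ‖I‖ ≤ ∫ σ in (θ - 5 * π / 6)..(θ + 5 * π / 6), ‖trigSum w K a σ‖ := by
    refine (intervalIntegral.norm_integral_le_integral_norm (by linarith)).trans (le_of_eq ?_)
    refine intervalIntegral.integral_congr fun σ _ => ?_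
    simp only [norm_mul, norm_osc, mul_one]
  have h4 : 120 * √(∑ k ∈ K, ‖a k‖ ^ 2) / √(1 + rexp τ) ≤ 120 * √(∑ k ∈ K, ‖a k‖ ^ 2) := by
    apply div_le_self (by positivity)
    rw [Real.one_le_sqrt]
    linarith [Real.exp_pos τ]
  have h5 : ‖besSum w K a τ θ‖ ≤ ‖besSum w K a τ θ - I‖ + ‖I‖ := norm_le_norm_sub_add _ _
  linarith

end PolyEig

namespace PolyEig
open Real

lemma lintegral_comp_exp (F : ℝ → ℝ≥0∞) :
    ∫⁻ τ, F (rexp τ) * ENNReal.ofReal (rexp (2 * τ)) = ∫⁻ r in Ioi 0, F r * ENNReal.ofReal r := by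
  have h := lintegral_image_eq_lintegral_abs_deriv_mul (s := univ) MeasurableSet.univ
    (fun x _ => (Real.hasDerivAt_exp x).hasDerivWithinAt) Real.exp_injective.injOn
    (fun r => F r * ENNReal.ofReal r)
  rw [image_univ, Real.range_exp, Measure.restrict_univ] at h
  rw [h]
  refine lintegral_congr fun τ => ?_
  rw [abs_of_pos (Real.exp_pos τ), exp_two_mul_eq_sq, sq, ENNReal.ofReal_mul (Real.exp_pos τ).le]
  ring

lemma setLIntegral_Ioc_two_pi (g : ℝ → ℝ≥0∞) (hg : Function.Periodic g (2 * π)) (c d : ℝ) :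
    ∫⁻ θ in Ioc c (c + 2 * π), g θ = ∫⁻ θ in Ioc d (d + 2 * π), g θ := by
  refine (isAddFundamentalDomain_Ioc two_pi_pos c).setLIntegral_eq
    (isAddFundamentalDomain_Ioc two_pi_pos d) g fun z x => ?_
  obtain ⟨z, n, rfl⟩ := z
  change g (n • (2 * π) + x) = g x
  rw [add_comm, zsmul_eq_mul]
  exact hg.int_mul n x

/-- Integration in logarithmic polar coordinates, over any window of `2π` angles. -/
lemma lintegral_logPolar (g : ℝ × ℝ → ℝ≥0∞) (hg : Measurable g) (c : ℝ) :
    ∫⁻ τ, (∫⁻ θ in Ioc c (c + 2 * π), g (rexp τ * cos θ, rexp τ * sin θ)) *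
      ENNReal.ofReal (rexp (2 * τ)) = ∫⁻ x, g x := by
  have h1 := lintegral_comp_exp fun r => ∫⁻ θ in Ioc c (c + 2 * π), g (r * cos θ, r * sin θ)
  rw [h1, ← lintegral_comp_polarCoord_symm, polarCoord_target, Measure.volume_eq_prod,
    ← Measure.prod_restrict, lintegral_prod _ (by
      have : Measurable fun p : ℝ × ℝ => g (p.1 * cos p.2, p.1 * sin p.2) := by fun_prop
      simp only [polarCoord_symm_apply, smul_eq_mul]
      fun_prop)]
  refine lintegral_congr fun r => ?_
  simp only [polarCoord_symm_apply, smul_eq_mul]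
  rw [lintegral_const_mul _ (by fun_prop), mul_comm]
  congr 1
  rw [restrict_Ioo_eq_restrict_Ioc]
  have := setLIntegral_Ioc_two_pi (fun θ => g (r * cos θ, r * sin θ))
    (fun θ => by simp only [cos_add_two_pi, sin_add_two_pi]) c (-π)
  rw [this]
  congr 3
  ring

lemma continuous_arcExt (c : ℝ) {f : ℝ → ℂ} (hf : Continuous f) : Continuous (arcExt c f) := by
  have hoc := continuous_osc
  exact continuous_parametric_integral_of_continuous
    (f := fun (x : ℝ × ℝ) s => f s * osc (-(x.1 * sin s - x.2 * cos s))) (by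
      unfold Function.uncurry
      fun_prop) isCompact_Icc

lemma lintegral_error_le {S : ℝ} (hS : 0 ≤ S) :
    ∫⁻ τ, ENNReal.ofReal (120 * S / √(1 + rexp τ)) ^ 6 * ENNReal.ofReal (rexp (2 * τ)) ≤
      ENNReal.ofReal (120 ^ 6 * π) * ENNReal.ofReal (S ^ 2) ^ 3 := by
  rw [lintegral_comp_exp fun r => ENNReal.ofReal (120 * S / √(1 + r)) ^ 6]
  calc _ ≤ ∫⁻ r in Ioi (0 : ℝ), ENNReal.ofReal (120 ^ 6 * S ^ 6) * ENNReal.ofReal (1 + r ^ 2)⁻¹ := by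
        refine setLIntegral_mono (by fun_prop) fun r hr => ?_
        have hr0 : 0 < r := hr
        rw [← ENNReal.ofReal_pow (by positivity), ← ENNReal.ofReal_mul (by positivity),
          ← ENNReal.ofReal_mul (by positivity)]
        apply ENNReal.ofReal_le_ofReal
        have h6 : √(1 + r) ^ 6 = (1 + r) ^ 3 := by
          rw [show 6 = 2 * 3 by rfl, pow_mul, Real.sq_sqrt (by positivity)]
        rw [div_pow, h6, mul_pow, div_mul_eq_mul_div, mul_div_assoc]
        refine mul_le_mul_of_nonneg_left ?_ (by positivity)
        rw [inv_eq_one_div, div_le_div_iff₀ (by positivity) (by positivity)]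
        nlinarith [sq_nonneg r, mul_pos hr0 hr0, mul_pos hr0 (mul_pos hr0 hr0)]
    _ ≤ ∫⁻ r, ENNReal.ofReal (120 ^ 6 * S ^ 6) * ENNReal.ofReal (1 + r ^ 2)⁻¹ :=
        setLIntegral_le_lintegral _ _
    _ = ENNReal.ofReal (120 ^ 6 * S ^ 6) * ENNReal.ofReal π := by
        rw [lintegral_const_mul _ (by fun_prop), ← ofReal_integral_eq_lintegral_ofReal
          integrable_inv_one_add_sq (Eventually.of_forall fun r => by positivity),
          integral_univ_inv_one_add_sq]
    _ = _ := by
        rw [← ENNReal.ofReal_pow (by positivity), ← ENNReal.ofReal_mul (by positivity),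
          ← ENNReal.ofReal_mul (by positivity)]
        congr 1
        ring

lemma lintegral_besSum_window_le : ∃ C : ℝ≥0∞, C ≠ ⊤ ∧ ∀ w : ℝ, 1 / 2 ≤ w → ∀ (K : Finset ℕ)
    (a : ℕ → ℂ) (θ₀ : ℝ), ∫⁻ τ, (∫⁻ θ in Icc (θ₀ - π / 12) (θ₀ + π / 12),
      ‖besSum w K a τ θ‖ₑ ^ 6) * ENNReal.ofReal (rexp (2 * τ)) ≤
      C * ENNReal.ofReal (∑ k ∈ K, ‖a k‖ ^ 2) ^ 3 := by
  have hπ := Real.pi_pos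
  refine ⟨2 ^ 6 * (5 ^ 6 * (5 * (8 * (ENNReal.ofReal (2 * π) * ENNReal.ofReal (2 * π) *
    ENNReal.ofReal (2 * π)) * ENNReal.ofReal (6 * π) ^ 3)) + ENNReal.ofReal (2 * π) *
    ENNReal.ofReal (120 ^ 6 * π)), by finiteness, ?_⟩
  intro w hw K a θ₀
  set S := √(∑ k ∈ K, ‖a k‖ ^ 2) with hS
  have hS0 : 0 ≤ S := Real.sqrt_nonneg _
  have hS2 : S ^ 2 = ∑ k ∈ K, ‖a k‖ ^ 2 := Real.sq_sqrt (by positivity)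
  set f := trigSum w K a with hf
  have hfc : Continuous f := continuous_trigSum w K a
  set c : ℕ → ℝ := fun j => θ₀ + ((j : ℝ) - 2) * (π / 3) with hc
  have hAc : ∀ j, Continuous (arcExt (c j) f) := fun j => continuous_arcExt _ hfc
  have hpt : ∀ τ, ∀ θ ∈ Icc (θ₀ - π / 12) (θ₀ + π / 12), ‖besSum w K a τ θ‖ₑ ^ 6 ≤
      2 ^ 6 * (5 ^ 6 * (∑ j ∈ Finset.range 5, ‖arcExt (c j) f (rexp τ * cos θ, rexp τ * sin θ)‖ₑ ^ 6) +
        ENNReal.ofReal (120 * S / √(1 + rexp τ)) ^ 6) := by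
    intro τ θ hθ
    have hθ' : |θ - θ₀| ≤ π / 12 := abs_le.mpr ⟨by linarith [hθ.1], by linarith [hθ.2]⟩
    have h1 := norm_besSum_sub_window_le hw K a (τ := τ) hθ'
    have h2 := window_eq_sum_arcExt f hfc (rexp τ * cos θ, rexp τ * sin θ) θ₀
    simp only at h2
    rw [h2] at h1
    have h3 : ‖besSum w K a τ θ‖ₑ ≤
        (∑ j ∈ Finset.range 5, ‖arcExt (c j) f (rexp τ * cos θ, rexp τ * sin θ)‖ₑ) +
        ENNReal.ofReal (120 * S / √(1 + rexp τ)) := by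
      set A := ∑ j ∈ Finset.range 5, arcExt (c j) f (rexp τ * cos θ, rexp τ * sin θ) with hA
      calc ‖besSum w K a τ θ‖ₑ = ‖A + (besSum w K a τ θ - A)‖ₑ := by rw [add_sub_cancel]
        _ ≤ ‖A‖ₑ + ‖besSum w K a τ θ - A‖ₑ := enorm_add_le _ _
        _ ≤ _ := by
          gcongr
          · exact enorm_sum_le _ _
          · rw [← ofReal_norm]
            exact ENNReal.ofReal_le_ofReal h1
    set X := ∑ j ∈ Finset.range 5, ‖arcExt (c j) f (rexp τ * cos θ, rexp τ * sin θ)‖ₑ with hX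
    set Y := ENNReal.ofReal (120 * S / √(1 + rexp τ)) with hY
    have h4 := sum_le_card_pow_six (Finset.univ : Finset (Fin 2)) ![X, Y]
    have h5 := sum_le_card_pow_six (Finset.range 5)
      fun j => ‖arcExt (c j) f (rexp τ * cos θ, rexp τ * sin θ)‖ₑ
    rw [← hX] at h5
    simp only [Fin.sum_univ_two, Matrix.cons_val_zero, Matrix.cons_val_one, Finset.card_univ,
      Fintype.card_fin, Finset.card_range, Nat.cast_ofNat] at h4 h5
    calc ‖besSum w K a τ θ‖ₑ ^ 6 ≤ (X + Y) ^ 6 := by gcongr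
      _ ≤ 2 ^ 6 * (X ^ 6 + Y ^ 6) := h4
      _ ≤ _ := by gcongr
  have hmeas : ∀ j, Measurable fun x : ℝ × ℝ => ‖arcExt (c j) f x‖ₑ ^ 6 :=
    fun j => ((hAc j).measurable.enorm).pow_const 6
  have hE : Measurable fun τ => ENNReal.ofReal (120 * S / √(1 + rexp τ)) ^ 6 := by fun_prop
  have hG : Measurable fun x : ℝ × ℝ => ∑ j ∈ Finset.range 5, ‖arcExt (c j) f x‖ₑ ^ 6 :=
    Finset.measurable_sum _ fun j _ => hmeas j
  have hang : ∀ τ, ∫⁻ θ in Icc (θ₀ - π / 12) (θ₀ + π / 12), ‖besSum w K a τ θ‖ₑ ^ 6 ≤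
      2 ^ 6 * (5 ^ 6 * (∫⁻ θ in Ioc (θ₀ - π) (θ₀ - π + 2 * π),
        ∑ j ∈ Finset.range 5, ‖arcExt (c j) f (rexp τ * cos θ, rexp τ * sin θ)‖ₑ ^ 6) +
        ENNReal.ofReal (2 * π) * ENNReal.ofReal (120 * S / √(1 + rexp τ)) ^ 6) := by
    intro τ
    have hGm : Measurable fun θ => ∑ j ∈ Finset.range 5,
        ‖arcExt (c j) f (rexp τ * cos θ, rexp τ * sin θ)‖ₑ ^ 6 :=
      hG.comp (by fun_prop : Measurable fun θ : ℝ => (rexp τ * cos θ, rexp τ * sin θ))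
    calc _ ≤ ∫⁻ θ in Icc (θ₀ - π / 12) (θ₀ + π / 12), 2 ^ 6 * (5 ^ 6 * (∑ j ∈ Finset.range 5,
          ‖arcExt (c j) f (rexp τ * cos θ, rexp τ * sin θ)‖ₑ ^ 6) +
            ENNReal.ofReal (120 * S / √(1 + rexp τ)) ^ 6) :=
          setLIntegral_mono (by fun_prop) (hpt τ)
      _ ≤ ∫⁻ θ in Ioc (θ₀ - π) (θ₀ - π + 2 * π), 2 ^ 6 * (5 ^ 6 * (∑ j ∈ Finset.range 5,
          ‖arcExt (c j) f (rexp τ * cos θ, rexp τ * sin θ)‖ₑ ^ 6) +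
            ENNReal.ofReal (120 * S / √(1 + rexp τ)) ^ 6) := by
          refine lintegral_mono_set fun θ hθ => ⟨?_, ?_⟩
          · linarith [hθ.1]
          · linarith [hθ.2]
      _ = _ := by
          rw [lintegral_const_mul _ (by fun_prop), lintegral_add_left (by fun_prop),
            lintegral_const_mul _ (by fun_prop), setLIntegral_const, Real.volume_Ioc,
            add_sub_cancel_left, mul_comm (ENNReal.ofReal (2 * π))]
  have hinner : Measurable fun τ => ∫⁻ θ in Ioc (θ₀ - π) (θ₀ - π + 2 * π),
        ∑ j ∈ Finset.range 5, ‖arcExt (c j) f (rexp τ * cos θ, rexp τ * sin θ)‖ₑ ^ 6 := by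
    refine Measurable.lintegral_prod_right' (f := fun p : ℝ × ℝ => ∑ j ∈ Finset.range 5,
      ‖arcExt (c j) f (rexp p.1 * cos p.2, rexp p.1 * sin p.2)‖ₑ ^ 6) ?_
    exact hG.comp (by fun_prop : Measurable fun p : ℝ × ℝ => (rexp p.1 * cos p.2, rexp p.1 * sin p.2))
  have hpol := lintegral_logPolar _ hG (θ₀ - π)
  have harc : ∫⁻ x, ∑ j ∈ Finset.range 5, ‖arcExt (c j) f x‖ₑ ^ 6 ≤
      5 * (8 * (ENNReal.ofReal (2 * π) * ENNReal.ofReal (2 * π) * ENNReal.ofReal (2 * π)) *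
        ENNReal.ofReal (6 * π) ^ 3) * ENNReal.ofReal (S ^ 2) ^ 3 := by
    rw [lintegral_finsetSum _ fun j _ => hmeas j]
    have h1 : ∀ j ∈ Finset.range 5, ∫⁻ x, ‖arcExt (c j) f x‖ₑ ^ 6 ≤
        8 * (ENNReal.ofReal (2 * π) * ENNReal.ofReal (2 * π) * ENNReal.ofReal (2 * π)) *
        (ENNReal.ofReal (6 * π) ^ 3 * ENNReal.ofReal (S ^ 2) ^ 3) := by
      intro j _
      refine (lintegral_arcExt_le hfc.measurable (norm_trigSum_le w K a) (c j)).trans ?_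
      rw [← mul_pow, hS2]
      gcongr
      rw [← ENNReal.ofReal_mul (by positivity)]
      exact lintegral_normSq_trigSum_window_le hw K a (by linarith) (by linarith)
    refine (Finset.sum_le_sum h1).trans (le_of_eq ?_)
    rw [Finset.sum_const, Finset.card_range, nsmul_eq_mul]
    push_cast
    ring
  have herr := lintegral_error_le hS0
  set Q : ℝ → ℝ≥0∞ := fun τ => ∫⁻ θ in Ioc (θ₀ - π) (θ₀ - π + 2 * π),
        ∑ j ∈ Finset.range 5, ‖arcExt (c j) f (rexp τ * cos θ, rexp τ * sin θ)‖ₑ ^ 6 with hQ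
  set E : ℝ → ℝ≥0∞ := fun τ => ENNReal.ofReal (120 * S / √(1 + rexp τ)) ^ 6 with hEdef
  set A := ∫⁻ x, ∑ j ∈ Finset.range 5, ‖arcExt (c j) f x‖ₑ ^ 6 with hA
  have hpol' : ∫⁻ τ, Q τ * ENNReal.ofReal (rexp (2 * τ)) = A := hpol
  have hang' : ∀ τ, ∫⁻ θ in Icc (θ₀ - π / 12) (θ₀ + π / 12), ‖besSum w K a τ θ‖ₑ ^ 6 ≤
      2 ^ 6 * (5 ^ 6 * Q τ + ENNReal.ofReal (2 * π) * E τ) := hang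
  have hstep : ∫⁻ τ, (2 ^ 6 * (5 ^ 6 * Q τ + ENNReal.ofReal (2 * π) * E τ)) *
      ENNReal.ofReal (rexp (2 * τ)) = 2 ^ 6 * (5 ^ 6 * A + ENNReal.ofReal (2 * π) *
        ∫⁻ τ, E τ * ENNReal.ofReal (rexp (2 * τ))) := by
    clear_value Q E A
    calc _ = ∫⁻ τ, (2 ^ 6 * (5 ^ 6 * (Q τ * ENNReal.ofReal (rexp (2 * τ))) +
        ENNReal.ofReal (2 * π) * (E τ * ENNReal.ofReal (rexp (2 * τ))))) :=
          lintegral_congr fun τ => by ring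
      _ = _ := by
        rw [lintegral_const_mul _ (by fun_prop), lintegral_add_left (by fun_prop),
          lintegral_const_mul _ (by fun_prop), lintegral_const_mul _ (by fun_prop), hpol']
  calc _ ≤ ∫⁻ τ, (2 ^ 6 * (5 ^ 6 * Q τ + ENNReal.ofReal (2 * π) * E τ)) *
        ENNReal.ofReal (rexp (2 * τ)) := lintegral_mono fun τ => by gcongr; exact hang' τ
    _ = 2 ^ 6 * (5 ^ 6 * A + ENNReal.ofReal (2 * π) *
        ∫⁻ τ, E τ * ENNReal.ofReal (rexp (2 * τ))) := hstep
    _ ≤ 2 ^ 6 * (5 ^ 6 * (5 * (8 * (ENNReal.ofReal (2 * π) * ENNReal.ofReal (2 * π) *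
        ENNReal.ofReal (2 * π)) * ENNReal.ofReal (6 * π) ^ 3) * ENNReal.ofReal (S ^ 2) ^ 3) +
        ENNReal.ofReal (2 * π) * (ENNReal.ofReal (120 ^ 6 * π) * ENNReal.ofReal (S ^ 2) ^ 3)) := by
        gcongr
    _ = _ := by
        rw [← hS2]
        ring

/-- The sixth power estimate over a bounded window of angles. -/
theorem lintegral_besSum_le : ∃ C : ℝ≥0∞, C ≠ ⊤ ∧ ∀ w : ℝ, 1 / 2 ≤ w → ∀ (K : Finset ℕ)
    (a : ℕ → ℂ), ∫⁻ τ, (∫⁻ θ in Icc (-(4 * π)) (4 * π),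
      ‖besSum w K a τ θ‖ₑ ^ 6) * ENNReal.ofReal (rexp (2 * τ)) ≤
      C * ENNReal.ofReal (∑ k ∈ K, ‖a k‖ ^ 2) ^ 3 := by
  obtain ⟨C, hC, h⟩ := lintegral_besSum_window_le
  refine ⟨49 * C, by finiteness, fun w hw K a => ?_⟩
  have hπ := Real.pi_pos
  set W : Fin 49 → Set ℝ := fun j => Icc (-(4 * π) + (j : ℕ) * (π / 6) - π / 12)
    (-(4 * π) + (j : ℕ) * (π / 6) + π / 12) with hW
  have hcover : Icc (-(4 * π)) (4 * π) ⊆ ⋃ j, W j := by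
    intro θ hθ
    set t := (θ + 4 * π) / (π / 6) + 1 / 2 with ht
    have ht0 : 0 ≤ (θ + 4 * π) / (π / 6) := div_nonneg (by linarith [hθ.1]) (by positivity)
    have ht1 : (θ + 4 * π) / (π / 6) ≤ 48 := by
      rw [div_le_iff₀ (by positivity)]
      linarith [hθ.2]
    have hθt : θ = (t - 1 / 2) * (π / 6) - 4 * π := by
      rw [ht]
      field_simp
      ring
    have h1 := Nat.floor_le (a := t) (by linarith)
    have h2 := Nat.lt_floor_add_one t
    refine mem_iUnion.mpr ⟨⟨⌊t⌋₊, (Nat.floor_lt (by linarith)).mpr (by push_cast; linarith)⟩, ?_⟩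
    change -(4 * π) + (⌊t⌋₊ : ℝ) * (π / 6) - π / 12 ≤ θ ∧ θ ≤ -(4 * π) + (⌊t⌋₊ : ℝ) * (π / 6) + π / 12
    clear_value t
    constructor <;> nlinarith
  have hm : ∀ j, Measurable fun τ => (∫⁻ θ in W j, ‖besSum w K a τ θ‖ₑ ^ 6) *
      ENNReal.ofReal (rexp (2 * τ)) := by
    intro j
    refine Measurable.mul ?_ (by fun_prop)
    refine Measurable.lintegral_prod_right' (f := fun p : ℝ × ℝ => ‖besSum w K a p.1 p.2‖ₑ ^ 6) ?_
    refine (Measurable.enorm ?_).pow_const 6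
    refine Finset.measurable_sum _ fun k _ => ?_
    have hb : Continuous (bes (k * w)) := continuous_iff_continuousAt.mpr fun τ =>
      (hasDerivAt_bes (mul_nonneg (Nat.cast_nonneg k) (by linarith)) τ).continuousAt
    have ho := continuous_osc
    exact Continuous.measurable (by fun_prop)
  calc _ ≤ ∫⁻ τ, ∑ j : Fin 49, (∫⁻ θ in W j, ‖besSum w K a τ θ‖ₑ ^ 6) *
        ENNReal.ofReal (rexp (2 * τ)) := by
        refine lintegral_mono fun τ => ?_
        rw [← Finset.sum_mul]
        gcongr
        exact (lintegral_mono_set hcover).trans ((lintegral_iUnion_le _ _).trans_eq (tsum_fintype _))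
    _ = ∑ j : Fin 49, ∫⁻ τ, (∫⁻ θ in W j, ‖besSum w K a τ θ‖ₑ ^ 6) *
        ENNReal.ofReal (rexp (2 * τ)) := lintegral_finsetSum _ fun j _ => hm j
    _ ≤ ∑ j : Fin 49, C * ENNReal.ofReal (∑ k ∈ K, ‖a k‖ ^ 2) ^ 3 :=
        Finset.sum_le_sum fun j _ => h w hw K a _
    _ = _ := by
        rw [Finset.sum_const, Finset.card_univ, Fintype.card_fin, nsmul_eq_mul]
        push_cast
        ring

end PolyEig

namespace PolyEig
open Real

/-- The weighted square integral of a radial mode over `τ < T`. -/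
noncomputable def modeEnergy (T : ℝ) (x : ℝ → ℝ) : ℝ≥0∞ :=
  ∫⁻ τ in Iio T, ENNReal.ofReal (x τ ^ 2 * rexp (2 * τ))

lemma bddSol_bes_translate {ν lam : ℝ} (hν : 0 ≤ ν) (hlam : 0 < lam) (T : ℝ) :
    BddSol ν (lam ^ 2) (4 * π) T (fun τ => bes ν (τ + log lam))
      (fun τ => bes' ν (τ + log lam)) := by
  have h := bddSol_bes hν (T + log lam)
  refine ⟨hν, by positivity, fun τ hτ => ?_, fun τ hτ => ?_, fun τ hτ => ?_⟩
  · exact (h.d1 (τ + log lam) (by linarith)).comp_add_const τ (log lam)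
  · refine ((h.d2 (τ + log lam) (by linarith)).comp_add_const τ (log lam)).congr_deriv ?_
    rw [mul_add, Real.exp_add, two_mul (log lam), Real.exp_add, Real.exp_log hlam]
    ring
  · exact h.bd (τ + log lam) (by linarith)

lemma modeEnergy_bes_ge {ν lam ε : ℝ} (hν : 0 ≤ ν) (hlam : 1 ≤ lam) (hε : 0 < ε)
    (hνN : 2 * ν ≤ lam * ε) :
    ENNReal.ofReal (ε ^ 3 / (32 * lam * (1 + ε ^ 2))) ≤
      modeEnergy (log ε) fun τ => bes ν (τ + log lam) := by
  have hl : 0 < lam := by linarith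
  have h := lintegral_bes_sq_ge hν (mul_pos hl hε) hνN
  set g : ℝ → ℝ≥0∞ := fun u => (Iio (log (lam * ε))).indicator
    (fun u => ENNReal.ofReal (bes ν u ^ 2 * rexp (2 * u))) u with hg
  have h1 : ∫⁻ u in Iio (log (lam * ε)), ENNReal.ofReal (bes ν u ^ 2 * rexp (2 * u)) =
      ENNReal.ofReal (lam ^ 2) * modeEnergy (log ε) fun τ => bes ν (τ + log lam) := by
    rw [← lintegral_indicator measurableSet_Iio, modeEnergy,
      ← lintegral_const_mul' _ _ ENNReal.ofReal_ne_top, ← lintegral_indicator measurableSet_Iio,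
      ← lintegral_add_right_eq_self _ (log lam)]
    refine lintegral_congr fun τ => ?_
    have hiff : τ + log lam ∈ Iio (log (lam * ε)) ↔ τ ∈ Iio (log ε) := by
      rw [Real.log_mul hl.ne' hε.ne', mem_Iio, mem_Iio, add_comm, add_lt_add_iff_left]
    by_cases hτ : τ ∈ Iio (log ε)
    · rw [indicator_of_mem (hiff.mpr hτ), indicator_of_mem hτ, ← ENNReal.ofReal_mul (by positivity)]
      congr 1
      rw [mul_add, Real.exp_add, two_mul (log lam), Real.exp_add, Real.exp_log hl]
      ring
    · rw [indicator_of_notMem (fun h => hτ (hiff.mp h)), indicator_of_notMem hτ]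
  rw [h1] at h
  have h2 : ENNReal.ofReal (lam ^ 2) * ENNReal.ofReal (ε ^ 3 / (32 * lam * (1 + ε ^ 2))) ≤
      ENNReal.ofReal ((lam * ε) ^ 3 / (32 * (1 + (lam * ε) ^ 2))) := by
    rw [← ENNReal.ofReal_mul (by positivity)]
    apply ENNReal.ofReal_le_ofReal
    rw [mul_div_assoc', div_le_div_iff₀ (by positivity) (by positivity)]
    have : 1 + (lam * ε) ^ 2 ≤ lam ^ 2 * (1 + ε ^ 2) := by nlinarith
    calc lam ^ 2 * ε ^ 3 * (32 * (1 + (lam * ε) ^ 2))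
        ≤ lam ^ 2 * ε ^ 3 * (32 * (lam ^ 2 * (1 + ε ^ 2))) := by gcongr
      _ = _ := by ring
  exact (ENNReal.mul_le_mul_iff_right (by simp; positivity) ENNReal.ofReal_ne_top).mp (h2.trans h)

/-- A low frequency mode is a multiple of a Bessel function, with controlled coefficient. -/
lemma BddSol.exists_low {ν lam ε M : ℝ} {x x' : ℝ → ℝ} (hx : BddSol ν (lam ^ 2) M (log ε) x x')
    (hlam : 1 ≤ lam) (hε : 0 < ε) (hνN : 2 * ν ≤ lam * ε) :
    ∃ A : ℝ, (∀ τ < log ε, x τ = A * bes ν (τ + log lam)) ∧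
      ENNReal.ofReal (A ^ 2) ≤ ENNReal.ofReal (32 * lam * (1 + ε ^ 2) / ε ^ 3) *
        modeEnergy (log ε) x := by
  have hl : 0 < lam := by linarith
  have hge := modeEnergy_bes_ge hx.hν hlam hε hνN
  obtain ⟨τ₁, hτ₁, hne⟩ : ∃ τ₁ < log ε, bes ν (τ₁ + log lam) ≠ 0 := by
    by_contra! hcon
    have : modeEnergy (log ε) (fun τ => bes ν (τ + log lam)) = 0 := by
      rw [modeEnergy, setLIntegral_congr_fun (g := fun _ => 0) measurableSet_Iio]
      · simp
      · intro τ hτ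
        simp [hcon τ hτ]
    rw [this] at hge
    have hpos : 0 < ε ^ 3 / (32 * lam * (1 + ε ^ 2)) := by positivity
    exact absurd hge (by simpa using hpos)
  obtain ⟨A, hA⟩ := hx.exists_eq_mul (bddSol_bes_translate hx.hν hl (log ε)) hτ₁ hne
  refine ⟨A, hA, ?_⟩
  have h1 : modeEnergy (log ε) x =
      ENNReal.ofReal (A ^ 2) * modeEnergy (log ε) fun τ => bes ν (τ + log lam) := by
    rw [modeEnergy, modeEnergy, ← lintegral_const_mul' _ _ ENNReal.ofReal_ne_top]
    refine setLIntegral_congr_fun measurableSet_Iio fun τ hτ => ?_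
    rw [← ENNReal.ofReal_mul (by positivity), hA τ hτ]
    congr 1
    ring
  rw [h1]
  calc ENNReal.ofReal (A ^ 2) = ENNReal.ofReal (32 * lam * (1 + ε ^ 2) / ε ^ 3) *
        (ENNReal.ofReal (A ^ 2) * ENNReal.ofReal (ε ^ 3 / (32 * lam * (1 + ε ^ 2)))) := by
        rw [← ENNReal.ofReal_mul (by positivity), ← ENNReal.ofReal_mul (by positivity)]
        congr 1
        field_simp
    _ ≤ _ := by gcongr

/-- A high frequency mode is exponentially small near the vertex. -/
lemma BddSol.high_le {ν lam ε M : ℝ} {x x' : ℝ → ℝ} (hx : BddSol ν (lam ^ 2) M (log ε) x x')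
    (hlam : 0 < lam) (hε : 0 < ε) (hνN : lam * ε < 2 * ν) {τ : ℝ} (hτ : τ < log (ε / 8)) :
    ENNReal.ofReal (x τ ^ 2) ≤ ENNReal.ofReal (200 / ε ^ 2 * rexp (-(ν / 3))) *
      modeEnergy (log ε) x := by
  have hl4 : (1 : ℝ) / 4 ≤ log (4 / 3) := by
    have := Real.one_sub_inv_le_log_of_pos (show (0 : ℝ) < 4 / 3 by norm_num)
    norm_num at this ⊢
    linarith
  have hl32 : (1 : ℝ) / 3 ≤ log (3 / 2) := by
    have := Real.one_sub_inv_le_log_of_pos (show (0 : ℝ) < 3 / 2 by norm_num)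
    norm_num at this ⊢
    linarith
  set s₁ := log (3 * ε / 16) with hs₁
  set s₂ := log (ε / 4) with hs₂
  have hs12 : s₂ = s₁ + log (4 / 3) := by
    rw [hs₁, hs₂, ← Real.log_mul (by positivity) (by norm_num)]
    congr 1
    ring
  have hτ1 : τ < s₁ - log (3 / 2) := by
    rw [hs₁, ← Real.log_div (by positivity) (by norm_num)]
    convert hτ using 2
    ring
  have hs2 : s₂ < log ε := Real.log_lt_log (by positivity) (by linarith)
  have key : ∀ σ ∈ Icc s₁ s₂, x τ ^ 2 * (9 * ε ^ 2 / 256) ≤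
      rexp (-(ν / 3)) * (x σ ^ 2 * rexp (2 * σ)) := by
    intro σ hσ
    have h1 : lam ^ 2 * rexp (2 * σ) ≤ ν ^ 2 / 4 := by
      have h2 : rexp σ ≤ ε / 4 := by
        rw [← Real.exp_log (show 0 < ε / 4 by positivity)]
        exact Real.exp_le_exp.mpr hσ.2
      rw [exp_two_mul_eq_sq, ← mul_pow]
      have h3 : lam * rexp σ ≤ ν / 2 := by
        calc lam * rexp σ ≤ lam * (ε / 4) := by gcongr
          _ ≤ ν / 2 := by linarith
      calc (lam * rexp σ) ^ 2 ≤ (ν / 2) ^ 2 := by gcongr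
        _ = _ := by ring
    have h4 := hx.sq_le_exp_mul (τ := τ) (σ := σ) (by linarith [hσ.1]) (by linarith [hσ.2]) h1
    have h5 : rexp (ν * (τ - σ)) ≤ rexp (-(ν / 3)) := by
      apply Real.exp_le_exp.mpr
      have : τ - σ ≤ -(1 / 3) := by linarith [hσ.1]
      nlinarith [hx.hν]
    have h6 : 9 * ε ^ 2 / 256 ≤ rexp (2 * σ) := by
      have : 3 * ε / 16 ≤ rexp σ := by
        rw [← Real.exp_log (show 0 < 3 * ε / 16 by positivity)]
        exact Real.exp_le_exp.mpr hσ.1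
      rw [exp_two_mul_eq_sq]
      calc 9 * ε ^ 2 / 256 = (3 * ε / 16) ^ 2 := by ring
        _ ≤ _ := by gcongr
    calc x τ ^ 2 * (9 * ε ^ 2 / 256) ≤ (rexp (-(ν / 3)) * x σ ^ 2) * rexp (2 * σ) := by
          gcongr
          exact h4.trans (by gcongr)
      _ = _ := by ring
  have h7 : ENNReal.ofReal (x τ ^ 2 * (9 * ε ^ 2 / 256)) * ENNReal.ofReal (1 / 4) ≤
      ENNReal.ofReal (rexp (-(ν / 3))) * modeEnergy (log ε) x := by
    calc _ ≤ ENNReal.ofReal (x τ ^ 2 * (9 * ε ^ 2 / 256)) * volume (Icc s₁ s₂) := by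
          gcongr
          rw [Real.volume_Icc]
          exact ENNReal.ofReal_le_ofReal (by linarith)
      _ = ∫⁻ σ in Icc s₁ s₂, ENNReal.ofReal (x τ ^ 2 * (9 * ε ^ 2 / 256)) :=
          (setLIntegral_const _ _).symm
      _ ≤ ∫⁻ σ in Icc s₁ s₂, ENNReal.ofReal (rexp (-(ν / 3))) *
            ENNReal.ofReal (x σ ^ 2 * rexp (2 * σ)) := by
          refine setLIntegral_mono' measurableSet_Icc fun σ hσ => ?_
          rw [← ENNReal.ofReal_mul (by positivity)]
          exact ENNReal.ofReal_le_ofReal (key σ hσ)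
      _ ≤ ∫⁻ σ in Iio (log ε), ENNReal.ofReal (rexp (-(ν / 3))) *
            ENNReal.ofReal (x σ ^ 2 * rexp (2 * σ)) :=
          lintegral_mono_set fun σ hσ => lt_of_le_of_lt hσ.2 hs2
      _ = _ := lintegral_const_mul' _ _ ENNReal.ofReal_ne_top
  calc ENNReal.ofReal (x τ ^ 2) ≤ ENNReal.ofReal (200 / ε ^ 2) *
        (ENNReal.ofReal (x τ ^ 2 * (9 * ε ^ 2 / 256)) * ENNReal.ofReal (1 / 4)) := by
        rw [← ENNReal.ofReal_mul (by positivity), ← ENNReal.ofReal_mul (by positivity)]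
        apply ENNReal.ofReal_le_ofReal
        have : 200 / ε ^ 2 * (x τ ^ 2 * (9 * ε ^ 2 / 256) * (1 / 4)) = x τ ^ 2 * (1800 / 1024) := by
          field_simp
          ring
        nlinarith [sq_nonneg (x τ)]
    _ ≤ ENNReal.ofReal (200 / ε ^ 2) * (ENNReal.ofReal (rexp (-(ν / 3))) * modeEnergy (log ε) x) := by
        gcongr
    _ = _ := by rw [← mul_assoc, ← ENNReal.ofReal_mul (by positivity)]

end PolyEig

namespace PolyEig
open Real

/-- Unnormalised cosine coefficients of a `2π/w`-periodic function. -/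
noncomputable def cosCoeff (w : ℝ) (u : ℝ → ℝ) (n : ℕ) : ℝ :=
  ∫ θ in (0 : ℝ)..2 * π / w, u θ * cos (n * w * θ)

/-- Unnormalised sine coefficients of a `2π/w`-periodic function. -/
noncomputable def sinCoeff (w : ℝ) (u : ℝ → ℝ) (n : ℕ) : ℝ :=
  ∫ θ in (0 : ℝ)..2 * π / w, u θ * sin (n * w * θ)

/-- Complex Fourier coefficients of a `2π/w`-periodic function. -/
noncomputable def expCoeff (w : ℝ) (u : ℝ → ℝ) (k : ℤ) : ℂ :=
  ((w / (2 * π) : ℝ) : ℂ) * ∫ θ in (0 : ℝ)..2 * π / w, (u θ : ℂ) * osc (-(k * w * θ))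

lemma osc_eq (t : ℝ) : osc t = (cos t : ℂ) + (sin t : ℂ) * Complex.I := by
  rw [osc, Complex.exp_mul_I, Complex.ofReal_cos, Complex.ofReal_sin]

lemma expCoeff_natCast {w : ℝ} {u : ℝ → ℝ} (hu : Continuous u) (n : ℕ) :
    expCoeff w u n = ((w / (2 * π) : ℝ) : ℂ) * (cosCoeff w u n - sinCoeff w u n * Complex.I) := by
  rw [expCoeff, cosCoeff, sinCoeff, ← intervalIntegral.integral_ofReal,
    ← intervalIntegral.integral_ofReal, ← intervalIntegral.integral_mul_const,
    ← intervalIntegral.integral_sub]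
  · congr 1
    refine intervalIntegral.integral_congr fun θ _ => ?_
    simp only [osc_eq, Int.cast_natCast, cos_neg, sin_neg]
    push_cast
    ring
  · exact Continuous.intervalIntegrable (by fun_prop) _ _
  · exact Continuous.intervalIntegrable (by fun_prop) _ _

lemma expCoeff_neg_natCast {w : ℝ} {u : ℝ → ℝ} (hu : Continuous u) (n : ℕ) :
    expCoeff w u (-n) =
      ((w / (2 * π) : ℝ) : ℂ) * (cosCoeff w u n + sinCoeff w u n * Complex.I) := by
  rw [expCoeff, cosCoeff, sinCoeff, ← intervalIntegral.integral_ofReal,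
    ← intervalIntegral.integral_ofReal, ← intervalIntegral.integral_mul_const,
    ← intervalIntegral.integral_add]
  · congr 1
    refine intervalIntegral.integral_congr fun θ _ => ?_
    simp only [osc_eq, Int.cast_neg, Int.cast_natCast, neg_mul, neg_neg]
    push_cast
    ring
  · exact Continuous.intervalIntegrable (by fun_prop) _ _
  · exact Continuous.intervalIntegrable (by fun_prop) _ _

lemma norm_sq_cos_sub_sin (w C S : ℝ) :
    ‖((w / (2 * π) : ℝ) : ℂ) * ((C : ℂ) - S * Complex.I)‖ ^ 2 = (w / (2 * π)) ^ 2 * (C ^ 2 + S ^ 2) := by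
  rw [norm_mul, mul_pow, Complex.norm_real, Real.norm_eq_abs, sq_abs, Complex.sq_norm,
    Complex.normSq_apply]
  simp [-mul_eq_mul_left_iff]
  ring

lemma norm_sq_cos_add_sin (w C S : ℝ) :
    ‖((w / (2 * π) : ℝ) : ℂ) * ((C : ℂ) + S * Complex.I)‖ ^ 2 = (w / (2 * π)) ^ 2 * (C ^ 2 + S ^ 2) := by
  have := norm_sq_cos_sub_sin w C (-S)
  push_cast at this
  simpa using this

lemma fourier_eq_osc {w : ℝ} (hw : 0 < w) (k : ℤ) (θ : ℝ) :
    (fourier k (θ : AddCircle (2 * π / w)) : ℂ) = osc (k * w * θ) := by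
  rw [fourier_coe_apply, osc]
  congr 1
  have hw' : (w : ℂ) ≠ 0 := by exact_mod_cast hw.ne'
  have hπ : (π : ℂ) ≠ 0 := by exact_mod_cast Real.pi_ne_zero
  push_cast
  field_simp

/-- The continuous function on the circle induced by a continuous periodic function. -/
noncomputable def circleLift (w : ℝ) (u : ℝ → ℝ) (hu : Continuous u)
    (hp : Function.Periodic u (2 * π / w)) : C(AddCircle (2 * π / w), ℂ) where
  toFun x := (hp.lift x : ℂ)
  continuous_toFun := Complex.continuous_ofReal.comp (continuous_coinduced_dom.mpr hu)

lemma fourierCoeff_circleLift {w : ℝ} (hw : 0 < w) [hT : Fact (0 < 2 * π / w)] {u : ℝ → ℝ}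
    (hu : Continuous u) (hp : Function.Periodic u (2 * π / w)) (k : ℤ) :
    fourierCoeff (circleLift w u hu hp) k = expCoeff w u k := by
  rw [fourierCoeff_eq_intervalIntegral _ k 0, zero_add, expCoeff, one_div_div,
    Complex.real_smul]
  congr 1
  refine intervalIntegral.integral_congr fun θ _ => ?_
  simp only [smul_eq_mul]
  rw [fourier_eq_osc hw, mul_comm]
  congr 2
  push_cast
  ring

lemma hasSum_expCoeff {w : ℝ} (hw : 0 < w) {u : ℝ → ℝ} (hu : Continuous u)
    (hp : Function.Periodic u (2 * π / w)) (hs : Summable (expCoeff w u)) (θ : ℝ) :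
    HasSum (fun k : ℤ => expCoeff w u k * osc (k * w * θ)) (u θ : ℂ) := by
  have hT : Fact (0 < 2 * π / w) := ⟨by positivity⟩
  have e : fourierCoeff (circleLift w u hu hp) = expCoeff w u :=
    funext fun k => fourierCoeff_circleLift hw hu hp k
  have h := has_pointwise_sum_fourier_series_of_summable (f := circleLift w u hu hp)
    (by rw [e]; exact hs) (θ : AddCircle (2 * π / w))
  rw [e] at h
  simp only [smul_eq_mul, fourier_eq_osc hw] at h
  exact h

/-- Bessel's inequality. -/
lemma sum_normSq_expCoeff_le {w : ℝ} (hw : 0 < w) {u : ℝ → ℝ} (hu : Continuous u)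
    (hp : Function.Periodic u (2 * π / w)) (F : Finset ℤ) :
    ∑ k ∈ F, ‖expCoeff w u k‖ ^ 2 ≤ w / (2 * π) * ∫ θ in (0 : ℝ)..2 * π / w, u θ ^ 2 := by
  have hT : Fact (0 < 2 * π / w) := ⟨by positivity⟩
  have h := hasSum_sq_fourierCoeff (ContinuousMap.toLp (E := ℂ) 2 AddCircle.haarAddCircle ℂ
    (circleLift w u hu hp))
  simp only [fourierCoeff_toLp, fourierCoeff_circleLift hw] at h
  refine (h.summable.sum_le_tsum F fun k _ => by positivity).trans (le_of_eq ?_)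
  rw [h.tsum_eq, AddCircle.integral_haarAddCircle, smul_eq_mul, inv_div]
  congr 1
  have h1 := AddCircle.intervalIntegral_preimage (2 * π / w) 0
    (fun t => ‖circleLift w u hu hp t‖ ^ 2)
  have h2 : ∫ t, ‖(ContinuousMap.toLp (E := ℂ) 2 AddCircle.haarAddCircle ℂ
      (circleLift w u hu hp)) t‖ ^ 2 = ∫ t, ‖circleLift w u hu hp t‖ ^ 2 := by
    refine integral_congr_ae ?_
    have := ContinuousMap.coeFn_toLp (p := 2) (𝕜 := ℂ) (μ := AddCircle.haarAddCircle)
      (circleLift w u hu hp)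
    have hac : (volume : Measure (AddCircle (2 * π / w))) ≪ AddCircle.haarAddCircle := by
      rw [AddCircle.volume_eq_smul_haarAddCircle]
      exact Measure.smul_absolutelyContinuous
    filter_upwards [hac.ae_le this] with t ht
    rw [ht]
  rw [h2, ← h1, zero_add]
  refine intervalIntegral.integral_congr fun θ _ => ?_
  change ‖((u θ : ℝ) : ℂ)‖ ^ 2 = u θ ^ 2
  rw [Complex.norm_real, Real.norm_eq_abs, sq_abs]

lemma sum_cosCoeff_sq_le {w : ℝ} (hw : 0 < w) {u : ℝ → ℝ} (hu : Continuous u)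
    (hp : Function.Periodic u (2 * π / w)) (K : Finset ℕ) :
    ∑ n ∈ K, (cosCoeff w u n ^ 2 + sinCoeff w u n ^ 2) ≤
      2 * π / w * ∫ θ in (0 : ℝ)..2 * π / w, u θ ^ 2 := by
  have hπ := Real.pi_pos
  have h := sum_normSq_expCoeff_le hw hu hp (K.map Nat.castEmbedding)
  rw [Finset.sum_map] at h
  simp only [Nat.castEmbedding_apply, expCoeff_natCast hu, norm_sq_cos_sub_sin] at h
  rw [← Finset.mul_sum] at h
  have h3 : 0 < 2 * π / w := by positivity
  calc _ = (2 * π / w) ^ 2 * ((w / (2 * π)) ^ 2 *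
        ∑ n ∈ K, (cosCoeff w u n ^ 2 + sinCoeff w u n ^ 2)) := by field_simp
    _ ≤ (2 * π / w) ^ 2 * (w / (2 * π) * ∫ θ in (0 : ℝ)..2 * π / w, u θ ^ 2) := by gcongr
    _ = _ := by field_simp

end PolyEig

namespace PolyEig
open Real

/-- A function in logarithmic polar coordinates near a vertex, `2π/w`-periodic in the angle, whose
angular modes are bounded solutions of the radial equation, and which has square integral at
most `2`. -/
structure VertexField (w ε lam : ℝ) (U : ℝ → ℝ → ℝ) : Prop where
  cont : ∀ τ < log ε, Continuous (U τ)
  per : ∀ τ < log ε, Function.Periodic (U τ) (2 * π / w)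
  cosMode : ∀ n : ℕ, ∃ M x', BddSol (n * w) (lam ^ 2) M (log ε) (fun τ => cosCoeff w (U τ) n) x'
  sinMode : ∀ n : ℕ, ∃ M x', BddSol (n * w) (lam ^ 2) M (log ε) (fun τ => sinCoeff w (U τ) n) x'
  energy : ∫⁻ τ in Iio (log ε), (∫⁻ θ in Ioc 0 (2 * π / w), ENNReal.ofReal (U τ θ ^ 2)) *
    ENNReal.ofReal (rexp (2 * τ)) ≤ 2

variable {w ε lam : ℝ} {U : ℝ → ℝ → ℝ}

lemma BddSol.aemeasurable_energy {ν κ M T : ℝ} {x x' : ℝ → ℝ} (h : BddSol ν κ M T x x') :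
    AEMeasurable (fun τ => ENNReal.ofReal (x τ ^ 2 * rexp (2 * τ))) (volume.restrict (Iio T)) := by
  have h1 : ContinuousOn x (Iio T) := fun τ hτ => (h.d1 τ hτ).continuousAt.continuousWithinAt
  have h2 : ContinuousOn (fun τ => x τ ^ 2 * rexp (2 * τ)) (Iio T) :=
    (h1.pow 2).mul (by fun_prop)
  exact (h2.aemeasurable measurableSet_Iio).ennreal_ofReal

lemma VertexField.sum_modeEnergy_le (h : VertexField w ε lam U) (hw : 0 < w) (K : Finset ℕ) :
    ∑ n ∈ K, (modeEnergy (log ε) (fun τ => cosCoeff w (U τ) n) +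
      modeEnergy (log ε) (fun τ => sinCoeff w (U τ) n)) ≤ ENNReal.ofReal (4 * π / w) := by
  have hπ := Real.pi_pos
  have hmc : ∀ n : ℕ, AEMeasurable (fun τ => ENNReal.ofReal (cosCoeff w (U τ) n ^ 2 * rexp (2 * τ)))
      (volume.restrict (Iio (log ε))) := by
    intro n
    obtain ⟨M, x', hx⟩ := h.cosMode n
    exact hx.aemeasurable_energy
  have hms : ∀ n : ℕ, AEMeasurable (fun τ => ENNReal.ofReal (sinCoeff w (U τ) n ^ 2 * rexp (2 * τ)))
      (volume.restrict (Iio (log ε))) := by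
    intro n
    obtain ⟨M, x', hx⟩ := h.sinMode n
    exact hx.aemeasurable_energy
  unfold modeEnergy
  simp_rw [← lintegral_add_left' (hmc _)]
  have hm : ∀ n : ℕ, AEMeasurable (fun τ => ENNReal.ofReal (cosCoeff w (U τ) n ^ 2 * rexp (2 * τ)) +
      ENNReal.ofReal (sinCoeff w (U τ) n ^ 2 * rexp (2 * τ))) (volume.restrict (Iio (log ε))) :=
    fun n => (hmc n).add (hms n)
  rw [← lintegral_finsetSum' _ fun n _ => hm n]
  calc _ ≤ ∫⁻ τ in Iio (log ε), ENNReal.ofReal (2 * π / w) *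
        ((∫⁻ θ in Ioc 0 (2 * π / w), ENNReal.ofReal (U τ θ ^ 2)) * ENNReal.ofReal (rexp (2 * τ))) := by
        refine setLIntegral_mono' measurableSet_Iio fun τ hτ => ?_
        have hc := h.cont τ hτ
        have h1 := sum_cosCoeff_sq_le hw hc (h.per τ hτ) K
        have h2 : ∑ n ∈ K, (ENNReal.ofReal (cosCoeff w (U τ) n ^ 2 * rexp (2 * τ)) +
            ENNReal.ofReal (sinCoeff w (U τ) n ^ 2 * rexp (2 * τ))) =
            ENNReal.ofReal (∑ n ∈ K, (cosCoeff w (U τ) n ^ 2 + sinCoeff w (U τ) n ^ 2)) *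
              ENNReal.ofReal (rexp (2 * τ)) := by
          rw [← ENNReal.ofReal_mul (Finset.sum_nonneg fun _ _ => by positivity), Finset.sum_mul,
            ENNReal.ofReal_sum_of_nonneg fun _ _ => by positivity]
          refine Finset.sum_congr rfl fun n _ => ?_
          rw [← ENNReal.ofReal_add (by positivity) (by positivity), add_mul]
        rw [h2, ← mul_assoc]
        gcongr
        have hcont : Continuous fun θ => U τ θ ^ 2 := hc.pow 2
        rw [← ofReal_integral_eq_lintegral_ofReal
          (hcont.continuousOn.integrableOn_Icc.mono_set Ioc_subset_Icc_self)
          (Eventually.of_forall fun θ => sq_nonneg _), ← ENNReal.ofReal_mul (by positivity),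
          ← intervalIntegral.integral_of_le (by positivity)]
        exact ENNReal.ofReal_le_ofReal h1
    _ ≤ ENNReal.ofReal (2 * π / w) * 2 := by
        rw [lintegral_const_mul' _ _ ENNReal.ofReal_ne_top]
        gcongr
        exact h.energy
    _ = _ := by
        rw [show (2 : ℝ≥0∞) = ENNReal.ofReal 2 by simp, ← ENNReal.ofReal_mul (by positivity)]
        congr 1
        ring

lemma VertexField.modeEnergy_le (h : VertexField w ε lam U) (hw : 0 < w) (n : ℕ) :
    modeEnergy (log ε) (fun τ => cosCoeff w (U τ) n) ≤ ENNReal.ofReal (4 * π / w) ∧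
      modeEnergy (log ε) (fun τ => sinCoeff w (U τ) n) ≤ ENNReal.ofReal (4 * π / w) := by
  have := h.sum_modeEnergy_le hw {n}
  rw [Finset.sum_singleton] at this
  exact ⟨le_self_add.trans this, le_add_self.trans this⟩

lemma VertexField.norm_expCoeff_le (h : VertexField w ε lam U) (hw : 0 < w) (hlam : 0 < lam)
    (hε : 0 < ε) {k : ℤ} (hk : lam * ε < 2 * (k.natAbs * w)) {τ : ℝ} (hτ : τ < log (ε / 8)) :
    ‖expCoeff w (U τ) k‖ ≤ w / (2 * π) * √(1600 * π / (w * ε ^ 2)) * rexp (-(w / 6)) ^ k.natAbs := by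
  have hπ := Real.pi_pos
  set n := k.natAbs with hn
  have hτε : τ < log ε := hτ.trans (Real.log_lt_log (by positivity) (by linarith))
  have hc := h.cont τ hτε
  obtain ⟨hE1, hE2⟩ := h.modeEnergy_le hw n
  have hgen : ∀ y : ℝ, ENNReal.ofReal (y ^ 2) ≤ ENNReal.ofReal (200 / ε ^ 2 * rexp (-(n * w / 3))) *
      ENNReal.ofReal (4 * π / w) → y ^ 2 ≤ 800 * π / (w * ε ^ 2) * rexp (-(n * w / 3)) := by
    intro y hy
    rw [← ENNReal.ofReal_mul (by positivity), ENNReal.ofReal_le_ofReal_iff (by positivity)] at hy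
    refine hy.trans (le_of_eq ?_)
    field_simp
    norm_num
  have hC : cosCoeff w (U τ) n ^ 2 ≤ 800 * π / (w * ε ^ 2) * rexp (-(n * w / 3)) := by
    obtain ⟨M, x', hx⟩ := h.cosMode n
    exact hgen _ ((hx.high_le hlam hε hk hτ).trans (by gcongr))
  have hS : sinCoeff w (U τ) n ^ 2 ≤ 800 * π / (w * ε ^ 2) * rexp (-(n * w / 3)) := by
    obtain ⟨M, x', hx⟩ := h.sinMode n
    exact hgen _ ((hx.high_le hlam hε hk hτ).trans (by gcongr))
  have hsq : ‖expCoeff w (U τ) k‖ ^ 2 =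
      (w / (2 * π)) ^ 2 * (cosCoeff w (U τ) n ^ 2 + sinCoeff w (U τ) n ^ 2) := by
    rcases Int.natAbs_eq k with hk' | hk'
    · rw [hk', expCoeff_natCast hc, norm_sq_cos_sub_sin]
    · rw [hk', expCoeff_neg_natCast hc, norm_sq_cos_add_sin]
  refine le_of_sq_le_sq ?_ (by positivity)
  rw [hsq, mul_pow, mul_pow, Real.sq_sqrt (by positivity), mul_assoc]
  refine mul_le_mul_of_nonneg_left ?_ (by positivity)
  have he : (rexp (-(w / 6)) ^ n) ^ 2 = rexp (-(n * w / 3)) := by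
    rw [← pow_mul, ← Real.exp_nat_mul]
    congr 1
    push_cast
    ring
  rw [he]
  calc _ ≤ _ := add_le_add hC hS
    _ = _ := by ring

lemma norm_sub_sum_le_tsum {f : ℤ → ℂ} {g : ℤ → ℝ} {s : ℂ} (hf : HasSum f s) (hg : Summable g)
    (hg0 : ∀ k, 0 ≤ g k) (F : Finset ℤ) (h : ∀ k ∉ F, ‖f k‖ ≤ g k) :
    ‖s - ∑ k ∈ F, f k‖ ≤ ∑' k, g k := by
  have h1 : HasSum (fun k => if k ∈ F then f k else 0) (∑ k ∈ F, f k) := by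
    have h0 : HasSum (fun k => if k ∈ F then f k else 0) (∑ k ∈ F, if k ∈ F then f k else 0) :=
      hasSum_sum_of_ne_finset_zero fun k hk => if_neg hk
    rwa [Finset.sum_congr rfl fun k hk => if_pos hk] at h0
  have h2 := hf.sub h1
  rw [← h2.tsum_eq]
  refine tsum_of_norm_bounded hg.hasSum fun k => ?_
  by_cases hk : k ∈ F
  · simpa [hk] using hg0 k
  · simpa [hk] using h k hk

/-- Near the vertex the field splits into two Bessel sums and a bounded error. -/
lemma VertexField.exists_decomposition (h : VertexField w ε lam U) (hw : 0 < w) (hlam : 1 ≤ lam)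
    (hε : 0 < ε) : ∃ (K K' : Finset ℕ) (a b : ℕ → ℂ),
      ∑ k ∈ K, ‖a k‖ ^ 2 ≤ 32 * (1 + ε ^ 2) * w / (π * ε ^ 3) * lam ∧
      ∑ k ∈ K', ‖b k‖ ^ 2 ≤ 32 * (1 + ε ^ 2) * w / (π * ε ^ 3) * lam ∧
      ∀ τ < log (ε / 8), ∀ θ, |U τ θ| ≤ ‖besSum w K a (τ + log lam) θ‖ +
        ‖besSum w K' b (τ + log lam) (-θ)‖ +
        ∑' k : ℤ, w / (2 * π) * √(1600 * π / (w * ε ^ 2)) * rexp (-(w / 6)) ^ k.natAbs := by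
  have hπ := Real.pi_pos
  have hl : 0 < lam := by linarith
  have hA : ∀ n : ℕ, ∃ A : ℝ, 2 * (n * w) ≤ lam * ε →
      (∀ τ < log ε, cosCoeff w (U τ) n = A * bes (n * w) (τ + log lam)) ∧
      ENNReal.ofReal (A ^ 2) ≤ ENNReal.ofReal (32 * lam * (1 + ε ^ 2) / ε ^ 3) *
        modeEnergy (log ε) fun τ => cosCoeff w (U τ) n := by
    intro n
    obtain ⟨M, x', hx⟩ := h.cosMode n
    by_cases hn : 2 * (n * w) ≤ lam * ε
    · obtain ⟨A, hA⟩ := hx.exists_low hlam hε hn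
      exact ⟨A, fun _ => hA⟩
    · exact ⟨0, fun h => absurd h hn⟩
  have hB : ∀ n : ℕ, ∃ A : ℝ, 2 * (n * w) ≤ lam * ε →
      (∀ τ < log ε, sinCoeff w (U τ) n = A * bes (n * w) (τ + log lam)) ∧
      ENNReal.ofReal (A ^ 2) ≤ ENNReal.ofReal (32 * lam * (1 + ε ^ 2) / ε ^ 3) *
        modeEnergy (log ε) fun τ => sinCoeff w (U τ) n := by
    intro n
    obtain ⟨M, x', hx⟩ := h.sinMode n
    by_cases hn : 2 * (n * w) ≤ lam * ε
    · obtain ⟨A, hA⟩ := hx.exists_low hlam hε hn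
      exact ⟨A, fun _ => hA⟩
    · exact ⟨0, fun h => absurd h hn⟩
  choose A hA using hA
  choose B hB using hB
  set N := ⌊lam * ε / (2 * w)⌋₊ with hN
  have hlow : ∀ n : ℕ, n ≤ N → 2 * (n * w) ≤ lam * ε := by
    intro n hn
    have h1 : (n : ℝ) ≤ lam * ε / (2 * w) := (Nat.cast_le.mpr hn).trans (Nat.floor_le (by positivity))
    rw [le_div_iff₀ (by positivity)] at h1
    linarith
  have hhigh : ∀ n : ℕ, N < n → lam * ε < 2 * (n * w) := by
    intro n hn
    have h1 : lam * ε / (2 * w) < n := (Nat.floor_lt (by positivity)).mp hn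
    rw [div_lt_iff₀ (by positivity)] at h1
    linarith
  set K := Finset.range (N + 1) with hK
  have hKlow : ∀ n ∈ K, 2 * (n * w) ≤ lam * ε := fun n hn =>
    hlow n (Nat.lt_succ_iff.mp (Finset.mem_range.mp hn))
  have hsum : ∑ n ∈ K, (A n ^ 2 + B n ^ 2) ≤ 32 * lam * (1 + ε ^ 2) / ε ^ 3 * (4 * π / w) := by
    rw [← ENNReal.ofReal_le_ofReal_iff (by positivity), ENNReal.ofReal_mul (by positivity),
      ENNReal.ofReal_sum_of_nonneg fun _ _ => by positivity]
    calc _ ≤ ∑ n ∈ K, ENNReal.ofReal (32 * lam * (1 + ε ^ 2) / ε ^ 3) *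
          (modeEnergy (log ε) (fun τ => cosCoeff w (U τ) n) +
            modeEnergy (log ε) (fun τ => sinCoeff w (U τ) n)) := by
          refine Finset.sum_le_sum fun n hn => ?_
          rw [ENNReal.ofReal_add (by positivity) (by positivity), mul_add]
          exact add_le_add (hA n (hKlow n hn)).2 (hB n (hKlow n hn)).2
      _ ≤ _ := by
          rw [← Finset.mul_sum]
          gcongr
          exact h.sum_modeEnergy_le hw K
  have hconst : (w / (2 * π)) ^ 2 * (32 * lam * (1 + ε ^ 2) / ε ^ 3 * (4 * π / w)) =
      32 * (1 + ε ^ 2) * w / (π * ε ^ 3) * lam := by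
    field_simp
    norm_num
  set a : ℕ → ℂ := fun n => ((w / (2 * π) : ℝ) : ℂ) * ((A n : ℂ) - B n * Complex.I) with ha
  set b : ℕ → ℂ := fun n => ((w / (2 * π) : ℝ) : ℂ) * ((A n : ℂ) + B n * Complex.I) with hb
  refine ⟨K, K.erase 0, a, b, ?_, ?_, fun τ hτ θ => ?_⟩
  · simp only [ha, norm_sq_cos_sub_sin]
    rw [← Finset.mul_sum, ← hconst]
    gcongr
  · simp only [hb, norm_sq_cos_add_sin]
    rw [← Finset.mul_sum, ← hconst]
    gcongr
    exact (Finset.sum_le_sum_of_subset_of_nonneg (Finset.erase_subset _ _)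
      fun _ _ _ => by positivity).trans hsum
  · have hτε : τ < log ε := hτ.trans (Real.log_lt_log (by positivity) (by linarith))
    have hc := h.cont τ hτε
    set ι : ℕ ↪ ℤ := ⟨fun n => -(n : ℤ), fun m n hmn => by simpa using hmn⟩ with hι
    set F : Finset ℤ := K.map Nat.castEmbedding ∪ (K.erase 0).map ι with hF
    have hdisj : Disjoint (K.map Nat.castEmbedding) ((K.erase 0).map ι) := by
      rw [Finset.disjoint_left]
      intro z hz hz'
      simp only [Finset.mem_map, Nat.castEmbedding_apply, Finset.mem_erase] at hz hz'
      obtain ⟨m, _, rfl⟩ := hz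
      obtain ⟨n, ⟨hn, _⟩, hmn⟩ := hz'
      change -(n : ℤ) = m at hmn
      omega
    set g : ℤ → ℝ := fun k =>
      w / (2 * π) * √(1600 * π / (w * ε ^ 2)) * rexp (-(w / 6)) ^ k.natAbs with hg
    have hg0 : ∀ k, 0 ≤ g k := fun k => by positivity
    have hgs : Summable g := by
      have hq : rexp (-(w / 6)) < 1 := by
        rw [Real.exp_lt_one_iff]
        linarith
      have hgeo := (summable_geometric_of_lt_one (Real.exp_pos (-(w / 6))).le hq).mul_left
        (w / (2 * π) * √(1600 * π / (w * ε ^ 2)))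
      refine Summable.of_nat_of_neg ?_ ?_ <;> simpa [hg] using hgeo
    have hout : ∀ k ∉ F, ‖expCoeff w (U τ) k‖ ≤ g k := by
      intro k hk
      refine h.norm_expCoeff_le hw hl hε (hhigh _ ?_) hτ
      by_contra! hcon
      apply hk
      have hmem : k.natAbs ∈ K := Finset.mem_range.mpr (by omega)
      rw [hF, Finset.mem_union]
      rcases le_or_gt 0 k with h0 | h0
      · left
        exact Finset.mem_map.mpr ⟨k.natAbs, hmem, by simpa using h0⟩
      · right
        refine Finset.mem_map.mpr ⟨k.natAbs, Finset.mem_erase.mpr ⟨by omega, hmem⟩, ?_⟩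
        change -(k.natAbs : ℤ) = k
        omega
    have hsm : Summable (expCoeff w (U τ)) := by
      refine Summable.of_norm_bounded_eventually hgs ?_
      refine F.finite_toSet.subset fun k hk => ?_
      by_contra hkF
      exact hk (hout k hkF)
    have hsumU := hasSum_expCoeff hw hc (h.per τ hτε) hsm θ
    have htail := norm_sub_sum_le_tsum hsumU hgs hg0 F fun k hk => by
      rw [norm_mul, norm_osc, mul_one]
      exact hout k hk
    have hsplit : ∑ k ∈ F, expCoeff w (U τ) k * osc (k * w * θ) =
        besSum w K a (τ + log lam) θ + besSum w (K.erase 0) b (τ + log lam) (-θ) := by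
      rw [hF, Finset.sum_union hdisj, Finset.sum_map, Finset.sum_map]
      congr 1
      · refine Finset.sum_congr rfl fun n hn => ?_
        simp only [Nat.castEmbedding_apply, Int.cast_natCast]
        rw [expCoeff_natCast hc, (hA n (hKlow n hn)).1 τ hτε, (hB n (hKlow n hn)).1 τ hτε]
        simp only [ha]
        push_cast
        ring
      · refine Finset.sum_congr rfl fun n hn => ?_
        have hn' := hKlow n (Finset.mem_of_mem_erase hn)
        change expCoeff w (U τ) (-(n : ℤ)) * osc (((-(n : ℤ) : ℤ) : ℝ) * w * θ) = _
        rw [expCoeff_neg_natCast hc, (hA n hn').1 τ hτε, (hB n hn').1 τ hτε]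
        have : ((-(n : ℤ) : ℤ) : ℝ) * w * θ = n * w * -θ := by
          push_cast
          ring
        rw [this]
        simp only [hb]
        push_cast
        ring
    rw [hsplit] at htail
    set V1 := besSum w K a (τ + log lam) θ
    set V2 := besSum w (K.erase 0) b (τ + log lam) (-θ)
    calc |U τ θ| = ‖(U τ θ : ℂ)‖ := by rw [Complex.norm_real, Real.norm_eq_abs]
      _ = ‖(V1 + V2) + ((U τ θ : ℂ) - (V1 + V2))‖ := by rw [add_sub_cancel]
      _ ≤ ‖V1‖ + ‖V2‖ + ‖(U τ θ : ℂ) - (V1 + V2)‖ := norm_add₃_le.trans' (by rw [])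
      _ ≤ _ := by gcongr

end PolyEig

namespace PolyEig
open Real

lemma add_three_pow_six_le (x y z : ℝ≥0∞) : (x + y + z) ^ 6 ≤ 729 * (x ^ 6 + y ^ 6 + z ^ 6) := by
  have h := sum_le_card_pow_six Finset.univ ![x, y, z]
  simp only [Fin.sum_univ_three, Finset.card_univ, Fintype.card_fin] at h
  refine h.trans (le_of_eq ?_)
  norm_num
  rfl

lemma measurable_besSum (w : ℝ) (K : Finset ℕ) (a : ℕ → ℂ) (hw : 0 ≤ w) :
    Measurable fun p : ℝ × ℝ => besSum w K a p.1 p.2 := by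
  unfold besSum
  refine Finset.measurable_sum _ fun k _ => ?_
  have h1 : Continuous (bes (k * w)) :=
    continuous_iff_continuousAt.mpr fun τ => (hasDerivAt_bes (by positivity) τ).continuousAt
  have h2 := continuous_osc
  exact Continuous.measurable (by fun_prop)

/-- The sixth-power integral of a translated Bessel sum. -/
lemma exists_lintegral_besSum_translate_le : ∃ C : ℝ≥0∞, C ≠ ⊤ ∧ ∀ w : ℝ, 1 / 2 ≤ w →
    ∀ (K : Finset ℕ) (a : ℕ → ℂ) (lam S : ℝ), 0 < lam → 0 ≤ S → ∑ k ∈ K, ‖a k‖ ^ 2 ≤ S * lam →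
    ∫⁻ τ, (∫⁻ θ in Icc (-(4 * π)) (4 * π), ‖besSum w K a (τ + log lam) θ‖ₑ ^ 6) *
      ENNReal.ofReal (rexp (2 * τ)) ≤ C * ENNReal.ofReal (S ^ 3 * lam) := by
  obtain ⟨C, hC, h⟩ := lintegral_besSum_le
  refine ⟨C, hC, fun w hw K a lam S hlam hS hs => ?_⟩
  set G : ℝ → ℝ≥0∞ := fun τ => (∫⁻ θ in Icc (-(4 * π)) (4 * π), ‖besSum w K a τ θ‖ₑ ^ 6) with hG
  have h1 : ∀ τ, G (τ + log lam) * ENNReal.ofReal (rexp (2 * τ)) =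
      ENNReal.ofReal (lam⁻¹ ^ 2) *
        (G (τ + log lam) * ENNReal.ofReal (rexp (2 * (τ + log lam)))) := by
    intro τ
    rw [mul_left_comm, ← ENNReal.ofReal_mul (by positivity)]
    congr 2
    rw [mul_add, Real.exp_add, exp_two_mul_eq_sq (log lam), Real.exp_log hlam]
    field_simp
  change ∫⁻ τ, G (τ + log lam) * ENNReal.ofReal (rexp (2 * τ)) ≤ _
  simp_rw [h1]
  rw [lintegral_const_mul' _ _ ENNReal.ofReal_ne_top,
    lintegral_add_right_eq_self (fun τ => G τ * ENNReal.ofReal (rexp (2 * τ)))]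
  calc _ ≤ ENNReal.ofReal (lam⁻¹ ^ 2) * (C * ENNReal.ofReal (S * lam) ^ 3) := by
        gcongr
        exact (h w hw K a).trans (by gcongr)
    _ = _ := by
        rw [mul_left_comm, ← ENNReal.ofReal_pow (by positivity), ← ENNReal.ofReal_mul (by positivity)]
        congr 2
        field_simp

lemma setLIntegral_comp_neg_Icc (f : ℝ → ℝ≥0∞) (c : ℝ) :
    ∫⁻ θ in Icc (-c) c, f (-θ) = ∫⁻ θ in Icc (-c) c, f θ := by
  rw [← lintegral_indicator measurableSet_Icc, ← lintegral_indicator measurableSet_Icc,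
    ← lintegral_neg_eq_self (μ := volume) ((Icc (-c) c).indicator f)]
  congr 1
  ext θ
  simp only [indicator, mem_Icc]
  refine if_congr ?_ rfl rfl
  constructor <;> rintro ⟨h1, h2⟩ <;> constructor <;> linarith

/-- The local estimate at a vertex: sup bound and sixth-power bound. -/
theorem VertexField.exists_bound {w ε : ℝ} (hw : 1 / 2 ≤ w) (hε : 0 < ε) :
    ∃ C : ℝ, 0 ≤ C ∧ ∀ (lam : ℝ) (U : ℝ → ℝ → ℝ), 1 ≤ lam → VertexField w ε lam U →
      (∀ τ < log (ε / 8), ∀ θ, |U τ θ| ≤ C * √lam) ∧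
      ∫⁻ τ in Iio (log (ε / 8)), (∫⁻ θ in Ioc 0 (2 * π / w), ‖U τ θ‖ₑ ^ 6) *
        ENNReal.ofReal (rexp (2 * τ)) ≤ ENNReal.ofReal (C * lam) := by
  have hπ := Real.pi_pos
  have hw0 : 0 < w := by linarith
  obtain ⟨C₀, hC₀, h₀⟩ := exists_lintegral_besSum_translate_le
  set S := 32 * (1 + ε ^ 2) * w / (π * ε ^ 3) with hS
  set H := ∑' k : ℤ, w / (2 * π) * √(1600 * π / (w * ε ^ 2)) * rexp (-(w / 6)) ^ k.natAbs with hH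
  have hS0 : 0 ≤ S := by positivity
  have hH0 : 0 ≤ H := tsum_nonneg fun k => by positivity
  clear_value S H
  set I : ℝ≥0∞ := ∫⁻ τ in Iio (log (ε / 8)), ENNReal.ofReal (rexp (2 * τ)) with hI
  have hIt : I ≠ ⊤ := by
    have : IntegrableOn (fun τ => rexp (2 * τ)) (Iio (log (ε / 8))) := by
      have := integrableOn_exp_mul_Iic (a := 2) (by norm_num) (log (ε / 8))
      exact this.mono_set Iio_subset_Iic_self
    exact this.lintegral_lt_top.ne
  set R : ℝ≥0∞ := 729 * (C₀ * ENNReal.ofReal (S ^ 3) + C₀ * ENNReal.ofReal (S ^ 3) +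
    ENNReal.ofReal H ^ 6 * ENNReal.ofReal (2 * π / w) * I) with hR
  have hRt : R ≠ ⊤ := by
    have h1 : ENNReal.ofReal H ^ 6 * ENNReal.ofReal (2 * π / w) * I ≠ ⊤ :=
      ENNReal.mul_ne_top (ENNReal.mul_ne_top (by simp) (by simp)) hIt
    have h2 : C₀ * ENNReal.ofReal (S ^ 3) ≠ ⊤ := ENNReal.mul_ne_top hC₀ (by simp)
    exact ENNReal.mul_ne_top (by simp) (ENNReal.add_ne_top.mpr ⟨ENNReal.add_ne_top.mpr ⟨h2, h2⟩, h1⟩)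
  refine ⟨max (2 * ((4 * π + 120) * √S) + H) R.toReal, by positivity, fun lam U hlam h => ?_⟩
  have hl : 0 < lam := by linarith
  obtain ⟨K, K', a, b, ha, hb, hdec⟩ := h.exists_decomposition hw0 hlam hε
  rw [← hS] at ha hb
  rw [← hH] at hdec
  have hsl : 1 ≤ √lam := Real.one_le_sqrt.mpr hlam
  constructor
  · intro τ hτ θ
    have h1 := norm_besSum_le hw K a (τ + log lam) θ
    have h2 := norm_besSum_le hw K' b (τ + log lam) (-θ)
    have h3 : √(∑ k ∈ K, ‖a k‖ ^ 2) ≤ √S * √lam := by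
      rw [← Real.sqrt_mul hS0]
      exact Real.sqrt_le_sqrt ha
    have h4 : √(∑ k ∈ K', ‖b k‖ ^ 2) ≤ √S * √lam := by
      rw [← Real.sqrt_mul hS0]
      exact Real.sqrt_le_sqrt hb
    calc |U τ θ| ≤ _ := hdec τ hτ θ
      _ ≤ (4 * π + 120) * (√S * √lam) + (4 * π + 120) * (√S * √lam) + H * √lam := by
          refine add_le_add (add_le_add (h1.trans (by gcongr)) (h2.trans (by gcongr))) ?_
          exact le_mul_of_one_le_right hH0 hsl
      _ = (2 * ((4 * π + 120) * √S) + H) * √lam := by ring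
      _ ≤ _ := by
          gcongr
          exact le_max_left _ _
  · set W := Icc (-(4 * π)) (4 * π) with hW
    have hsub : Ioc 0 (2 * π / w) ⊆ W := by
      intro θ hθ
      have : 2 * π / w ≤ 4 * π := by
        rw [div_le_iff₀ hw0]
        nlinarith
      exact ⟨by linarith [hθ.1], hθ.2.trans this⟩
    have hX : Measurable fun p : ℝ × ℝ => ‖besSum w K a (p.1 + log lam) p.2‖ₑ ^ 6 :=
      ((measurable_besSum w K a hw0.le).comp (f := fun p : ℝ × ℝ => (p.1 + log lam, p.2))
        (by fun_prop)).enorm.pow_const 6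
    have hY : Measurable fun p : ℝ × ℝ => ‖besSum w K' b (p.1 + log lam) (-p.2)‖ₑ ^ 6 :=
      ((measurable_besSum w K' b hw0.le).comp (f := fun p : ℝ × ℝ => (p.1 + log lam, -p.2))
        (by fun_prop)).enorm.pow_const 6
    set X : ℝ → ℝ≥0∞ := fun τ => ∫⁻ θ in W, ‖besSum w K a (τ + log lam) θ‖ₑ ^ 6 with hXd
    set Y : ℝ → ℝ≥0∞ := fun τ => ∫⁻ θ in W, ‖besSum w K' b (τ + log lam) (-θ)‖ₑ ^ 6 with hYd
    have hXτ : ∀ τ, Measurable fun θ => ‖besSum w K a (τ + log lam) θ‖ₑ ^ 6 :=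
      fun τ => ((measurable_besSum w K a hw0.le).comp (f := fun θ : ℝ => (τ + log lam, θ))
        (by fun_prop)).enorm.pow_const 6
    have hXm : Measurable X := hX.lintegral_prod_right'
    have hYm : Measurable Y := hY.lintegral_prod_right'
    have hYe : Y = fun τ => ∫⁻ θ in W, ‖besSum w K' b (τ + log lam) θ‖ₑ ^ 6 := by
      ext τ
      exact setLIntegral_comp_neg_Icc (fun θ => ‖besSum w K' b (τ + log lam) θ‖ₑ ^ 6) (4 * π)
    have hpt : ∀ τ < log (ε / 8), ∫⁻ θ in Ioc 0 (2 * π / w), ‖U τ θ‖ₑ ^ 6 ≤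
        729 * (X τ + Y τ + ENNReal.ofReal H ^ 6 * ENNReal.ofReal (2 * π / w)) := by
      intro τ hτ
      calc _ ≤ ∫⁻ θ in Ioc 0 (2 * π / w), 729 * (‖besSum w K a (τ + log lam) θ‖ₑ ^ 6 +
            ‖besSum w K' b (τ + log lam) (-θ)‖ₑ ^ 6 + ENNReal.ofReal H ^ 6) := by
            refine lintegral_mono fun θ => ?_
            refine le_trans ?_ (add_three_pow_six_le _ _ _)
            gcongr
            rw [← ofReal_norm, ← ofReal_norm, ← ofReal_norm, ← ENNReal.ofReal_add (by positivity)
              (by positivity), ← ENNReal.ofReal_add (by positivity) hH0]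
            exact ENNReal.ofReal_le_ofReal (hdec τ hτ θ)
        _ = 729 * ((∫⁻ θ in Ioc 0 (2 * π / w), ‖besSum w K a (τ + log lam) θ‖ₑ ^ 6) +
            (∫⁻ θ in Ioc 0 (2 * π / w), ‖besSum w K' b (τ + log lam) (-θ)‖ₑ ^ 6) +
            ENNReal.ofReal H ^ 6 * ENNReal.ofReal (2 * π / w)) := by
            rw [lintegral_const_mul' _ _ (by simp), lintegral_add_right _ measurable_const,
              lintegral_add_left (hXτ τ), setLIntegral_const,
              Real.volume_Ioc, sub_zero]
        _ ≤ _ := by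
            gcongr
            · exact lintegral_mono_set hsub
            · exact lintegral_mono_set hsub
    have hl3 : ∀ x : ℝ≥0∞, x ≤ x * ENNReal.ofReal lam := fun x => by
      have : (1 : ℝ≥0∞) ≤ ENNReal.ofReal lam := by simpa using hlam
      simpa using mul_le_mul_right this x
    calc _ ≤ ∫⁻ τ in Iio (log (ε / 8)), 729 * (X τ * ENNReal.ofReal (rexp (2 * τ)) +
          Y τ * ENNReal.ofReal (rexp (2 * τ)) +
          ENNReal.ofReal H ^ 6 * ENNReal.ofReal (2 * π / w) * ENNReal.ofReal (rexp (2 * τ))) := by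
          refine setLIntegral_mono' measurableSet_Iio fun τ hτ => ?_
          rw [← add_mul, ← add_mul, ← mul_assoc]
          gcongr
          exact hpt τ hτ
      _ = 729 * ((∫⁻ τ in Iio (log (ε / 8)), X τ * ENNReal.ofReal (rexp (2 * τ))) +
          (∫⁻ τ in Iio (log (ε / 8)), Y τ * ENNReal.ofReal (rexp (2 * τ))) +
          ENNReal.ofReal H ^ 6 * ENNReal.ofReal (2 * π / w) * I) := by
          rw [lintegral_const_mul' _ _ (by simp), lintegral_add_left, lintegral_add_left,
            lintegral_const_mul' _ _ (ENNReal.mul_ne_top (by simp) (by simp))]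
          · exact hXm.mul (by fun_prop)
          · exact (hXm.mul (by fun_prop)).add (hYm.mul (by fun_prop))
      _ ≤ 729 * (C₀ * ENNReal.ofReal (S ^ 3 * lam) + C₀ * ENNReal.ofReal (S ^ 3 * lam) +
          ENNReal.ofReal H ^ 6 * ENNReal.ofReal (2 * π / w) * I * ENNReal.ofReal lam) := by
          gcongr 729 * (?_ + ?_ + ?_)
          · exact (setLIntegral_le_lintegral _ _).trans (h₀ w hw K a lam S hl hS0 ha)
          · rw [hYe]
            exact (setLIntegral_le_lintegral _ _).trans (h₀ w hw K' b lam S hl hS0 hb)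
          · exact hl3 _
      _ = R * ENNReal.ofReal lam := by
          rw [ENNReal.ofReal_mul (by positivity), hR]
          ring
      _ = ENNReal.ofReal (R.toReal * lam) := by
          rw [ENNReal.ofReal_mul (by positivity), ENNReal.ofReal_toReal hRt]
      _ ≤ _ := by
          gcongr
          exact le_max_right _ _

end PolyEig

namespace PolyEig
open Real

/-- A bounded continuous function in logarithmic polar coordinates that solves the Helmholtz
equation for radii below `exp T` and angles in `D`. -/
structure PolarSol (lam T M : ℝ) (D : Set ℝ) (v v₁ v₁₁ v₂ v₂₂ : ℝ → ℝ → ℝ) : Prop where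
  cont : Continuous (Function.uncurry v)
  bdd : ∀ τ θ, |v τ θ| ≤ M
  cont₁ : ContinuousOn (Function.uncurry v₁) (Iio T ×ˢ D)
  cont₁₁ : ContinuousOn (Function.uncurry v₁₁) (Iio T ×ˢ D)
  cont₂₂ : ContinuousOn (Function.uncurry v₂₂) (Iio T ×ˢ D)
  deriv₁ : ∀ τ < T, ∀ θ ∈ D, HasDerivAt (fun s => v s θ) (v₁ τ θ) τ
  deriv₁₁ : ∀ τ < T, ∀ θ ∈ D, HasDerivAt (fun s => v₁ s θ) (v₁₁ τ θ) τ
  deriv₂ : ∀ τ < T, ∀ θ ∈ D, HasDerivAt (v τ) (v₂ τ θ) θ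
  deriv₂₂ : ∀ τ < T, ∀ θ ∈ D, HasDerivAt (v₂ τ) (v₂₂ τ θ) θ
  pde : ∀ τ < T, ∀ θ ∈ D, v₁₁ τ θ + v₂₂ τ θ + lam ^ 2 * rexp (2 * τ) * v τ θ = 0

variable {lam T M : ℝ} {D : Set ℝ} {v v₁ v₁₁ v₂ v₂₂ : ℝ → ℝ → ℝ}

lemma PolarSol.hasDerivAt_mode (h : PolarSol lam T M D v v₁ v₁₁ v₂ v₂₂) {a b : ℝ} (hab : a ≤ b)
    (hD : Icc a b ⊆ D) {ψ ψ' : ℝ → ℝ} {ν : ℝ} (hψ : ∀ θ, HasDerivAt ψ (ψ' θ) θ)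
    (hψ' : ∀ θ, HasDerivAt ψ' (-ν ^ 2 * ψ θ) θ) {τ : ℝ} (hτ : τ < T) :
    HasDerivAt (fun s => ∫ θ in a..b, v s θ * ψ θ) (∫ θ in a..b, v₁ τ θ * ψ θ) τ ∧
    HasDerivAt (fun s => ∫ θ in a..b, v₁ s θ * ψ θ)
      ((ν ^ 2 - lam ^ 2 * rexp (2 * τ)) * (∫ θ in a..b, v τ θ * ψ θ) -
        ((v₂ τ b * ψ b - v τ b * ψ' b) - (v₂ τ a * ψ a - v τ a * ψ' a))) τ := by
  have hψc : Continuous ψ := continuous_iff_continuousAt.mpr fun θ => (hψ θ).continuousAt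
  have hψc' : Continuous ψ' := continuous_iff_continuousAt.mpr fun θ => (hψ' θ).continuousAt
  have hsub : Iio T ×ˢ Icc a b ⊆ Iio T ×ˢ D := prod_mono subset_rfl hD
  have hslice : ∀ {f : ℝ → ℝ → ℝ}, ContinuousOn (Function.uncurry f) (Iio T ×ˢ D) →
      ∀ s ∈ Iio T, ContinuousOn (f s) (Icc a b) := fun hf s hs =>
    hf.comp (f := fun θ => (s, θ)) (by fun_prop) fun θ hθ => ⟨hs, hD hθ⟩
  have hmul : ∀ {f : ℝ → ℝ → ℝ}, ContinuousOn (Function.uncurry f) (Iio T ×ˢ D) →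
      ContinuousOn (Function.uncurry fun s θ => f s θ * ψ θ) (Iio T ×ˢ Icc a b) := fun hf =>
    (hf.mono hsub).mul (hψc.comp continuous_snd).continuousOn
  have hvτ : Continuous (v τ) := h.cont.comp (f := fun θ => (τ, θ)) (by fun_prop)
  refine ⟨?_, ?_⟩
  · exact hasDerivAt_intervalIntegral_param (F := fun s θ => v s θ * ψ θ)
      (F' := fun s θ => v₁ s θ * ψ θ) isOpen_Iio hab
      (fun s _ => ((h.cont.comp (f := fun θ => (s, θ)) (by fun_prop)).mul hψc).continuousOn)
      (hmul h.cont₁) (fun s hs θ hθ => (h.deriv₁ s hs θ (hD hθ)).mul_const _) hτ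
  · have h1 := hasDerivAt_intervalIntegral_param (F := fun s θ => v₁ s θ * ψ θ)
      (F' := fun s θ => v₁₁ s θ * ψ θ) isOpen_Iio hab
      (fun s hs => (hslice h.cont₁ s hs).mul hψc.continuousOn)
      (hmul h.cont₁₁) (fun s hs θ hθ => (h.deriv₁₁ s hs θ (hD hθ)).mul_const _) hτ
    refine h1.congr_deriv ?_
    have hi1 : IntervalIntegrable (fun θ => v₂₂ τ θ * ψ θ + ν ^ 2 * (v τ θ * ψ θ)) volume a b :=
      (((hslice h.cont₂₂ τ hτ).mul hψc.continuousOn).add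
        (continuous_const.mul (hvτ.mul hψc)).continuousOn).intervalIntegrable_of_Icc hab
    have hi2 : IntervalIntegrable (fun θ => (ν ^ 2 - lam ^ 2 * rexp (2 * τ)) * (v τ θ * ψ θ))
        volume a b := (continuous_const.mul (hvτ.mul hψc)).intervalIntegrable _ _
    have h2 : ∫ θ in a..b, (v₂₂ τ θ * ψ θ + ν ^ 2 * (v τ θ * ψ θ)) =
        (v₂ τ b * ψ b - v τ b * ψ' b) - (v₂ τ a * ψ a - v τ a * ψ' a) := by
      refine intervalIntegral.integral_eq_sub_of_hasDerivAt
        (f := fun θ => v₂ τ θ * ψ θ - v τ θ * ψ' θ) (fun θ hθ => ?_) hi1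
      rw [uIcc_of_le hab] at hθ
      have hd := ((h.deriv₂₂ τ hτ θ (hD hθ)).mul (hψ θ)).sub
        ((h.deriv₂ τ hτ θ (hD hθ)).mul (hψ' θ))
      exact hd.congr_deriv (by ring)
    rw [← h2, ← intervalIntegral.integral_const_mul, ← intervalIntegral.integral_sub hi2 hi1]
    refine intervalIntegral.integral_congr fun θ hθ => ?_
    rw [uIcc_of_le hab] at hθ
    have := h.pde τ hτ θ (hD hθ)
    change v₁₁ τ θ * ψ θ = (ν ^ 2 - lam ^ 2 * rexp (2 * τ)) * (v τ θ * ψ θ) -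
      (v₂₂ τ θ * ψ θ + ν ^ 2 * (v τ θ * ψ θ))
    linear_combination ψ θ * this

lemma PolarSol.abs_mode_le (h : PolarSol lam T M D v v₁ v₁₁ v₂ v₂₂) {a b : ℝ} (hab : a ≤ b)
    {ψ : ℝ → ℝ} (hψ : ∀ θ, |ψ θ| ≤ 1) (τ : ℝ) :
    |∫ θ in a..b, v τ θ * ψ θ| ≤ M * (b - a) := by
  have h1 := intervalIntegral.norm_integral_le_of_norm_le_const (a := a) (b := b) (C := M)
    (f := fun θ => v τ θ * ψ θ) fun θ _ => by
      rw [norm_mul]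
      exact (mul_le_mul (h.bdd τ θ) (hψ θ) (abs_nonneg _)
        ((abs_nonneg _).trans (h.bdd τ θ))).trans_eq (mul_one M)
  rwa [abs_of_nonneg (by linarith : 0 ≤ b - a)] at h1

/-- Angular modes of a solution in a punctured disc. -/
lemma PolarSol.bddSol_circle (h : PolarSol lam T M univ v v₁ v₁₁ v₂ v₂₂)
    (hper : ∀ τ, Function.Periodic (v τ) (2 * π)) (n : ℕ) :
    (∃ M' x', BddSol (n * 1) (lam ^ 2) M' T (fun τ => cosCoeff 1 (v τ) n) x') ∧
      ∃ M' x', BddSol (n * 1) (lam ^ 2) M' T (fun τ => sinCoeff 1 (v τ) n) x' := by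
  have hπ := Real.pi_pos
  have hper2 : ∀ τ < T, v₂ τ (2 * π) = v₂ τ 0 := by
    intro τ hτ
    have h1 := h.deriv₂ τ hτ (2 * π) (mem_univ _)
    have h2 := (h.deriv₂ τ hτ 0 (mem_univ _))
    have h3 : HasDerivAt (v τ) (v₂ τ (2 * π)) 0 := by
      have := HasDerivAt.comp_add_const 0 (2 * π) (by rw [zero_add]; exact h1)
      exact this.congr_of_eventuallyEq (Eventually.of_forall fun θ => (hper τ θ).symm)
    exact h3.unique h2
  have hper0 : ∀ τ, v τ (2 * π) = v τ 0 := fun τ => by simpa using hper τ 0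
  have key : ∀ ψ ψ' : ℝ → ℝ, (∀ θ, HasDerivAt ψ (ψ' θ) θ) →
      (∀ θ, HasDerivAt ψ' (-(n : ℝ) ^ 2 * ψ θ) θ) → (∀ θ, |ψ θ| ≤ 1) → ψ (2 * π) = ψ 0 →
      ψ' (2 * π) = ψ' 0 → BddSol (n * 1) (lam ^ 2) (M * (2 * π - 0)) T
        (fun τ => ∫ θ in 0..2 * π, v τ θ * ψ θ) (fun τ => ∫ θ in 0..2 * π, v₁ τ θ * ψ θ) := by
    intro ψ ψ' h1 h2 h3 h4 h5
    refine ⟨by positivity, by positivity, fun τ hτ => ?_, fun τ hτ => ?_, fun τ _ => ?_⟩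
    · exact (h.hasDerivAt_mode (by positivity) (subset_univ _) h1 h2 hτ).1
    · refine (h.hasDerivAt_mode (by positivity) (subset_univ _) h1 h2 hτ).2.congr_deriv ?_
      rw [hper2 τ hτ, hper0, h4, h5]
      ring
    · exact h.abs_mode_le (by positivity) h3 τ
  constructor
  · refine ⟨M * (2 * π - 0), fun τ => ∫ θ in 0..2 * π, v₁ τ θ * cos (n * θ), ?_⟩
    · have := key (fun θ => cos (n * θ)) (fun θ => -(n * sin (n * θ))) ?_ ?_
        (fun θ => abs_cos_le_one _) ?_ ?_
      · simpa only [cosCoeff, mul_one, div_one] using this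
      · intro θ
        exact (((hasDerivAt_id θ).const_mul (n : ℝ)).cos).congr_deriv (by simp; ring)
      · intro θ
        exact ((((hasDerivAt_id θ).const_mul (n : ℝ)).sin.const_mul (n : ℝ)).neg).congr_deriv
          (by simp; ring)
      · simp [Real.cos_nat_mul_two_pi]
      · simp only [mul_zero, sin_zero]
        rw [show (n : ℝ) * (2 * π) = ((2 * n : ℕ) : ℝ) * π by push_cast; ring, Real.sin_nat_mul_pi]
        simp
  · refine ⟨M * (2 * π - 0), fun τ => ∫ θ in 0..2 * π, v₁ τ θ * sin (n * θ), ?_⟩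
    · have := key (fun θ => sin (n * θ)) (fun θ => n * cos (n * θ)) ?_ ?_
        (fun θ => abs_sin_le_one _) ?_ ?_
      · simpa only [sinCoeff, mul_one, div_one] using this
      · intro θ
        exact (((hasDerivAt_id θ).const_mul (n : ℝ)).sin).congr_deriv (by simp; ring)
      · intro θ
        exact (((hasDerivAt_id θ).const_mul (n : ℝ)).cos.const_mul (n : ℝ)).congr_deriv
          (by simp; ring)
      · simp only [mul_zero, sin_zero]
        rw [show (n : ℝ) * (2 * π) = ((2 * n : ℕ) : ℝ) * π by push_cast; ring, Real.sin_nat_mul_pi]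
      · simp [Real.cos_nat_mul_two_pi]

/-- The limit of solutions of second-order equations with converging right-hand sides. -/
lemma exists_hasDerivAt_of_tendsto {T C : ℝ} {B B' g : ℕ → ℝ → ℝ} {b γ : ℝ → ℝ}
    (h1 : ∀ k, ∀ τ < T, HasDerivAt (B k) (B' k τ) τ)
    (h2 : ∀ k, ∀ τ < T, HasDerivAt (B' k) (g k τ) τ)
    (hg : ∀ k, ContinuousOn (g k) (Iio T)) (hgb : ∀ k, ∀ τ < T, |g k τ| ≤ C)
    (hγ : ContinuousOn γ (Iio T))
    (hB : ∀ τ < T, Tendsto (fun k => B k τ) atTop (nhds (b τ)))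
    (hgl : ∀ τ < T, Tendsto (fun k => g k τ) atTop (nhds (γ τ))) :
    ∃ b', ∀ τ < T, HasDerivAt b (b' τ) τ ∧ HasDerivAt b' (γ τ) τ := by
  set t₀ := T - 2 with ht₀
  set t₁ := T - 1 with ht₁
  have ht0 : t₀ < T := by linarith
  have ht1 : t₁ < T := by linarith
  have huI : ∀ τ < T, uIcc t₀ τ ⊆ Iio T := by
    intro τ hτ s hs
    exact lt_of_le_of_lt hs.2 (max_lt ht0 hτ)
  have hprim : ∀ f : ℝ → ℝ, ContinuousOn f (Iio T) → ∀ τ < T,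
      HasDerivAt (fun s => ∫ σ in t₀..s, f σ) (f τ) τ := by
    intro f hf τ hτ
    refine intervalIntegral.integral_hasDerivAt_right
      ((hf.mono (huI τ hτ)).intervalIntegrable) ?_ (hf.continuousAt (Iio_mem_nhds hτ))
    exact hf.stronglyMeasurableAtFilter isOpen_Iio τ hτ
  set Q : (ℝ → ℝ) → ℝ → ℝ := fun f τ => τ * (∫ σ in t₀..τ, f σ) - ∫ σ in t₀..τ, σ * f σ with hQ
  have hQd : ∀ f : ℝ → ℝ, ContinuousOn f (Iio T) → ∀ τ < T,
      HasDerivAt (Q f) (∫ σ in t₀..τ, f σ) τ := by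
    intro f hf τ hτ
    have ha := (hasDerivAt_id τ).mul (hprim f hf τ hτ)
    have hb := hprim (fun σ => σ * f σ) (continuousOn_id.mul hf) τ hτ
    exact (ha.sub hb).congr_deriv (by simp)
  have haff : ∀ k, ∀ τ < T, B k τ - Q (g k) τ = (B k t₀ - Q (g k) t₀) +
      ((B k t₁ - Q (g k) t₁) - (B k t₀ - Q (g k) t₀)) * (τ - t₀) := by
    intro k
    have hd' : ∀ τ < T, HasDerivAt (fun s => B' k s - ∫ σ in t₀..s, g k σ) 0 τ := by
      intro τ hτ
      exact ((h2 k τ hτ).sub (hprim _ (hg k) τ hτ)).congr_deriv (by ring)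
    have hconst : ∀ {f : ℝ → ℝ}, (∀ τ < T, HasDerivAt f 0 τ) → ∀ τ < T, f τ = f t₀ := by
      intro f hf τ hτ
      refine isOpen_Iio.is_const_of_deriv_eq_zero isPreconnected_Iio
        (fun s hs => (hf s hs).differentiableAt.differentiableWithinAt)
        (fun s hs => (hf s hs).deriv) hτ ht0
    have hc := hconst hd'
    set c := B' k t₀ - ∫ σ in t₀..t₀, g k σ with hcdef
    have hd : ∀ τ < T, HasDerivAt (fun s => B k s - Q (g k) s - c * (s - t₀)) 0 τ := by
      intro τ hτ
      have := ((h1 k τ hτ).sub (hQd _ (hg k) τ hτ)).sub (((hasDerivAt_id τ).sub_const t₀).const_mul c)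
      exact this.congr_deriv (by have := hc τ hτ; linarith)
    have he := hconst hd
    intro τ hτ
    have e1 := he τ hτ
    have e2 := he t₁ ht1
    simp only [sub_self, mul_zero, sub_zero] at e1 e2
    have e3 : t₁ - t₀ = 1 := by rw [ht₀, ht₁]; ring
    rw [e3] at e2
    rw [show (B k t₁ - Q (g k) t₁) - (B k t₀ - Q (g k) t₀) = c by linarith]
    linarith
  have hQl : ∀ τ < T, Tendsto (fun k => Q (g k) τ) atTop (nhds (Q γ τ)) := by
    intro τ hτ
    have hC : 0 ≤ C := (abs_nonneg _).trans (hgb 0 t₀ ht0)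
    refine Tendsto.sub (Tendsto.const_mul _ ?_) ?_
    · refine intervalIntegral.tendsto_integral_filter_of_dominated_convergence (fun _ => C)
        (Eventually.of_forall fun k => ?_) (Eventually.of_forall fun k => ?_)
        intervalIntegrable_const ?_
      · exact ((hg k).mono (uIoc_subset_uIcc.trans (huI τ hτ))).aestronglyMeasurable
          measurableSet_uIoc
      · exact ae_of_all _ fun s hs => hgb k s (huI τ hτ (uIoc_subset_uIcc hs))
      · exact ae_of_all _ fun s hs => hgl s (huI τ hτ (uIoc_subset_uIcc hs))
    · refine intervalIntegral.tendsto_integral_filter_of_dominated_convergence (fun s => |s| * C)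
        (Eventually.of_forall fun k => ?_) (Eventually.of_forall fun k => ?_)
        (Continuous.intervalIntegrable (by fun_prop) _ _) ?_
      · exact ((continuousOn_id.mul (hg k)).mono
          (uIoc_subset_uIcc.trans (huI τ hτ))).aestronglyMeasurable measurableSet_uIoc
      · refine ae_of_all _ fun s hs => ?_
        rw [norm_mul]
        exact mul_le_mul_of_nonneg_left (hgb k s (huI τ hτ (uIoc_subset_uIcc hs))) (abs_nonneg s)
      · exact ae_of_all _ fun s hs => (hgl s (huI τ hτ (uIoc_subset_uIcc hs))).const_mul _
  have hP : ∀ τ < T, Tendsto (fun k => B k τ - Q (g k) τ) atTop (nhds (b τ - Q γ τ)) :=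
    fun τ hτ => (hB τ hτ).sub (hQl τ hτ)
  set d := (b t₁ - Q γ t₁) - (b t₀ - Q γ t₀) with hd
  have hlim : ∀ τ < T, b τ = Q γ τ + (b t₀ - Q γ t₀) + d * (τ - t₀) := by
    intro τ hτ
    have e1 := hP τ hτ
    simp_rw [fun k => haff k τ hτ] at e1
    have e2 := (hP t₀ ht0).add (((hP t₁ ht1).sub (hP t₀ ht0)).mul_const (τ - t₀))
    have := tendsto_nhds_unique e1 e2
    linarith
  refine ⟨fun τ => (∫ σ in t₀..τ, γ σ) + d, fun τ hτ => ⟨?_, (hprim γ hγ τ hτ).add_const d⟩⟩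
  have hder : HasDerivAt (fun s => Q γ s + (b t₀ - Q γ t₀) + d * (s - t₀))
      ((∫ σ in t₀..τ, γ σ) + d) τ :=
    (((hQd γ hγ τ hτ).add_const _).add (((hasDerivAt_id τ).sub_const t₀).const_mul d)).congr_deriv
      (by simp)
  refine hder.congr_of_eventuallyEq ?_
  filter_upwards [Iio_mem_nhds hτ] with s hs
  exact hlim s hs

end PolyEig

namespace PolyEig
open Real

variable {lam T M : ℝ} {D : Set ℝ} {v v₁ v₁₁ v₂ v₂₂ : ℝ → ℝ → ℝ}

/-- The `n`-th Dirichlet mode of `u` on `[a, b]`, rescaled to the unit interval. -/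
noncomputable def sectorMode (v : ℝ → ℝ → ℝ) (n : ℕ) (a b τ : ℝ) : ℝ :=
  (b - a) * ∫ s in (0 : ℝ)..1, v τ (a + (b - a) * s) * sin (n * π * s)

lemma sectorMode_eq {a b : ℝ} (hab : a < b) (v : ℝ → ℝ → ℝ) (n : ℕ) (τ : ℝ) :
    sectorMode v n a b τ = ∫ θ in a..b, v τ θ * sin (n * (π / (b - a)) * (θ - a)) := by
  have h := intervalIntegral.mul_integral_comp_add_mul (a := 0) (b := 1)
    (f := fun θ => v τ θ * sin (n * (π / (b - a)) * (θ - a))) (b - a) a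
  rw [mul_zero, add_zero, mul_one, add_sub_cancel] at h
  rw [← h, sectorMode]
  congr 1
  refine intervalIntegral.integral_congr fun s _ => ?_
  have : b - a ≠ 0 := by linarith
  congr 2
  field_simp
  ring

lemma continuous_sectorMode (hv : Continuous (Function.uncurry v)) (n : ℕ) :
    Continuous fun p : ℝ × ℝ × ℝ => sectorMode v n p.1 p.2.1 p.2.2 := by
  unfold sectorMode
  refine Continuous.mul (by fun_prop) ?_
  refine intervalIntegral.continuous_parametric_intervalIntegral_of_continuous'
    (f := fun (p : ℝ × ℝ × ℝ) s => v p.2.2 (p.1 + (p.2.1 - p.1) * s) * sin (n * π * s)) ?_ 0 1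
  refine Continuous.mul ?_ (by fun_prop)
  exact hv.comp (f := fun q : (ℝ × ℝ × ℝ) × ℝ => (q.1.2.2, q.1.1 + (q.1.2.1 - q.1.1) * q.2))
    (by fun_prop)

/-- The second derivative in `τ` of `sectorMode`. -/
noncomputable def sectorForce (lam : ℝ) (v : ℝ → ℝ → ℝ) (n : ℕ) (a b τ : ℝ) : ℝ :=
  ((n * (π / (b - a))) ^ 2 - lam ^ 2 * rexp (2 * τ)) * sectorMode v n a b τ +
    n * (π / (b - a)) * (v τ b * cos (n * π) - v τ a)

lemma PolarSol.hasDerivAt_sectorMode (h : PolarSol lam T M D v v₁ v₁₁ v₂ v₂₂) {a b : ℝ}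
    (hab : a < b) (hD : Icc a b ⊆ D) (n : ℕ) {τ : ℝ} (hτ : τ < T) :
    HasDerivAt (sectorMode v n a b) (sectorMode v₁ n a b τ) τ ∧
      HasDerivAt (sectorMode v₁ n a b) (sectorForce lam v n a b τ) τ := by
  have hba : b - a ≠ 0 := by linarith
  set ν := n * (π / (b - a)) with hν
  have h1 : ∀ θ, HasDerivAt (fun θ => sin (ν * (θ - a))) (ν * cos (ν * (θ - a))) θ := fun θ =>
    ((((hasDerivAt_id θ).sub_const a).const_mul ν).sin).congr_deriv (by simp; ring)
  have h2 : ∀ θ, HasDerivAt (fun θ => ν * cos (ν * (θ - a))) (-ν ^ 2 * sin (ν * (θ - a))) θ :=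
    fun θ => ((((hasDerivAt_id θ).sub_const a).const_mul ν).cos.const_mul ν).congr_deriv
      (by simp; ring)
  have hνb : ν * (b - a) = n * π := by
    rw [hν]
    field_simp
  have hm := h.hasDerivAt_mode hab.le hD h1 h2 hτ
  have e : ∀ u : ℝ → ℝ → ℝ, sectorMode u n a b =
      fun s => ∫ θ in a..b, u s θ * sin (ν * (θ - a)) := fun u => funext fun s => by
    rw [sectorMode_eq hab]
  refine ⟨?_, ?_⟩
  · rw [e v, e v₁]
    exact hm.1
  · rw [e v₁]
    refine hm.2.congr_deriv ?_
    rw [sectorForce, e v, hνb, sin_nat_mul_pi, sub_self, mul_zero ν, sin_zero, cos_zero, ← hν]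
    ring

lemma abs_sectorMode_le {M : ℝ} (hv : ∀ τ θ, |v τ θ| ≤ M) (n : ℕ) {a b : ℝ} (hab : a ≤ b)
    (τ : ℝ) : |sectorMode v n a b τ| ≤ (b - a) * M := by
  have h1 := intervalIntegral.norm_integral_le_of_norm_le_const (a := 0) (b := 1) (C := M)
    (f := fun s => v τ (a + (b - a) * s) * sin (n * π * s)) fun s _ => by
      rw [norm_mul]
      exact (mul_le_mul (hv τ _) (abs_sin_le_one _) (abs_nonneg _)
        ((abs_nonneg _).trans (hv τ 0))).trans_eq (mul_one M)
  rw [sub_zero, abs_one, mul_one] at h1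
  rw [sectorMode, abs_mul, abs_of_nonneg (by linarith : 0 ≤ b - a)]
  exact mul_le_mul_of_nonneg_left h1 (by linarith)

/-- Angular modes of a solution in a sector with Dirichlet conditions. -/
lemma PolarSol.bddSol_sector {x y : ℝ} (hxy : x < y)
    (h : PolarSol lam T M (Ioo x y) v v₁ v₁₁ v₂ v₂₂)
    (hx : ∀ τ < T, v τ x = 0) (hy : ∀ τ < T, v τ y = 0) (n : ℕ) :
    ∃ x', BddSol (n * (π / (y - x))) (lam ^ 2) ((y - x) * M) T (sectorMode v n x y) x' := by
  have hπ := Real.pi_pos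
  have hM : 0 ≤ M := (abs_nonneg _).trans (h.bdd 0 0)
  set α := y - x with hα
  have hα0 : 0 < α := by linarith
  set δ : ℕ → ℝ := fun k => α / (k + 4) with hδ
  have hδ0 : ∀ k, 0 < δ k := fun k => by positivity
  have hδ4 : ∀ k, δ k ≤ α / 4 := fun k => by
    simp only [hδ]
    gcongr
    linarith [(Nat.cast_nonneg k : (0 : ℝ) ≤ k)]
  have hδl : Tendsto δ atTop (nhds 0) := by
    refine Tendsto.div_atTop tendsto_const_nhds ?_
    exact tendsto_atTop_add_const_right _ _ tendsto_natCast_atTop_atTop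
  set a : ℕ → ℝ := fun k => x + δ k with ha
  set b : ℕ → ℝ := fun k => y - δ k with hb
  have hal : Tendsto a atTop (nhds x) := by simpa using hδl.const_add x
  have hbl : Tendsto b atTop (nhds y) := by simpa using hδl.const_sub y
  have hab : ∀ k, α / 2 ≤ b k - a k := fun k => by
    have := hδ4 k
    simp only [ha, hb]
    linarith
  have hab' : ∀ k, b k - a k ≤ α := fun k => by
    have := hδ0 k
    simp only [ha, hb]
    linarith
  have hab0 : ∀ k, a k < b k := fun k => by linarith [hab k]
  have hD : ∀ k, Icc (a k) (b k) ⊆ Ioo x y := fun k θ hθ =>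
    ⟨by have := hδ0 k; have := hθ.1; simp only [ha] at this; linarith,
      by have := hδ0 k; have := hθ.2; simp only [hb] at this; linarith⟩
  have hcS := continuous_sectorMode h.cont n
  have hcv : ∀ θ, Continuous fun τ => v τ θ := fun θ =>
    h.cont.comp (f := fun τ => (τ, θ)) (by fun_prop)
  have hcS' : ∀ a b, Continuous fun τ => sectorMode v n a b τ := fun a b =>
    hcS.comp (f := fun τ => (a, b, τ)) (by fun_prop)
  have hBl : ∀ τ, Tendsto (fun k => sectorMode v n (a k) (b k) τ) atTop
      (nhds (sectorMode v n x y τ)) := fun τ =>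
    (hcS.tendsto (x, y, τ)).comp (hal.prodMk_nhds (hbl.prodMk_nhds tendsto_const_nhds))
  have hvl : ∀ τ (c : ℕ → ℝ) (z : ℝ), Tendsto c atTop (nhds z) →
      Tendsto (fun k => v τ (c k)) atTop (nhds (v τ z)) := fun τ c z hc =>
    (h.cont.tendsto (τ, z)).comp (tendsto_const_nhds.prodMk_nhds hc)
  have hνl : Tendsto (fun k => n * (π / (b k - a k))) atTop (nhds (n * (π / α))) :=
    (tendsto_const_nhds.div (hbl.sub hal) hα0.ne').const_mul _
  have hνb : ∀ k, n * (π / (b k - a k)) ≤ n * (π / (α / 2)) := fun k => by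
    have := hab k
    gcongr
  have hν0 : ∀ k, 0 ≤ n * (π / (b k - a k)) := fun k => by
    have := hab k
    have : 0 ≤ b k - a k := by linarith
    positivity
  set N := n * (π / (α / 2)) with hN
  obtain ⟨b', hb'⟩ := exists_hasDerivAt_of_tendsto (T := T)
    (C := (N ^ 2 + lam ^ 2 * rexp (2 * T)) * (α * M) + N * (M * 1 + M))
    (B := fun k => sectorMode v n (a k) (b k)) (B' := fun k => sectorMode v₁ n (a k) (b k))
    (g := fun k => sectorForce lam v n (a k) (b k)) (b := sectorMode v n x y)
    (γ := fun τ => ((n * (π / α)) ^ 2 - lam ^ 2 * rexp (2 * τ)) * sectorMode v n x y τ)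
    (fun k τ hτ => (h.hasDerivAt_sectorMode (hab0 k) (hD k) n hτ).1)
    (fun k τ hτ => (h.hasDerivAt_sectorMode (hab0 k) (hD k) n hτ).2)
    (fun k => by
      have h1 := hcS' (a k) (b k)
      have h2 := hcv (a k)
      have h3 := hcv (b k)
      unfold sectorForce
      exact Continuous.continuousOn (by fun_prop))
    (fun k τ hτ => by
      have e1 := abs_sectorMode_le h.bdd n (hab0 k).le τ
      have e2 : |sectorMode v n (a k) (b k) τ| ≤ α * M :=
        e1.trans (mul_le_mul_of_nonneg_right (hab' k) hM)
      have e3 : |(n * (π / (b k - a k))) ^ 2 - lam ^ 2 * rexp (2 * τ)| ≤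
          N ^ 2 + lam ^ 2 * rexp (2 * T) := by
        refine (abs_sub _ _).trans ?_
        rw [abs_of_nonneg (by positivity), abs_of_nonneg (by positivity)]
        have := hν0 k
        have := hνb k
        gcongr
      have e4 : |v τ (b k) * cos (n * π) - v τ (a k)| ≤ M * 1 + M := by
        refine (abs_sub _ _).trans (add_le_add ?_ (h.bdd _ _))
        rw [abs_mul]
        exact mul_le_mul (h.bdd _ _) (abs_cos_le_one _) (abs_nonneg _) hM
      have e5 : |n * (π / (b k - a k))| ≤ N := by
        rw [abs_of_nonneg (hν0 k)]
        exact hνb k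
      rw [sectorForce]
      refine (abs_add_le _ _).trans ?_
      rw [abs_mul, abs_mul]
      exact add_le_add (mul_le_mul e3 e2 (abs_nonneg _) (by positivity))
        (mul_le_mul e5 e4 (abs_nonneg _) (by positivity)))
    (by
      have h1 := hcS' x y
      exact Continuous.continuousOn (by fun_prop))
    (fun τ _ => hBl τ)
    (fun τ hτ => by
      have e := ((((hνl.pow 2).sub_const (lam ^ 2 * rexp (2 * τ))).mul (hBl τ)).add
        (hνl.mul (((hvl τ b y hbl).mul_const (cos (n * π))).sub (hvl τ a x hal))))
      rw [hx τ hτ, hy τ hτ, zero_mul, sub_zero, mul_zero, add_zero] at e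
      exact e)
  exact ⟨b', by positivity, by positivity, fun τ hτ => (hb' τ hτ).1, fun τ hτ => (hb' τ hτ).2,
    fun τ _ => abs_sectorMode_le h.bdd n hxy.le τ⟩

end PolyEig

namespace PolyEig
open Real

/-- The odd `2α`-periodic extension of a function on `[0, α]`. -/
noncomputable def oddExt (α : ℝ) (u : ℝ → ℝ) (θ : ℝ) : ℝ :=
  if 0 ≤ sin (π / α * θ) then u (α / π * arccos (cos (π / α * θ)))
  else -u (α / π * arccos (cos (π / α * θ)))

section OddExt
variable {α : ℝ} {u : ℝ → ℝ}

lemma oddExt_of_mem (hα : 0 < α) {θ : ℝ} (hθ : θ ∈ Icc 0 α) : oddExt α u θ = u θ := by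
  have hπ := Real.pi_pos
  have h0 : 0 ≤ π / α * θ := mul_nonneg (by positivity) hθ.1
  have h1 : π / α * θ ≤ π := by
    rw [div_mul_eq_mul_div, div_le_iff₀ hα]
    exact mul_le_mul_of_nonneg_left hθ.2 hπ.le
  rw [oddExt, if_pos (sin_nonneg_of_nonneg_of_le_pi h0 h1), arccos_cos h0 h1]
  congr 1
  field_simp

lemma apply_arccos_of_sin_eq_zero (h0 : u 0 = 0) (h1 : u α = 0) {t : ℝ}
    (ht : sin t = 0) : u (α / π * arccos (cos t)) = 0 := by
  have hπ := Real.pi_pos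
  rcases sin_eq_zero_iff_cos_eq.mp ht with h | h
  · rw [h, arccos_one, mul_zero, h0]
  · rw [h, arccos_neg_one, div_mul_cancel₀ _ hπ.ne', h1]

lemma oddExt_neg (h0 : u 0 = 0) (h1 : u α = 0) (θ : ℝ) :
    oddExt α u (-θ) = -oddExt α u θ := by
  unfold oddExt
  rw [mul_neg, sin_neg, cos_neg]
  rcases lt_trichotomy (sin (π / α * θ)) 0 with h | h | h
  · rw [if_pos (by linarith), if_neg (by linarith), neg_neg]
  · rw [apply_arccos_of_sin_eq_zero h0 h1 h]
    simp
  · rw [if_neg (by linarith), if_pos h.le]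

lemma oddExt_periodic (hα : 0 < α) : Function.Periodic (oddExt α u) (2 * α) := by
  intro θ
  have : π / α * (θ + 2 * α) = π / α * θ + 2 * π := by field_simp
  rw [oddExt, this, sin_add_two_pi, cos_add_two_pi, oddExt]

lemma oddExt_two_mul_sub (hα : 0 < α) (h0 : u 0 = 0) (h1 : u α = 0) (θ : ℝ) :
    oddExt α u (2 * α - θ) = -oddExt α u θ := by
  rw [← oddExt_neg h0 h1, ← oddExt_periodic hα (-θ)]
  congr 1
  ring

lemma continuous_oddExt (hu : Continuous u) (h0 : u 0 = 0) (h1 : u α = 0) :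
    Continuous (oddExt α u) := by
  unfold oddExt
  have hc : Continuous fun θ => u (α / π * arccos (cos (π / α * θ))) :=
    hu.comp (continuous_const.mul (continuous_arccos.comp (by fun_prop)))
  refine Continuous.if_le hc hc.neg continuous_const (by fun_prop) fun θ hθ => ?_
  rw [apply_arccos_of_sin_eq_zero h0 h1 hθ.symm, neg_zero]

lemma two_pi_div_pi_div (hα : 0 < α) : 2 * π / (π / α) = 2 * α := by
  have hπ := Real.pi_pos
  field_simp

lemma cosCoeff_oddExt (hα : 0 < α) (h0 : u 0 = 0) (h1 : u α = 0) (n : ℕ) :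
    cosCoeff (π / α) (oddExt α u) n = 0 := by
  rw [cosCoeff, two_pi_div_pi_div hα]
  have h := intervalIntegral.integral_comp_sub_left (a := 0) (b := 2 * α)
    (fun θ => oddExt α u θ * cos (n * (π / α) * θ)) (2 * α)
  rw [sub_self, sub_zero] at h
  have h2 : ∀ θ, oddExt α u (2 * α - θ) * cos (n * (π / α) * (2 * α - θ)) =
      -(oddExt α u θ * cos (n * (π / α) * θ)) := fun θ => by
    rw [oddExt_two_mul_sub hα h0 h1, show n * (π / α) * (2 * α - θ) =
      n * (2 * π) - n * (π / α) * θ by field_simp, cos_nat_mul_two_pi_sub, neg_mul]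
  simp_rw [h2] at h
  rw [intervalIntegral.integral_neg] at h
  linarith

lemma integral_of_symm {g : ℝ → ℝ} (hg : Continuous g) (h : ∀ θ, g (2 * α - θ) = g θ) :
    ∫ θ in (0 : ℝ)..2 * α, g θ = 2 * ∫ θ in (0 : ℝ)..α, g θ := by
  rw [← intervalIntegral.integral_add_adjacent_intervals (hg.intervalIntegrable 0 α)
    (hg.intervalIntegrable α (2 * α))]
  have h1 := intervalIntegral.integral_comp_sub_left (a := 0) (b := α) g (2 * α)
  simp_rw [h] at h1
  rw [sub_zero, show 2 * α - α = α by ring] at h1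
  rw [← h1]
  ring

lemma sinCoeff_oddExt (hα : 0 < α) (hu : Continuous u) (h0 : u 0 = 0) (h1 : u α = 0) (n : ℕ) :
    sinCoeff (π / α) (oddExt α u) n = 2 * ∫ θ in (0 : ℝ)..α, u θ * sin (n * (π / α) * θ) := by
  have hc := continuous_oddExt hu h0 h1
  rw [sinCoeff, two_pi_div_pi_div hα, integral_of_symm (by fun_prop)]
  · congr 1
    refine intervalIntegral.integral_congr fun θ hθ => ?_
    rw [uIcc_of_le hα.le] at hθ
    simp only [oddExt_of_mem hα hθ]
  · intro θ
    rw [oddExt_two_mul_sub hα h0 h1, show n * (π / α) * (2 * α - θ) =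
      n * (2 * π) - n * (π / α) * θ by field_simp, sin_nat_mul_two_pi_sub, neg_mul_neg]

lemma lintegral_oddExt_sq (hα : 0 < α) (hu : Continuous u) (h0 : u 0 = 0) (h1 : u α = 0) :
    ∫⁻ θ in Ioc 0 (2 * α), ENNReal.ofReal (oddExt α u θ ^ 2) =
      2 * ∫⁻ θ in Ioc 0 α, ENNReal.ofReal (u θ ^ 2) := by
  have hc := continuous_oddExt hu h0 h1
  have hc2 : Continuous fun θ => oddExt α u θ ^ 2 := hc.pow 2
  have key : ∀ (f : ℝ → ℝ) (c : ℝ), Continuous f → 0 ≤ c →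
      ∫⁻ θ in Ioc 0 c, ENNReal.ofReal (f θ ^ 2) = ENNReal.ofReal (∫ θ in (0 : ℝ)..c, f θ ^ 2) := by
    intro f c hf hc
    have hf2 : Continuous fun θ => f θ ^ 2 := hf.pow 2
    rw [intervalIntegral.integral_of_le hc, ofReal_integral_eq_lintegral_ofReal
      (hf2.continuousOn.integrableOn_Icc.mono_set Ioc_subset_Icc_self)
      (Eventually.of_forall fun θ => sq_nonneg _)]
  rw [key _ _ hc (by positivity), key _ _ hu hα.le, integral_of_symm hc2 fun θ => by
    rw [oddExt_two_mul_sub hα h0 h1, neg_sq], ENNReal.ofReal_mul (by norm_num), ENNReal.ofReal_ofNat]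
  congr 2
  refine intervalIntegral.integral_congr fun θ hθ => ?_
  rw [uIcc_of_le hα.le] at hθ
  simp only [oddExt_of_mem hα hθ]

end OddExt

lemma BddSol.const_mul_congr {ν κ M T : ℝ} {x x' y : ℝ → ℝ} (h : BddSol ν κ M T x x') (c : ℝ)
    (hy : ∀ τ < T, y τ = c * x τ) : BddSol ν κ (|c| * M) T y (fun τ => c * x' τ) where
  hν := h.hν
  hκ := h.hκ
  d1 τ hτ := by
    refine ((h.d1 τ hτ).const_mul c).congr_of_eventuallyEq ?_
    filter_upwards [Iio_mem_nhds hτ] with s hs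
    exact hy s hs
  d2 τ hτ := ((h.d2 τ hτ).const_mul c).congr_deriv (by rw [hy τ hτ]; ring)
  bd τ hτ := by
    rw [hy τ hτ, abs_mul]
    exact mul_le_mul_of_nonneg_left (h.bd τ hτ) (abs_nonneg c)

variable {lam ε M : ℝ} {v v₁ v₁₁ v₂ v₂₂ : ℝ → ℝ → ℝ}

lemma PolarSol.vertexField_circle (h : PolarSol lam (log ε) M univ v v₁ v₁₁ v₂ v₂₂)
    (hper : ∀ τ, Function.Periodic (v τ) (2 * π))
    (hE : ∫⁻ τ in Iio (log ε), (∫⁻ θ in Ioc 0 (2 * π), ENNReal.ofReal (v τ θ ^ 2)) *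
      ENNReal.ofReal (rexp (2 * τ)) ≤ 1) : VertexField 1 ε lam v where
  cont τ _ := h.cont.comp (f := fun θ => (τ, θ)) (by fun_prop)
  per τ _ := by rw [div_one]; exact hper τ
  cosMode n := (h.bddSol_circle hper n).1
  sinMode n := (h.bddSol_circle hper n).2
  energy := by
    rw [div_one]
    exact hE.trans (by norm_num)

lemma setLIntegral_Ioc_comp_add (f : ℝ → ℝ≥0∞) (x a b : ℝ) :
    ∫⁻ s in Ioc a b, f (x + s) = ∫⁻ θ in Ioc (x + a) (x + b), f θ := by
  rw [← lintegral_indicator measurableSet_Ioc, ← lintegral_indicator measurableSet_Ioc,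
    ← lintegral_add_left_eq_self (μ := volume) ((Ioc (x + a) (x + b)).indicator f) x]
  congr 1
  ext s
  simp only [indicator, mem_Ioc, add_lt_add_iff_left, add_le_add_iff_left]

lemma PolarSol.vertexField_sector {x y : ℝ} (hxy : x < y)
    (h : PolarSol lam (log ε) M (Ioo x y) v v₁ v₁₁ v₂ v₂₂)
    (hx : ∀ τ < log ε, v τ x = 0) (hy : ∀ τ < log ε, v τ y = 0)
    (hE : ∫⁻ τ in Iio (log ε), (∫⁻ θ in Ioc x y, ENNReal.ofReal (v τ θ ^ 2)) *
      ENNReal.ofReal (rexp (2 * τ)) ≤ 1) :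
    VertexField (π / (y - x)) ε lam fun τ => oddExt (y - x) fun s => v τ (x + s) := by
  have hα : 0 < y - x := by linarith
  have hc : ∀ τ, Continuous fun s => v τ (x + s) := fun τ =>
    h.cont.comp (f := fun s => (τ, x + s)) (by fun_prop)
  have h0 : ∀ τ < log ε, v τ (x + 0) = 0 := fun τ hτ => by rw [add_zero, hx τ hτ]
  have h1 : ∀ τ < log ε, v τ (x + (y - x)) = 0 := fun τ hτ => by rw [add_sub_cancel, hy τ hτ]
  refine ⟨fun τ hτ => continuous_oddExt (hc τ) (h0 τ hτ) (h1 τ hτ), fun τ _ => ?_, fun n => ?_,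
    fun n => ?_, ?_⟩
  · rw [two_pi_div_pi_div hα]
    exact oddExt_periodic hα
  · obtain ⟨x', hx'⟩ := h.bddSol_sector hxy hx hy n
    refine ⟨_, _, hx'.const_mul_congr 0 fun τ hτ => ?_⟩
    rw [zero_mul]
    exact cosCoeff_oddExt hα (h0 τ hτ) (h1 τ hτ) n
  · obtain ⟨x', hx'⟩ := h.bddSol_sector hxy hx hy n
    refine ⟨_, _, hx'.const_mul_congr 2 fun τ hτ => ?_⟩
    rw [sinCoeff_oddExt hα (hc τ) (h0 τ hτ) (h1 τ hτ), sectorMode_eq hxy]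
    congr 1
    have := intervalIntegral.integral_comp_add_left (a := 0) (b := y - x)
      (fun θ => v τ θ * sin (n * (π / (y - x)) * (θ - x))) x
    rw [add_zero, add_sub_cancel] at this
    rw [← this]
    simp only [add_sub_cancel_left]
  · calc _ ≤ ∫⁻ τ in Iio (log ε), 2 * ((∫⁻ θ in Ioc x y, ENNReal.ofReal (v τ θ ^ 2)) *
        ENNReal.ofReal (rexp (2 * τ))) := by
          refine setLIntegral_mono' measurableSet_Iio fun τ hτ => ?_
          rw [two_pi_div_pi_div hα, lintegral_oddExt_sq hα (hc τ) (h0 τ hτ) (h1 τ hτ),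
            setLIntegral_Ioc_comp_add fun θ => ENNReal.ofReal (v τ θ ^ 2), add_zero,
            add_sub_cancel, mul_assoc]
      _ ≤ 2 * 1 := by
          rw [lintegral_const_mul' _ _ (by simp)]
          gcongr
      _ = 2 := mul_one 2

/-- Estimates for a solution in a punctured disc. -/
theorem exists_bound_circle {ε : ℝ} (hε : 0 < ε) : ∃ C : ℝ, 0 ≤ C ∧
    ∀ (lam M : ℝ) (v v₁ v₁₁ v₂ v₂₂ : ℝ → ℝ → ℝ), 1 ≤ lam →
      PolarSol lam (log ε) M univ v v₁ v₁₁ v₂ v₂₂ → (∀ τ, Function.Periodic (v τ) (2 * π)) →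
      ∫⁻ τ in Iio (log ε), (∫⁻ θ in Ioc 0 (2 * π), ENNReal.ofReal (v τ θ ^ 2)) *
        ENNReal.ofReal (rexp (2 * τ)) ≤ 1 →
      (∀ τ < log (ε / 8), ∀ θ, |v τ θ| ≤ C * √lam) ∧
      ∫⁻ τ in Iio (log (ε / 8)), (∫⁻ θ in Ioc 0 (2 * π), ‖v τ θ‖ₑ ^ 6) *
        ENNReal.ofReal (rexp (2 * τ)) ≤ ENNReal.ofReal (C * lam) := by
  obtain ⟨C, hC, h⟩ := VertexField.exists_bound (w := 1) (by norm_num) hε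
  refine ⟨C, hC, fun lam M v v₁ v₁₁ v₂ v₂₂ hlam hv hper hE => ?_⟩
  have := h lam v hlam (hv.vertexField_circle hper hE)
  rwa [div_one] at this

/-- Estimates for a solution in a sector. -/
theorem exists_bound_sector {ε x y : ℝ} (hε : 0 < ε) (hxy : x < y) (hy : y ≤ x + 2 * π) :
    ∃ C : ℝ, 0 ≤ C ∧ ∀ (lam M : ℝ) (v v₁ v₁₁ v₂ v₂₂ : ℝ → ℝ → ℝ), 1 ≤ lam →
      PolarSol lam (log ε) M (Ioo x y) v v₁ v₁₁ v₂ v₂₂ →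
      (∀ τ < log ε, v τ x = 0) → (∀ τ < log ε, v τ y = 0) →
      ∫⁻ τ in Iio (log ε), (∫⁻ θ in Ioc x y, ENNReal.ofReal (v τ θ ^ 2)) *
        ENNReal.ofReal (rexp (2 * τ)) ≤ 1 →
      (∀ τ < log (ε / 8), ∀ θ ∈ Icc x y, |v τ θ| ≤ C * √lam) ∧
      ∫⁻ τ in Iio (log (ε / 8)), (∫⁻ θ in Ioc x y, ‖v τ θ‖ₑ ^ 6) *
        ENNReal.ofReal (rexp (2 * τ)) ≤ ENNReal.ofReal (C * lam) := by
  have hπ := Real.pi_pos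
  have hα : 0 < y - x := by linarith
  obtain ⟨C, hC, h⟩ := VertexField.exists_bound (w := π / (y - x))
    (by rw [div_le_div_iff₀ (by norm_num) hα]; linarith) hε
  refine ⟨C, hC, fun lam M v v₁ v₁₁ v₂ v₂₂ hlam hv hvx hvy hE => ?_⟩
  obtain ⟨h1, h2⟩ := h lam _ hlam (hv.vertexField_sector hxy hvx hvy hE)
  refine ⟨fun τ hτ θ hθ => ?_, le_trans ?_ h2⟩
  · have := h1 τ hτ (θ - x)
    rwa [oddExt_of_mem hα ⟨by linarith [hθ.1], by linarith [hθ.2]⟩, add_sub_cancel] at this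
  · refine setLIntegral_mono' measurableSet_Iio fun τ _ => ?_
    refine mul_le_mul_left ?_ _
    rw [two_pi_div_pi_div hα]
    calc ∫⁻ θ in Ioc x y, ‖v τ θ‖ₑ ^ 6 = ∫⁻ s in Ioc 0 (y - x), ‖v τ (x + s)‖ₑ ^ 6 := by
          rw [setLIntegral_Ioc_comp_add fun θ => ‖v τ θ‖ₑ ^ 6, add_zero, add_sub_cancel]
      _ = ∫⁻ s in Ioc 0 (y - x), ‖oddExt (y - x) (fun s => v τ (x + s)) s‖ₑ ^ 6 := by
          refine setLIntegral_congr_fun measurableSet_Ioc fun s hs => ?_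
          simp only [oddExt_of_mem hα ⟨hs.1.le, hs.2⟩]
      _ ≤ _ := lintegral_mono_set (Ioc_subset_Ioc_right (by linarith))

end PolyEig

namespace PolyEig
open Real

/-- The Euclidean plane. -/
abbrev Plane := EuclideanSpace ℝ (Fin 2)

/-- The point with logarithmic polar coordinates `(τ, θ)` centred at `p`. -/
noncomputable def logPolar (p : Plane) (τ θ : ℝ) : Plane :=
  p + ((rexp τ * cos θ) • EuclideanSpace.single 0 1 + (rexp τ * sin θ) • EuclideanSpace.single 1 1)

/-- The partial derivative of `f` in the direction of the `i`-th coordinate. -/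
noncomputable def partialDeriv (i : Fin 2) (f : Plane → ℝ) (x : Plane) : ℝ :=
  fderiv ℝ f x (EuclideanSpace.single i 1)

lemma planeLaplacian_eq (f : Plane → ℝ) (x : Plane) :
    planeLaplacian f x =
      partialDeriv 0 (partialDeriv 0 f) x + partialDeriv 1 (partialDeriv 1 f) x := by
  simp only [planeLaplacian, Fin.sum_univ_two]
  rfl

lemma contDiffOn_partialDeriv {U : Set Plane} (hU : IsOpen U) {f : Plane → ℝ}
    (hf : ContDiffOn ℝ (⊤ : ℕ∞) f U) (i : Fin 2) :
    ContDiffOn ℝ (⊤ : ℕ∞) (partialDeriv i f) U :=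
  (hf.fderiv_of_isOpen hU (by simp)).clm_apply contDiffOn_const

lemma continuous_logPolar (p : Plane) : Continuous (Function.uncurry (logPolar p)) := by
  unfold logPolar Function.uncurry
  fun_prop

lemma logPolar_add_two_pi (p : Plane) (τ θ : ℝ) :
    logPolar p τ (θ + 2 * π) = logPolar p τ θ := by
  simp [logPolar]

section
variable {p : Plane} {g : Plane → ℝ} {τ θ : ℝ}

lemma hasDerivAt_logPolar_fst (hg : DifferentiableAt ℝ g (logPolar p τ θ)) :
    HasDerivAt (fun s => g (logPolar p s θ))
      (partialDeriv 0 g (logPolar p τ θ) * (rexp τ * cos θ) +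
        partialDeriv 1 g (logPolar p τ θ) * (rexp τ * sin θ)) τ := by
  have h : HasDerivAt (fun s => logPolar p s θ)
      ((rexp τ * cos θ) • EuclideanSpace.single 0 1 +
        (rexp τ * sin θ) • EuclideanSpace.single 1 1) τ :=
    ((((Real.hasDerivAt_exp τ).mul_const (cos θ)).smul_const _).add
      (((Real.hasDerivAt_exp τ).mul_const (sin θ)).smul_const _)).const_add p
  refine (hg.hasFDerivAt.comp_hasDerivAt (f := fun s => logPolar p s θ) τ h).congr_deriv ?_
  simp [partialDeriv, mul_comm]

lemma hasDerivAt_logPolar_snd (hg : DifferentiableAt ℝ g (logPolar p τ θ)) :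
    HasDerivAt (fun t => g (logPolar p τ t))
      (-partialDeriv 0 g (logPolar p τ θ) * (rexp τ * sin θ) +
        partialDeriv 1 g (logPolar p τ θ) * (rexp τ * cos θ)) θ := by
  have h : HasDerivAt (fun t => logPolar p τ t)
      ((rexp τ * -sin θ) • EuclideanSpace.single 0 1 +
        (rexp τ * cos θ) • EuclideanSpace.single 1 1) θ :=
    ((((Real.hasDerivAt_cos θ).const_mul (rexp τ)).smul_const _).add
      (((Real.hasDerivAt_sin θ).const_mul (rexp τ)).smul_const _)).const_add p
  refine (hg.hasFDerivAt.comp_hasDerivAt (f := fun t => logPolar p τ t) θ h).congr_deriv ?_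
  simp [partialDeriv]
  ring

end

/-- A bounded continuous solution of the Helmholtz equation off the closed set `F`, vanishing on
`F`, with `L²` norm at most one. -/
structure EigField (F : Set Plane) (lam : ℝ) (f : Plane → ℝ) : Prop where
  cont : Continuous f
  bdd : ∃ M, ∀ x, |f x| ≤ M
  smooth : ContDiffOn ℝ (⊤ : ℕ∞) f Fᶜ
  pde : ∀ x ∉ F, planeLaplacian f x = -(lam ^ 2 * f x)
  zero : ∀ x ∈ F, f x = 0
  energy : ∫⁻ x, ENNReal.ofReal (f x ^ 2) ≤ 1

lemma EigField.polarSol {F : Set Plane} {lam : ℝ} {f : Plane → ℝ} (hF : IsClosed F)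
    (h : EigField F lam f) {M : ℝ} (hM : ∀ x, |f x| ≤ M) (p : Plane) {T : ℝ} {D : Set ℝ}
    (hD : ∀ τ < T, ∀ θ ∈ D, logPolar p τ θ ∉ F) :
    ∃ v₁ v₁₁ v₂ v₂₂, PolarSol lam T M D (fun τ θ => f (logPolar p τ θ)) v₁ v₁₁ v₂ v₂₂ := by
  have hU : IsOpen Fᶜ := hF.isOpen_compl
  have hs1 := fun i => contDiffOn_partialDeriv hU h.smooth i
  have hs2 := fun i j => contDiffOn_partialDeriv hU (hs1 j) i
  have hdiff : ∀ {g : Plane → ℝ}, ContDiffOn ℝ (⊤ : ℕ∞) g Fᶜ → ∀ τ < T, ∀ θ ∈ D,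
      DifferentiableAt ℝ g (logPolar p τ θ) := fun hg τ hτ θ hθ =>
    (hg.contDiffAt (hU.mem_nhds (hD τ hτ θ hθ))).differentiableAt (by simp)
  have hcont : ∀ {g : Plane → ℝ}, ContDiffOn ℝ (⊤ : ℕ∞) g Fᶜ →
      ContinuousOn (fun x : ℝ × ℝ => g (logPolar p x.1 x.2)) (Iio T ×ˢ D) := fun hg =>
    hg.continuousOn.comp (f := fun x : ℝ × ℝ => logPolar p x.1 x.2)
      (continuous_logPolar p).continuousOn fun x hx => hD x.1 hx.1 x.2 hx.2
  have hc0 := hcont (hs1 0)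
  have hc1 := hcont (hs1 1)
  have hc00 := hcont (hs2 0 0)
  have hc01 := hcont (hs2 0 1)
  have hc10 := hcont (hs2 1 0)
  have hc11 := hcont (hs2 1 1)
  have hcx : ContinuousOn (fun x : ℝ × ℝ => rexp x.1 * cos x.2) (Iio T ×ˢ D) := by fun_prop
  have hsx : ContinuousOn (fun x : ℝ × ℝ => rexp x.1 * sin x.2) (Iio T ×ˢ D) := by fun_prop
  refine ⟨fun τ θ => partialDeriv 0 f (logPolar p τ θ) * (rexp τ * cos θ) +
      partialDeriv 1 f (logPolar p τ θ) * (rexp τ * sin θ),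
    fun τ θ => (partialDeriv 0 (partialDeriv 0 f) (logPolar p τ θ) * (rexp τ * cos θ) +
        partialDeriv 1 (partialDeriv 0 f) (logPolar p τ θ) * (rexp τ * sin θ)) * (rexp τ * cos θ) +
      partialDeriv 0 f (logPolar p τ θ) * (rexp τ * cos θ) +
      ((partialDeriv 0 (partialDeriv 1 f) (logPolar p τ θ) * (rexp τ * cos θ) +
        partialDeriv 1 (partialDeriv 1 f) (logPolar p τ θ) * (rexp τ * sin θ)) * (rexp τ * sin θ) +
      partialDeriv 1 f (logPolar p τ θ) * (rexp τ * sin θ)),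
    fun τ θ => -partialDeriv 0 f (logPolar p τ θ) * (rexp τ * sin θ) +
      partialDeriv 1 f (logPolar p τ θ) * (rexp τ * cos θ),
    fun τ θ => -(-partialDeriv 0 (partialDeriv 0 f) (logPolar p τ θ) * (rexp τ * sin θ) +
        partialDeriv 1 (partialDeriv 0 f) (logPolar p τ θ) * (rexp τ * cos θ)) * (rexp τ * sin θ) +
      -partialDeriv 0 f (logPolar p τ θ) * (rexp τ * cos θ) +
      ((-partialDeriv 0 (partialDeriv 1 f) (logPolar p τ θ) * (rexp τ * sin θ) +
        partialDeriv 1 (partialDeriv 1 f) (logPolar p τ θ) * (rexp τ * cos θ)) * (rexp τ * cos θ) +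
      partialDeriv 1 f (logPolar p τ θ) * (rexp τ * -sin θ)), ?_⟩
  constructor
  · exact h.cont.comp (continuous_logPolar p)
  · exact fun τ θ => hM _
  · exact (hc0.mul hcx).add (hc1.mul hsx)
  · exact ((((hc00.mul hcx).add (hc10.mul hsx)).mul hcx).add (hc0.mul hcx)).add
      ((((hc01.mul hcx).add (hc11.mul hsx)).mul hsx).add (hc1.mul hsx))
  · have hnx : ContinuousOn (fun x : ℝ × ℝ => rexp x.1 * -sin x.2) (Iio T ×ˢ D) := by fun_prop
    exact ((((hc00.neg.mul hsx).add (hc10.mul hcx)).neg.mul hsx).add (hc0.neg.mul hcx)).add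
      ((((hc01.neg.mul hsx).add (hc11.mul hcx)).mul hcx).add (hc1.mul hnx))
  · exact fun τ hτ θ hθ => hasDerivAt_logPolar_fst (hdiff h.smooth τ hτ θ hθ)
  · intro τ hτ θ hθ
    exact ((hasDerivAt_logPolar_fst (hdiff (hs1 0) τ hτ θ hθ)).mul
        ((Real.hasDerivAt_exp τ).mul_const (cos θ))).add
      ((hasDerivAt_logPolar_fst (hdiff (hs1 1) τ hτ θ hθ)).mul
        ((Real.hasDerivAt_exp τ).mul_const (sin θ)))
  · exact fun τ hτ θ hθ => hasDerivAt_logPolar_snd (hdiff h.smooth τ hτ θ hθ)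
  · intro τ hτ θ hθ
    exact ((hasDerivAt_logPolar_snd (hdiff (hs1 0) τ hτ θ hθ)).neg.mul
        ((Real.hasDerivAt_sin θ).const_mul (rexp τ))).add
      ((hasDerivAt_logPolar_snd (hdiff (hs1 1) τ hτ θ hθ)).mul
        ((Real.hasDerivAt_cos θ).const_mul (rexp τ)))
  · intro τ hτ θ hθ
    have h1 := h.pde _ (hD τ hτ θ hθ)
    rw [planeLaplacian_eq] at h1
    have h2 : rexp (2 * τ) = rexp τ ^ 2 := exp_two_mul_eq_sq τ
    have h3 := Real.sin_sq_add_cos_sq θ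
    rw [h2]
    linear_combination (rexp τ ^ 2 * (sin θ ^ 2 + cos θ ^ 2)) * h1 -
      lam ^ 2 * f (logPolar p τ θ) * rexp τ ^ 2 * h3

end PolyEig

namespace PolyEig
open Real

lemma partialDeriv_eventuallyEq {f g : Plane → ℝ} {x : Plane} (h : f =ᶠ[nhds x] g) (i : Fin 2) :
    partialDeriv i f =ᶠ[nhds x] partialDeriv i g :=
  (h.fderiv (𝕜 := ℝ)).mono fun y hy => by simp only [partialDeriv, hy]

lemma planeLaplacian_congr {f g : Plane → ℝ} {x : Plane} (h : f =ᶠ[nhds x] g) :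
    planeLaplacian f x = planeLaplacian g x := by
  rw [planeLaplacian_eq, planeLaplacian_eq,
    (partialDeriv_eventuallyEq (partialDeriv_eventuallyEq h 0) 0).eq_of_nhds,
    (partialDeriv_eventuallyEq (partialDeriv_eventuallyEq h 1) 1).eq_of_nhds]

lemma planeLaplacian_zero (x : Plane) : planeLaplacian (fun _ => (0 : ℝ)) x = 0 := by
  simp [planeLaplacian]

lemma eigField_indicator {Ω : Set Plane} (hΩ : IsOpen Ω) (hb : Bornology.IsBounded Ω)
    {φ : Plane → ℝ} {lam : ℝ} (hφ : ContDiffOn ℝ (⊤ : ℕ∞) φ Ω) (hc : ContinuousOn φ (closure Ω))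
    (h0 : ∀ x ∈ frontier Ω, φ x = 0) (hpde : ∀ x ∈ Ω, -planeLaplacian φ x = lam ^ 2 * φ x)
    (hn : eLpNorm φ 2 (volume.restrict Ω) = 1) :
    EigField (frontier Ω) lam (Ω.indicator φ) := by
  have hcompl : ∀ x ∉ frontier Ω, x ∈ Ω ∨ x ∈ (closure Ω)ᶜ := by
    intro x hx
    rw [hΩ.frontier_eq] at hx
    by_contra! h
    exact hx ⟨not_notMem.mp h.2, h.1⟩
  have hin : ∀ x ∈ Ω, Ω.indicator φ =ᶠ[nhds x] φ := fun x hx =>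
    (hΩ.eventually_mem hx).mono fun y hy => indicator_of_mem hy φ
  have hout : ∀ x ∈ (closure Ω)ᶜ, Ω.indicator φ =ᶠ[nhds x] fun _ => 0 := fun x hx =>
    (isClosed_closure.isOpen_compl.eventually_mem hx).mono fun y hy =>
      indicator_of_notMem (fun h => hy (subset_closure h)) φ
  constructor
  · exact continuous_indicator h0 hc
  · obtain ⟨M, hM⟩ := (Metric.isCompact_of_isClosed_isBounded isClosed_closure
      hb.closure).exists_bound_of_continuousOn hc
    refine ⟨max M 0, fun x => ?_⟩
    by_cases hx : x ∈ Ω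
    · rw [indicator_of_mem hx]
      exact (hM x (subset_closure hx)).trans (le_max_left _ _)
    · rw [indicator_of_notMem hx, abs_zero]
      exact le_max_right _ _
  · intro x hx
    rcases hcompl x hx with h | h
    · exact ((hφ.contDiffAt (hΩ.mem_nhds h)).congr_of_eventuallyEq (hin x h)).contDiffWithinAt
    · exact (contDiffAt_const.congr_of_eventuallyEq (hout x h)).contDiffWithinAt
  · intro x hx
    rcases hcompl x hx with h | h
    · rw [planeLaplacian_congr (hin x h), indicator_of_mem h, ← hpde x h, neg_neg]
    · rw [planeLaplacian_congr (hout x h), planeLaplacian_zero,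
        indicator_of_notMem fun h' => h (subset_closure h')]
      simp
  · intro x hx
    rw [hΩ.frontier_eq] at hx
    exact indicator_of_notMem hx.2 φ
  · have h1 : ∫⁻ x in Ω, ‖φ x‖ₑ ^ (2 : ℝ) = 1 := by
      rw [eLpNorm_eq_lintegral_rpow_enorm_toReal (by norm_num) (by norm_num)] at hn
      simp only [ENNReal.toReal_ofNat] at hn
      have := congrArg (· ^ (2 : ℝ)) hn
      simp only [← ENNReal.rpow_mul, ENNReal.one_rpow] at this
      rwa [show (1 / 2 * 2 : ℝ) = 1 by norm_num, ENNReal.rpow_one] at this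
    rw [← h1, ← lintegral_indicator hΩ.measurableSet]
    refine le_of_eq (lintegral_congr fun x => ?_)
    by_cases hx : x ∈ Ω
    · rw [indicator_of_mem hx, indicator_of_mem hx, ← sq_abs,
        ENNReal.ofReal_pow (abs_nonneg _), Real.enorm_eq_ofReal_abs]
      norm_cast
    · rw [indicator_of_notMem hx, indicator_of_notMem hx]
      simp

end PolyEig

namespace PolyEig
open Real

lemma isClosed_segment (a b : Plane) : IsClosed (segment ℝ a b) := by
  rw [segment_eq_image]
  exact (isCompact_Icc.image (by fun_prop)).isClosed

lemma logPolar_apply_zero (p : Plane) (τ θ : ℝ) :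
    logPolar p τ θ 0 = p 0 + rexp τ * cos θ := by
  simp [logPolar]

lemma logPolar_apply_one (p : Plane) (τ θ : ℝ) :
    logPolar p τ θ 1 = p 1 + rexp τ * sin θ := by
  simp [logPolar]

lemma dist_logPolar (p : Plane) (τ θ : ℝ) : dist (logPolar p τ θ) p = rexp τ := by
  rw [EuclideanSpace.dist_eq, Fin.sum_univ_two, Real.dist_eq, Real.dist_eq, logPolar_apply_zero,
    logPolar_apply_one, sq_abs, sq_abs,
    show (p 0 + rexp τ * cos θ - p 0) ^ 2 + (p 1 + rexp τ * sin θ - p 1) ^ 2 =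
      rexp τ ^ 2 * (sin θ ^ 2 + cos θ ^ 2) by ring, sin_sq_add_cos_sq, mul_one,
    sqrt_sq (exp_pos τ).le]

lemma mem_segment_iff_mem_union {a b p x : Plane} (hp : p ∈ segment ℝ a b) :
    x ∈ segment ℝ a b ↔ x ∈ segment ℝ p a ∪ segment ℝ p b := by
  constructor
  · intro hx
    rw [← insert_endpoints_openSegment] at hx
    rcases hx with rfl | rfl | hx
    · exact Or.inl (right_mem_segment _ _ _)
    · exact Or.inr (right_mem_segment _ _ _)
    · have hr : p ∈ range (AffineMap.lineMap a b : ℝ → Plane) := by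
        rw [segment_eq_image_lineMap] at hp
        exact image_subset_range _ _ hp
      rcases openSegment_subset_union a b hr hx with rfl | h | h
      · exact Or.inl (left_mem_segment _ _ _)
      · rw [segment_symm ℝ p a]
        exact Or.inl (openSegment_subset_segment _ _ _ h)
      · exact Or.inr (openSegment_subset_segment _ _ _ h)
  · rintro (h | h)
    · exact (convex_segment a b).segment_subset hp (left_mem_segment _ _ _) h
    · exact (convex_segment a b).segment_subset hp (right_mem_segment _ _ _) h

/-- Near `p`, the set `F` is a union of finitely many rays issuing from `p`, with angles in `Θ`. -/
def IsStarAt (F : Set Plane) (p : Plane) : Prop :=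
  ∃ ε > 0, ∃ Θ : Set ℝ, (∀ τ < log ε, ∀ θ, logPolar p τ θ ∈ F ↔ θ ∈ Θ) ∧
    ∀ x y, (Θ ∩ Icc x y).Finite

lemma IsStarAt.congr {F G : Set Plane} {p : Plane} (h : IsStarAt F p) (hFG : F = G) :
    IsStarAt G p := hFG ▸ h

lemma IsStarAt.union {F G : Set Plane} {p : Plane} (hF : IsStarAt F p) (hG : IsStarAt G p) :
    IsStarAt (F ∪ G) p := by
  obtain ⟨ε, hε, Θ, h1, h2⟩ := hF
  obtain ⟨ε', hε', Θ', h1', h2'⟩ := hG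
  refine ⟨min ε ε', lt_min hε hε', Θ ∪ Θ', fun τ hτ θ => ?_, fun x y => ?_⟩
  · rw [mem_union, mem_union,
      h1 τ (hτ.trans_le (log_le_log (lt_min hε hε') (min_le_left _ _))) θ,
      h1' τ (hτ.trans_le (log_le_log (lt_min hε hε') (min_le_right _ _))) θ]
  · rw [union_inter_distrib_right]
    exact (h2 x y).union (h2' x y)

lemma isStarAt_of_notMem {F : Set Plane} {p : Plane} (hF : IsClosed F) (hp : p ∉ F) :
    IsStarAt F p := by
  obtain ⟨ε, hε, h⟩ := Metric.isOpen_iff.mp hF.isOpen_compl p hp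
  refine ⟨ε, hε, ∅, fun τ hτ θ => ?_, fun x y => by simp⟩
  refine iff_of_false (h ?_) (notMem_empty _)
  rw [Metric.mem_ball, dist_logPolar]
  exact (lt_log_iff_exp_lt hε).mp hτ

lemma finite_setOf_cos_sin_eq (r A B x y : ℝ) (hr : r ≠ 0) :
    ({θ | r * cos θ = A ∧ r * sin θ = B} ∩ Icc x y).Finite := by
  rcases eq_empty_or_nonempty ({θ | r * cos θ = A ∧ r * sin θ = B} ∩ Icc x y) with h | ⟨t, ht, -⟩
  · rw [h]
    exact finite_empty
  refine ((finite_Icc ⌈(x - t) / (2 * π)⌉ ⌊(y - t) / (2 * π)⌋).image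
    fun k : ℤ => 2 * π * k + t).subset ?_
  rintro s ⟨hs, hxy⟩
  have hπ := two_pi_pos
  have hst : (s : Real.Angle) = t := Real.Angle.cos_sin_inj
    (mul_left_cancel₀ hr (hs.1.trans ht.1.symm)) (mul_left_cancel₀ hr (hs.2.trans ht.2.symm))
  obtain ⟨k, hk⟩ := Real.Angle.angle_eq_iff_two_pi_dvd_sub.mp hst
  refine ⟨k, ⟨Int.ceil_le.mpr ?_, Int.le_floor.mpr ?_⟩, by simp only; linarith⟩
  · rw [div_le_iff₀ hπ]
    linarith [hxy.1]
  · rw [le_div_iff₀ hπ]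
    linarith [hxy.2]

lemma isStarAt_segment_left (p c : Plane) : IsStarAt (segment ℝ p c) p := by
  by_cases hcp : c = p
  · refine ⟨1, one_pos, ∅, fun τ hτ θ => iff_of_false (fun h => ?_) (notMem_empty _),
      fun x y => by simp⟩
    rw [hcp, segment_same, mem_singleton_iff] at h
    have := dist_logPolar p τ θ
    rw [h, dist_self] at this
    exact (exp_pos τ).ne this
  have hr : 0 < dist c p := dist_pos.mpr hcp
  have hr2 : dist c p ^ 2 = (c 0 - p 0) ^ 2 + (c 1 - p 1) ^ 2 := by
    rw [EuclideanSpace.dist_eq, Fin.sum_univ_two, Real.dist_eq, Real.dist_eq, sq_abs, sq_abs,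
      sq_sqrt (by positivity)]
  set r := dist c p
  refine ⟨r, hr, {θ | r * cos θ = c 0 - p 0 ∧ r * sin θ = c 1 - p 1}, fun τ hτ θ => ?_,
    fun x y => finite_setOf_cos_sin_eq _ _ _ x y hr.ne'⟩
  have hτr : rexp τ < r := (lt_log_iff_exp_lt hr).mp hτ
  have hexp := exp_pos τ
  rw [segment_eq_image', mem_ofPred_eq]
  constructor
  · rintro ⟨t, ht, h⟩
    have h0 : t * (c 0 - p 0) = rexp τ * cos θ := by
      have := congrArg (· 0) h
      simp only [logPolar_apply_zero, PiLp.add_apply, PiLp.smul_apply, PiLp.sub_apply,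
        smul_eq_mul] at this
      linarith
    have h1 : t * (c 1 - p 1) = rexp τ * sin θ := by
      have := congrArg (· 1) h
      simp only [logPolar_apply_one, PiLp.add_apply, PiLp.smul_apply, PiLp.sub_apply,
        smul_eq_mul] at this
      linarith
    have h2 : (t * r) ^ 2 = rexp τ ^ 2 := by
      have : (t * r) ^ 2 = (t * (c 0 - p 0)) ^ 2 + (t * (c 1 - p 1)) ^ 2 := by
        rw [mul_pow, hr2]
        ring
      rw [this, h0, h1]
      linear_combination rexp τ ^ 2 * sin_sq_add_cos_sq θ
    have h3 : t * r = rexp τ :=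
      (sq_eq_sq₀ (mul_nonneg ht.1 hr.le) hexp.le).mp h2
    have ht0 : t ≠ 0 := by
      rintro rfl
      simp at h3
      exact absurd h3 hexp.ne
    constructor
    · apply mul_left_cancel₀ ht0
      rw [h0, ← h3]
      ring
    · apply mul_left_cancel₀ ht0
      rw [h1, ← h3]
      ring
  · rintro ⟨h0, h1⟩
    refine ⟨rexp τ / r, ⟨by positivity, (div_le_one hr).mpr hτr.le⟩, ?_⟩
    ext i
    fin_cases i
    · simp only [Fin.zero_eta, logPolar_apply_zero, PiLp.add_apply, PiLp.smul_apply,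
        PiLp.sub_apply, smul_eq_mul, ← h0]
      field_simp
    · simp only [Fin.mk_one, logPolar_apply_one, PiLp.add_apply, PiLp.smul_apply,
        PiLp.sub_apply, smul_eq_mul, ← h1]
      field_simp

lemma isStarAt_segment (a b p : Plane) : IsStarAt (segment ℝ a b) p := by
  by_cases hp : p ∈ segment ℝ a b
  · exact ((isStarAt_segment_left p a).union (isStarAt_segment_left p b)).congr
      (ext fun x => (mem_segment_iff_mem_union hp).symm)
  · exact isStarAt_of_notMem (isClosed_segment a b) hp

lemma isStarAt_iUnion_segment {n : ℕ} (a b : Fin n → Plane) (p : Plane) :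
    IsStarAt (⋃ i, segment ℝ (a i) (b i)) p := by
  induction n with
  | zero =>
    rw [iUnion_of_empty]
    exact isStarAt_of_notMem isClosed_empty (notMem_empty _)
  | succ n ih =>
    refine ((isStarAt_segment (a 0) (b 0) p).union
      (ih (fun i => a i.succ) fun i => b i.succ)).congr (ext fun x => ?_)
    simp [Fin.exists_fin_succ]

end PolyEig

namespace PolyEig
open Real

lemma lintegral_plane (p : Plane) {g : Plane → ℝ≥0∞} (hg : Measurable g) :
    ∫⁻ z : ℝ × ℝ, g (p + (z.1 • EuclideanSpace.single 0 1 + z.2 • EuclideanSpace.single 1 1)) =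
      ∫⁻ x, g x := by
  have h := (PiLp.volume_preserving_toLp (Fin 2)).comp (volume_preserving_finTwoArrow ℝ).symm
  rw [← lintegral_add_left_eq_self g p, ← h.lintegral_comp (by fun_prop)]
  refine lintegral_congr fun z => ?_
  congr 2
  ext i
  fin_cases i <;> simp [MeasurableEquiv.finTwoArrow]

lemma lintegral_comp_logPolar (p : Plane) {g : Plane → ℝ≥0∞} (hg : Measurable g) (c : ℝ) :
    ∫⁻ τ, (∫⁻ θ in Ioc c (c + 2 * π), g (logPolar p τ θ)) * ENNReal.ofReal (rexp (2 * τ)) =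
      ∫⁻ x, g x := by
  rw [← lintegral_plane p hg, ← lintegral_logPolar _ (by fun_prop) c]
  rfl

lemma setLIntegral_ball_eq (p : Plane) {g : Plane → ℝ≥0∞} (hg : Measurable g) (c : ℝ) {r : ℝ}
    (hr : 0 < r) :
    ∫⁻ x in Metric.ball p r, g x = ∫⁻ τ in Iio (log r),
      (∫⁻ θ in Ioc c (c + 2 * π), g (logPolar p τ θ)) * ENNReal.ofReal (rexp (2 * τ)) := by
  rw [← lintegral_indicator measurableSet_ball, ← lintegral_comp_logPolar p
    (hg.indicator measurableSet_ball) c, ← lintegral_indicator measurableSet_Iio]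
  refine lintegral_congr fun τ => ?_
  by_cases hτ : τ ∈ Iio (log r)
  · have h : ∀ θ, logPolar p τ θ ∈ Metric.ball p r := fun θ => by
      rw [Metric.mem_ball, dist_logPolar]
      exact (lt_log_iff_exp_lt hr).mp hτ
    simp only [indicator_of_mem hτ, indicator_of_mem (h _)]
  · have h : ∀ θ, logPolar p τ θ ∉ Metric.ball p r := fun θ => by
      rw [Metric.mem_ball, dist_logPolar]
      exact fun h => hτ ((lt_log_iff_exp_lt hr).mpr h)
    simp only [indicator_of_notMem hτ, indicator_of_notMem (h _), lintegral_zero, zero_mul]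

lemma exists_logPolar_eq {p x : Plane} (hx : x ≠ p) (c : ℝ) :
    ∃ θ ∈ Ioc c (c + 2 * π), logPolar p (log (dist x p)) θ = x := by
  set z : ℂ := ⟨x 0 - p 0, x 1 - p 1⟩ with hz
  have hzd : ‖z‖ = dist x p := by
    rw [EuclideanSpace.dist_eq, Fin.sum_univ_two, Real.dist_eq, Real.dist_eq, sq_abs, sq_abs,
      Complex.norm_eq_sqrt_sq_add_sq]
  obtain ⟨θ, hθ, h⟩ := Function.Periodic.exists_mem_Ioc
    (f := logPolar p (log (dist x p))) (logPolar_add_two_pi p _) two_pi_pos z.arg c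
  refine ⟨θ, hθ, ?_⟩
  rw [← h]
  have he : rexp (log (dist x p)) = ‖z‖ := by rw [exp_log (dist_pos.mpr hx), hzd]
  ext i
  fin_cases i
  · simp only [Fin.zero_eta, logPolar_apply_zero, he, Complex.norm_mul_cos_arg, hz]
    ring
  · simp only [Fin.mk_one, logPolar_apply_one, he, Complex.norm_mul_sin_arg, hz]
    ring

lemma tendsto_logPolar_atBot (p : Plane) (θ : ℝ) :
    Tendsto (fun τ => logPolar p τ θ) atBot (nhds p) := by
  rw [tendsto_iff_dist_tendsto_zero]
  simp only [dist_logPolar]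
  exact tendsto_exp_atBot

lemma measurable_lintegral_logPolar (p : Plane) {g : Plane → ℝ≥0∞} (hg : Measurable g)
    (s : Set ℝ) :
    Measurable fun τ => (∫⁻ θ in s, g (logPolar p τ θ)) * ENNReal.ofReal (rexp (2 * τ)) := by
  have h : Measurable fun z : ℝ × ℝ => g (logPolar p z.1 z.2) :=
    hg.comp (continuous_logPolar p).measurable
  exact h.lintegral_prod_right'.mul (by fun_prop)

/-- A uniform sup and `L⁶` bound for eigenfunctions in the sector with angles in `[x, y]` and
radii below `r` centred at `p`. -/
def SectorBound (F : Set Plane) (p : Plane) (r x y : ℝ) : Prop :=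
  ∃ C : ℝ, 0 ≤ C ∧ ∀ (lam : ℝ) (f : Plane → ℝ), 1 ≤ lam → EigField F lam f →
    (∀ τ < log r, ∀ θ ∈ Icc x y, |f (logPolar p τ θ)| ≤ C * √lam) ∧
    ∫⁻ τ in Iio (log r), (∫⁻ θ in Ioc x y, ‖f (logPolar p τ θ)‖ₑ ^ 6) *
      ENNReal.ofReal (rexp (2 * τ)) ≤ ENNReal.ofReal (C * lam)

lemma SectorBound.trans {F : Set Plane} {p : Plane} {r x y z : ℝ} (hxz : x ≤ z) (hzy : z ≤ y)
    (h₁ : SectorBound F p r x z) (h₂ : SectorBound F p r z y) : SectorBound F p r x y := by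
  obtain ⟨C₁, hC₁, h₁⟩ := h₁
  obtain ⟨C₂, hC₂, h₂⟩ := h₂
  refine ⟨C₁ + C₂, add_nonneg hC₁ hC₂, fun lam f hlam hf => ⟨fun τ hτ θ hθ => ?_, ?_⟩⟩
  · have hs := sqrt_nonneg lam
    rcases le_total θ z with h | h
    · refine ((h₁ lam f hlam hf).1 τ hτ θ ⟨hθ.1, h⟩).trans ?_
      gcongr
      linarith
    · refine ((h₂ lam f hlam hf).1 τ hτ θ ⟨h, hθ.2⟩).trans ?_
      gcongr
      linarith
  · have hm := measurable_lintegral_logPolar p (g := fun x => ‖f x‖ₑ ^ 6)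
      (hf.cont.measurable.enorm.pow_const 6) (Ioc x z)
    have h0 : 0 ≤ lam := by linarith
    rw [add_mul, ENNReal.ofReal_add (mul_nonneg hC₁ h0) (mul_nonneg hC₂ h0)]
    refine le_trans (le_of_eq ?_) (add_le_add (h₁ lam f hlam hf).2 (h₂ lam f hlam hf).2)
    rw [← lintegral_add_left hm]
    refine lintegral_congr fun τ => ?_
    rw [← add_mul, ← lintegral_union measurableSet_Ioc
      (Ioc_disjoint_Ioc_of_le le_rfl), Ioc_union_Ioc_eq_Ioc hxz hzy]

lemma EigField.energy_sector {F : Set Plane} {lam : ℝ} {f : Plane → ℝ} (h : EigField F lam f)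
    (p : Plane) (T : ℝ) {x y : ℝ} (hy : y ≤ x + 2 * π) :
    ∫⁻ τ in Iio T, (∫⁻ θ in Ioc x y, ENNReal.ofReal (f (logPolar p τ θ) ^ 2)) *
      ENNReal.ofReal (rexp (2 * τ)) ≤ 1 := by
  have hm : Measurable fun x => ENNReal.ofReal (f x ^ 2) :=
    (h.cont.measurable.pow_const 2).ennreal_ofReal
  refine le_trans ?_ h.energy
  rw [← lintegral_comp_logPolar p hm x]
  refine (setLIntegral_le_lintegral _ _).trans (lintegral_mono fun τ => ?_)
  exact mul_le_mul_left (lintegral_mono_set (Ioc_subset_Ioc_right hy)) _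

lemma sectorBound_of_isStarAt {F : Set Plane} (hF : IsClosed F) {p : Plane} {ε : ℝ} (hε : 0 < ε)
    {Θ : Set ℝ} (hΘ : ∀ τ < log ε, ∀ θ, logPolar p τ θ ∈ F ↔ θ ∈ Θ)
    (hfin : ∀ x y, (Θ ∩ Icc x y).Finite) (n : ℕ) :
    ∀ x y, x < y → y ≤ x + 2 * π → x ∈ Θ → y ∈ Θ → (Θ ∩ Ioo x y).ncard = n →
      SectorBound F p (ε / 8) x y := by
  have hfin' : ∀ x y, (Θ ∩ Ioo x y).Finite := fun x y =>
    (hfin x y).subset (inter_subset_inter_right _ Ioo_subset_Icc_self)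
  induction n using Nat.strong_induction_on with
  | _ n ih =>
  intro x y hxy hy hx hyΘ hn
  rcases eq_empty_or_nonempty (Θ ∩ Ioo x y) with h | ⟨z, hz, hxz, hzy⟩
  · obtain ⟨C, hC, hb⟩ := exists_bound_sector hε hxy hy
    refine ⟨C, hC, fun lam f hlam hf => ?_⟩
    obtain ⟨M, hM⟩ := hf.bdd
    obtain ⟨v₁, v₁₁, v₂, v₂₂, hv⟩ := hf.polarSol hF hM p (T := log ε) (D := Ioo x y)
      fun τ hτ θ hθ h' => by
        have : θ ∈ Θ ∩ Ioo x y := ⟨(hΘ τ hτ θ).mp h', hθ⟩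
        rw [h] at this
        exact this
    exact hb lam M _ v₁ v₁₁ v₂ v₂₂ hlam hv
      (fun τ hτ => hf.zero _ ((hΘ τ hτ x).mpr hx)) (fun τ hτ => hf.zero _ ((hΘ τ hτ y).mpr hyΘ))
      (hf.energy_sector p _ hy)
  · have h1 : (Θ ∩ Ioo x z).ncard < n := hn ▸ ncard_lt_ncard
      ((ssubset_iff_of_subset (inter_subset_inter_right _ (Ioo_subset_Ioo_right hzy.le))).mpr
        ⟨z, ⟨hz, hxz, hzy⟩, fun h => h.2.2.false⟩) (hfin' x y)
    have h2 : (Θ ∩ Ioo z y).ncard < n := hn ▸ ncard_lt_ncard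
      ((ssubset_iff_of_subset (inter_subset_inter_right _ (Ioo_subset_Ioo_left hxz.le))).mpr
        ⟨z, ⟨hz, hxz, hzy⟩, fun h => h.2.1.false⟩) (hfin' x y)
    exact (ih _ h1 x z hxz (by linarith) hx hz rfl).trans hxz.le hzy.le
      (ih _ h2 z y hzy (by linarith) hz hyΘ rfl)

lemma exists_sectorBound {F : Set Plane} (hF : IsClosed F) {p : Plane} (h : IsStarAt F p) :
    ∃ r > 0, ∃ c, SectorBound F p r c (c + 2 * π) := by
  obtain ⟨ε, hε, Θ, hΘ, hfin⟩ := h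
  refine ⟨ε / 8, by positivity, ?_⟩
  rcases eq_empty_or_nonempty Θ with h | ⟨c, hc⟩
  · obtain ⟨C, hC, hb⟩ := exists_bound_circle hε
    refine ⟨0, C, hC, fun lam f hlam hf => ?_⟩
    obtain ⟨M, hM⟩ := hf.bdd
    obtain ⟨v₁, v₁₁, v₂, v₂₂, hv⟩ := hf.polarSol hF hM p (T := log ε) (D := univ)
      fun τ hτ θ _ h' => by
        have := (hΘ τ hτ θ).mp h'
        rw [h] at this
        exact this
    rw [zero_add]
    obtain ⟨h1, h2⟩ := hb lam M _ v₁ v₁₁ v₂ v₂₂ hlam hv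
      (fun τ θ => by simp only [logPolar_add_two_pi]) (hf.energy_sector p _ (zero_add _).ge)
    exact ⟨fun τ hτ θ _ => h1 τ hτ θ, h2⟩
  · have hτ : log ε - 1 < log ε := by linarith
    have hc' : c + 2 * π ∈ Θ := by
      rw [← hΘ _ hτ, logPolar_add_two_pi, hΘ _ hτ]
      exact hc
    exact ⟨c, sectorBound_of_isStarAt hF hε hΘ hfin _ c _ (by linarith [two_pi_pos]) le_rfl hc hc'
      rfl⟩

/-- Local sup and `L⁶` estimates near a point where the nodal set `F` is star-shaped. -/
lemma exists_local_bound {F : Set Plane} (hF : IsClosed F) {p : Plane} (h : IsStarAt F p) :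
    ∃ r > 0, ∃ C : ℝ, 0 ≤ C ∧ ∀ (lam : ℝ) (f : Plane → ℝ), 1 ≤ lam → EigField F lam f →
      (∀ x ∈ Metric.ball p r, |f x| ≤ C * √lam) ∧
      ∫⁻ x in Metric.ball p r, ‖f x‖ₑ ^ 6 ≤ ENNReal.ofReal (C * lam) := by
  obtain ⟨r, hr, c, C, hC, hb⟩ := exists_sectorBound hF h
  refine ⟨r, hr, C, hC, fun lam f hlam hf => ?_⟩
  obtain ⟨h1, h2⟩ := hb lam f hlam hf
  refine ⟨fun x hx => ?_, ?_⟩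
  · by_cases hxp : x = p
    · rw [hxp]
      refine le_of_tendsto ((hf.cont.abs.tendsto p).comp (tendsto_logPolar_atBot p c)) ?_
      filter_upwards [Iio_mem_atBot (log r)] with τ hτ
      exact h1 τ hτ c ⟨le_rfl, by linarith [two_pi_pos]⟩
    · obtain ⟨θ, hθ, hθx⟩ := exists_logPolar_eq hxp c
      have := h1 _ (log_lt_log (dist_pos.mpr hxp) hx) θ (Ioc_subset_Icc_self hθ)
      rwa [hθx] at this
  · rwa [setLIntegral_ball_eq p (g := fun x => ‖f x‖ₑ ^ 6)
      (hf.cont.measurable.enorm.pow_const 6) c hr]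

end PolyEig

namespace PolyEig
open Real

lemma exists_bound_of_isCompact {F K : Set Plane} (hF : IsClosed F) (hstar : ∀ p, IsStarAt F p)
    (hK : IsCompact K) :
    ∃ C : ℝ, 0 ≤ C ∧ ∀ (lam : ℝ) (f : Plane → ℝ), 1 ≤ lam → EigField F lam f →
      (∀ x ∈ K, |f x| ≤ C * √lam) ∧ ∫⁻ x in K, ‖f x‖ₑ ^ 6 ≤ ENNReal.ofReal (C * lam) := by
  refine hK.induction_on (p := fun s => ∃ C : ℝ, 0 ≤ C ∧ ∀ (lam : ℝ) (f : Plane → ℝ), 1 ≤ lam →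
    EigField F lam f → (∀ x ∈ s, |f x| ≤ C * √lam) ∧
      ∫⁻ x in s, ‖f x‖ₑ ^ 6 ≤ ENNReal.ofReal (C * lam)) ?_ ?_ ?_ ?_
  · exact ⟨0, le_rfl, fun lam f _ _ => by simp⟩
  · rintro s t hst ⟨C, hC, h⟩
    exact ⟨C, hC, fun lam f hlam hf => ⟨fun x hx => (h lam f hlam hf).1 x (hst hx),
      (lintegral_mono_set hst).trans (h lam f hlam hf).2⟩⟩
  · rintro s t ⟨C₁, hC₁, h₁⟩ ⟨C₂, hC₂, h₂⟩
    refine ⟨C₁ + C₂, add_nonneg hC₁ hC₂, fun lam f hlam hf => ⟨?_, ?_⟩⟩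
    · have hs := sqrt_nonneg lam
      rintro x (hx | hx)
      · refine ((h₁ lam f hlam hf).1 x hx).trans ?_
        gcongr
        linarith
      · refine ((h₂ lam f hlam hf).1 x hx).trans ?_
        gcongr
        linarith
    · have h0 : 0 ≤ lam := by linarith
      rw [add_mul, ENNReal.ofReal_add (mul_nonneg hC₁ h0) (mul_nonneg hC₂ h0)]
      exact (lintegral_union_le _ _ _).trans
        (add_le_add (h₁ lam f hlam hf).2 (h₂ lam f hlam hf).2)
  · intro p _
    obtain ⟨r, hr, h⟩ := exists_local_bound hF (hstar p)
    exact ⟨Metric.ball p r, mem_nhdsWithin_of_mem_nhds (Metric.ball_mem_nhds p hr), h⟩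

section
variable {α : Type*} [MeasurableSpace α] {μ : Measure α} {f : α → ℝ} {C lam : ℝ}

lemma eLpNorm_le_of_two_of_six (hf : AEMeasurable f μ) (h2 : ∫⁻ x, ‖f x‖ₑ ^ (2 : ℝ) ∂μ ≤ 1)
    (hC : 0 ≤ C) (hlam : 0 ≤ lam) (h6 : ∫⁻ x, ‖f x‖ₑ ^ (6 : ℝ) ∂μ ≤ ENNReal.ofReal (C * lam))
    {q : ℝ≥0∞} (hq2 : 2 ≤ q) (hq6 : q ≤ 6) {δ : ℝ} (hδ : δ = (1/2) * (1/2 - 1/q.toReal)) :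
    eLpNorm f q μ ≤ ENNReal.ofReal (C ^ δ * lam ^ δ) := by
  have hqt : q ≠ ⊤ := ne_top_of_le_ne_top (by norm_num) hq6
  have hr2 : 2 ≤ q.toReal := by simpa using ENNReal.toReal_mono hqt hq2
  have hr6 : q.toReal ≤ 6 := by simpa using ENNReal.toReal_mono (by norm_num) hq6
  have hq0 : q ≠ 0 := fun h => by simp [h] at hq2
  rw [eLpNorm_eq_lintegral_rpow_enorm_toReal hq0 hqt]
  set r := q.toReal
  have hδ' : (r - 2) / 4 * (1 / r) = δ := by
    rw [hδ]
    field_simp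
    ring
  have hδ0 : 0 ≤ δ := hδ' ▸ mul_nonneg (by linarith) (by positivity)
  have key : ∫⁻ x, ‖f x‖ₑ ^ r ∂μ ≤ ENNReal.ofReal (C * lam) ^ ((r - 2) / 4) := by
    have h := ENNReal.lintegral_mul_norm_pow_le (μ := μ) (f := fun x => ‖f x‖ₑ ^ (2 : ℝ))
      (g := fun x => ‖f x‖ₑ ^ (6 : ℝ)) (p := (6 - r) / 4) (q := (r - 2) / 4)
      (hf.enorm.pow_const 2) (hf.enorm.pow_const 6) (by linarith) (by linarith) (by ring)
    calc ∫⁻ x, ‖f x‖ₑ ^ r ∂μ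
        = ∫⁻ x, (‖f x‖ₑ ^ (2 : ℝ)) ^ ((6 - r) / 4) * (‖f x‖ₑ ^ (6 : ℝ)) ^ ((r - 2) / 4) ∂μ := by
          refine lintegral_congr fun x => ?_
          rw [← ENNReal.rpow_mul, ← ENNReal.rpow_mul,
            ← ENNReal.rpow_add_of_nonneg _ _ (by linarith) (by linarith)]
          congr 1
          ring
      _ ≤ _ := h
      _ ≤ 1 ^ ((6 - r) / 4) * ENNReal.ofReal (C * lam) ^ ((r - 2) / 4) :=
          mul_le_mul' (ENNReal.rpow_le_rpow h2 (by linarith))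
            (ENNReal.rpow_le_rpow h6 (by linarith))
      _ = _ := by rw [ENNReal.one_rpow, one_mul]
  calc (∫⁻ x, ‖f x‖ₑ ^ r ∂μ) ^ (1 / r)
      ≤ (ENNReal.ofReal (C * lam) ^ ((r - 2) / 4)) ^ (1 / r) :=
        ENNReal.rpow_le_rpow key (by positivity)
    _ = ENNReal.ofReal (C ^ δ * lam ^ δ) := by
        rw [← ENNReal.rpow_mul, hδ', ENNReal.ofReal_rpow_of_nonneg (by positivity) hδ0,
          mul_rpow hC hlam]

lemma eLpNorm_le_of_six_of_bound (hC : 0 ≤ C) (hlam : 0 < lam)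
    (h6 : ∫⁻ x, ‖f x‖ₑ ^ (6 : ℝ) ∂μ ≤ ENNReal.ofReal (C * lam))
    (hb : ∀ᵐ x ∂μ, ‖f x‖ ≤ C * √lam) {q : ℝ≥0∞} (hq6 : 6 ≤ q) {δ : ℝ}
    (hδ : δ = 2 * (1/2 - 1/q.toReal) - 1/2) :
    eLpNorm f q μ ≤ ENNReal.ofReal ((if q = ⊤ then C else (C ^ (q.toReal - 6) * C) ^ (1/q.toReal))
      * lam ^ δ) := by
  split_ifs with hqt
  · have : δ = 1 / 2 := by
      rw [hδ, hqt]
      norm_num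
    rw [hqt, eLpNorm_exponent_top, this, ← sqrt_eq_rpow]
    exact eLpNormEssSup_le_of_ae_bound hb
  have hr6 : 6 ≤ q.toReal := by simpa using ENNReal.toReal_mono hqt hq6
  have hq0 : q ≠ 0 := fun h => by simp [h] at hq6
  rw [eLpNorm_eq_lintegral_rpow_enorm_toReal hq0 hqt]
  set r := q.toReal
  have key : ∫⁻ x, ‖f x‖ₑ ^ r ∂μ ≤
      ENNReal.ofReal (C * √lam) ^ (r - 6) * ENNReal.ofReal (C * lam) := by
    calc ∫⁻ x, ‖f x‖ₑ ^ r ∂μ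
        ≤ ∫⁻ x, ENNReal.ofReal (C * √lam) ^ (r - 6) * ‖f x‖ₑ ^ (6 : ℝ) ∂μ := by
          refine lintegral_mono_ae (hb.mono fun x hx => ?_)
          rw [show r = (r - 6) + 6 by ring, ENNReal.rpow_add_of_nonneg _ _ (by linarith)
            (by norm_num), add_sub_cancel_right]
          refine mul_le_mul_left (ENNReal.rpow_le_rpow ?_ (by linarith)) _
          rw [← ofReal_norm]
          exact ENNReal.ofReal_le_ofReal hx
      _ = ENNReal.ofReal (C * √lam) ^ (r - 6) * ∫⁻ x, ‖f x‖ₑ ^ (6 : ℝ) ∂μ :=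
          lintegral_const_mul' _ _ (ENNReal.rpow_ne_top_of_nonneg (by linarith)
            ENNReal.ofReal_ne_top)
      _ ≤ _ := by gcongr
  refine (ENNReal.rpow_le_rpow key (by positivity)).trans (le_of_eq ?_)
  have hl : 0 ≤ C * √lam := by positivity
  rw [ENNReal.ofReal_rpow_of_nonneg hl (by linarith), ← ENNReal.ofReal_mul (by positivity),
    ENNReal.ofReal_rpow_of_nonneg (by positivity) (by positivity)]
  congr 1
  have hs : (√lam) ^ (r - 6) * lam = lam ^ (δ * r) := by
    rw [sqrt_eq_rpow, ← rpow_mul hlam.le]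
    nth_rewrite 2 [← rpow_one lam]
    rw [← rpow_add hlam, hδ]
    congr 1
    field_simp
    ring
  rw [mul_rpow hC (sqrt_nonneg _), show C ^ (r - 6) * (√lam) ^ (r - 6) * (C * lam) =
    (C ^ (r - 6) * C) * ((√lam) ^ (r - 6) * lam) by ring, hs,
    mul_rpow (by positivity) (by positivity), ← rpow_mul hlam.le, mul_assoc δ,
    mul_one_div_cancel (by linarith), mul_one]

end

end PolyEig

/-- `L^q` eigenfunction bounds for Dirichlet eigenfunctions on a polygonal domain,
for `2 ≤ q ≤ ∞`.  (For `q = ∞` one has `q.toReal = 0`, hence `1/q.toReal = 0` and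
`δ = 2 * (1/2 - 0) - 1/2 = 1/2`, as required.) -/
theorem eigenfunction_Lq_estimate_polygon
    (Ω : Set (EuclideanSpace ℝ (Fin 2))) (hΩ : IsPolygonalDomain Ω)
    (q : ℝ≥0∞) (hq : 2 ≤ q)
    (δ : ℝ)
    (hδ₁ : q ≤ 6 → δ = (1/2) * (1/2 - 1/q.toReal))
    (hδ₂ : 6 ≤ q → δ = 2 * (1/2 - 1/q.toReal) - 1/2) :
    ∃ C : ℝ, ∀ (φ : EuclideanSpace ℝ (Fin 2) → ℝ) (lam : ℝ), 1 ≤ lam →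
      ContDiffOn ℝ (⊤ : ℕ∞) φ Ω →
      ContinuousOn φ (closure Ω) →
      (∀ x ∈ frontier Ω, φ x = 0) →
      (∀ x ∈ Ω, -planeLaplacian φ x = lam ^ 2 * φ x) →
      eLpNorm φ 2 (volume.restrict Ω) = 1 →
      eLpNorm φ q (volume.restrict Ω) ≤ ENNReal.ofReal (C * lam ^ δ) := by
  obtain ⟨hopen, -, hbdd, n, a, b, hab⟩ := hΩ
  obtain ⟨C, hC, h⟩ := PolyEig.exists_bound_of_isCompact (F := frontier Ω) isClosed_frontier
    (fun p => (PolyEig.isStarAt_iUnion_segment a b p).congr hab.symm)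
    (Metric.isCompact_of_isClosed_isBounded isClosed_closure hbdd.closure)
  have main : ∀ (φ : EuclideanSpace ℝ (Fin 2) → ℝ) (lam : ℝ), 1 ≤ lam →
      ContDiffOn ℝ (⊤ : ℕ∞) φ Ω → ContinuousOn φ (closure Ω) → (∀ x ∈ frontier Ω, φ x = 0) →
      (∀ x ∈ Ω, -planeLaplacian φ x = lam ^ 2 * φ x) → eLpNorm φ 2 (volume.restrict Ω) = 1 →
      AEMeasurable φ (volume.restrict Ω) ∧ (∀ᵐ x ∂volume.restrict Ω, ‖φ x‖ ≤ C * √lam) ∧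
      ∫⁻ x in Ω, ‖φ x‖ₑ ^ (2 : ℝ) ≤ 1 ∧
      ∫⁻ x in Ω, ‖φ x‖ₑ ^ (6 : ℝ) ≤ ENNReal.ofReal (C * lam) := by
    intro φ lam hlam h1 h2 h3 h4 h5
    have hf := PolyEig.eigField_indicator hopen hbdd h1 h2 h3 h4 h5
    obtain ⟨hsup, hsix⟩ := h lam _ hlam hf
    refine ⟨(h2.mono subset_closure).aemeasurable hopen.measurableSet, ?_, ?_, ?_⟩
    · refine (ae_restrict_iff' hopen.measurableSet).mpr (ae_of_all _ fun x hx => ?_)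
      have := hsup x (subset_closure hx)
      rwa [indicator_of_mem hx] at this
    · refine le_trans (le_trans (le_of_eq ?_) (setLIntegral_le_lintegral Ω _)) hf.energy
      refine setLIntegral_congr_fun hopen.measurableSet fun x hx => ?_
      simp only [indicator_of_mem hx]
      rw [← sq_abs, ENNReal.ofReal_pow (abs_nonneg _), Real.enorm_eq_ofReal_abs]
      norm_cast
    · refine le_trans (le_trans (le_of_eq ?_) (lintegral_mono_set subset_closure)) hsix
      refine setLIntegral_congr_fun hopen.measurableSet fun x hx => ?_
      simp only [indicator_of_mem hx]
      norm_cast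
  rcases le_total q 6 with hq6 | hq6
  · refine ⟨C ^ δ, fun φ lam hlam h1 h2 h3 h4 h5 => ?_⟩
    obtain ⟨hm, -, htwo, hsix⟩ := main φ lam hlam h1 h2 h3 h4 h5
    exact PolyEig.eLpNorm_le_of_two_of_six hm htwo hC (by linarith) hsix hq hq6 (hδ₁ hq6)
  · refine ⟨if q = ⊤ then C else (C ^ (q.toReal - 6) * C) ^ (1 / q.toReal),
      fun φ lam hlam h1 h2 h3 h4 h5 => ?_⟩
    obtain ⟨-, hb, -, hsix⟩ := main φ lam hlam h1 h2 h3 h4 h5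
    exact PolyEig.eLpNorm_le_of_six_of_bound hC (by linarith) hsix hb hq6 (hδ₂ hq6)
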